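/- (Guth–Katz incidence theorem) There is an absolute constant C such that the following holds. Let P be a finite set of points and L a finite set of lines in ℝ³, and let s ≤ |L| be a parameter such that no affine plane contains more than s lines of L. Then the number of incidences I(P,L) = #{(p,l) ∈ P × L : p ∈ l} satisfies I(P,L) ≤ C·(|L|^{3/4}·|P|^{1/2} + s^{1/3}·|L|^{1/3}·|P|^{2/3} + |L| + |P|). -/

import Mathlib

open scoped Classical

/-- A line in `ℝ³`: a one-dimensional affine subspace, as a set of points. -/
def IsLine (l : Set (Fin 3 → ℝ)) : Prop :=
  ∃ p v : Fin 3 → ℝ, v ≠ 0 ∧ l = {x | ∃ t : ℝ, x = p + t • v}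

/-- An affine plane in `ℝ³`: the solution set of a nontrivial linear equation. -/
def IsPlane (π : Set (Fin 3 → ℝ)) : Prop :=
  ∃ (f : Fin 3 → ℝ) (c : ℝ), f ≠ 0 ∧ π = {x | ∑ i, f i * x i = c}

section ModTwoChains

variable {E : Type*}

/-- Chains with coefficients in `ℤ/2` on unordered simplices, given by their vertices. -/
abbrev ModTwoChain (E : Type*) := Multiset E →₀ ZMod 2

namespace ModTwoChain

/-- The cone with apex `v`. -/
noncomputable def cone (v : E) : ModTwoChain E →ₗ[ZMod 2] ModTwoChain E :=
  Finsupp.lmapDomain _ _ (fun m => v ::ₘ m)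

/-- The sum of the facets of a simplex. -/
noncomputable def facetSum (m : Multiset E) : ModTwoChain E :=
  (m.map fun v => Finsupp.single (m.erase v) 1).sum

/-- The augmented boundary operator. -/
noncomputable def bdry : ModTwoChain E →ₗ[ZMod 2] ModTwoChain E :=
  Finsupp.linearCombination (ZMod 2) facetSum

/-- The chain map induced by a map of vertices. -/
noncomputable def push {F : Type*} (g : E → F) : ModTwoChain E →ₗ[ZMod 2] ModTwoChain F :=
  Finsupp.lmapDomain _ _ (Multiset.map g)

lemma cone_single (v : E) (m : Multiset E) :
    cone v (Finsupp.single m 1) = Finsupp.single (v ::ₘ m) 1 := by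
  simp [cone]

lemma bdry_single (m : Multiset E) : bdry (Finsupp.single m 1) = facetSum m := by
  simp [bdry]

lemma push_single {F : Type*} (g : E → F) (m : Multiset E) :
    push g (Finsupp.single m 1) = Finsupp.single (m.map g) 1 := by
  simp [push]

/-- Linear maps on chains agree as soon as they agree on simplices. -/
lemma linearMap_eqOn {V : Type*} [AddCommMonoid V] [Module (ZMod 2) V] {s : Set (Multiset E)}
    (φ ψ : ModTwoChain E →ₗ[ZMod 2] V)
    (h : ∀ m ∈ s, φ (Finsupp.single m 1) = ψ (Finsupp.single m 1)) {c : ModTwoChain E}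
    (hc : c ∈ Finsupp.supported (ZMod 2) (ZMod 2) s) : φ c = ψ c := by
  rw [Finsupp.supported_eq_span_single] at hc
  refine LinearMap.eqOn_span (s := (fun i => Finsupp.single i (1 : ZMod 2)) '' s) ?_ hc
  rintro _ ⟨m, hm, rfl⟩
  exact h m hm

/-- A linear map carries chains supported on `s` into a submodule containing the images of the
simplices in `s`. -/
lemma map_mem_of_supported {V : Type*} [AddCommMonoid V] [Module (ZMod 2) V]
    {s : Set (Multiset E)} (φ : ModTwoChain E →ₗ[ZMod 2] V) (W : Submodule (ZMod 2) V)
    (h : ∀ m ∈ s, φ (Finsupp.single m 1) ∈ W) {c : ModTwoChain E}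
    (hc : c ∈ Finsupp.supported (ZMod 2) (ZMod 2) s) : φ c ∈ W := by
  rw [Finsupp.supported_eq_span_single] at hc
  have : Submodule.span (ZMod 2) ((fun i => Finsupp.single i (1 : ZMod 2)) '' s) ≤ W.comap φ := by
    rw [Submodule.span_le]
    rintro _ ⟨m, hm, rfl⟩
    exact h m hm
  exact this hc

lemma facetSum_cons (v : E) (m : Multiset E) :
    facetSum (v ::ₘ m) = Finsupp.single m 1 + cone v (facetSum m) := by
  have h : ∀ w ∈ m, (Finsupp.single ((v ::ₘ m).erase w) 1 : ModTwoChain E)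
      = cone v (Finsupp.single (m.erase w) 1) := by
    intro w hw
    rw [cone_single]
    by_cases hvw : w = v
    · subst hvw
      rw [Multiset.erase_cons_head, Multiset.cons_erase hw]
    · rw [Multiset.erase_cons_tail _ (fun h => hvw h.symm)]
  unfold facetSum
  rw [Multiset.map_cons, Multiset.sum_cons, Multiset.erase_cons_head, Multiset.map_congr rfl h,
    map_multiset_sum, Multiset.map_map]
  rfl

lemma bdry_cone (v : E) (c : ModTwoChain E) : bdry (cone v c) = c + cone v (bdry c) := by
  refine linearMap_eqOn (s := Set.univ) (bdry ∘ₗ cone v) (LinearMap.id + cone v ∘ₗ bdry)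
    (fun m _ => ?_) (by simp)
  simp [cone_single, bdry_single, facetSum_cons]

lemma push_cone {F : Type*} (g : E → F) (v : E) (c : ModTwoChain E) :
    push g (cone v c) = cone (g v) (push g c) := by
  refine linearMap_eqOn (s := Set.univ) (push g ∘ₗ cone v) (cone (g v) ∘ₗ push g)
    (fun m _ => ?_) (by simp)
  simp [cone_single, push_single]

lemma bdry_facetSum (m : Multiset E) : bdry (facetSum m) = 0 := by
  induction m using Multiset.induction with
  | empty => simp [facetSum]
  | cons v m ih =>
    rw [facetSum_cons, map_add, bdry_cone, bdry_single, ih, map_zero, add_zero]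
    exact ZModModule.add_self _

lemma bdry_push {F : Type*} (g : E → F) (c : ModTwoChain E) :
    bdry (push g c) = push g (bdry c) := by
  refine linearMap_eqOn (s := Set.univ) (bdry ∘ₗ push g) (push g ∘ₗ bdry)
    (fun m _ => ?_) (by simp)
  simp only [LinearMap.comp_apply, push_single, bdry_single]
  induction m using Multiset.induction with
  | empty => simp [facetSum]
  | cons v m ih =>
    rw [Multiset.map_cons, facetSum_cons, facetSum_cons, map_add, push_single, push_cone,
      ih (Set.mem_univ _)]

lemma facetSum_mem_supported {m : Multiset E} {s : Set (Multiset E)}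
    (h : ∀ v ∈ m, m.erase v ∈ s) :
    facetSum m ∈ Finsupp.supported (ZMod 2) (ZMod 2) s := by
  unfold facetSum
  refine multiset_sum_mem _ fun c hc => ?_
  obtain ⟨v, hv, rfl⟩ := Multiset.mem_map.1 hc
  exact Finsupp.single_mem_supported _ _ (h v hv)

lemma bdry_mem_supported_card {k : ℕ} {c : ModTwoChain E}
    (hc : c ∈ Finsupp.supported (ZMod 2) (ZMod 2) {m : Multiset E | m.card = k + 1}) :
    bdry c ∈ Finsupp.supported (ZMod 2) (ZMod 2) {m : Multiset E | m.card = k} := by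
  refine map_mem_of_supported _ _ (fun m hm => ?_) hc
  rw [bdry_single]
  refine facetSum_mem_supported fun v hv => ?_
  simp only [Set.mem_ofPred_eq] at hm ⊢
  rw [Multiset.card_erase_of_mem hv, hm]
  rfl

section Subdivision

variable [AddCommGroup E] [Module ℝ E]

/-- The barycentre of a simplex. -/
noncomputable def barycentre (m : Multiset E) : E := (m.card : ℝ)⁻¹ • m.sum

/-- Barycentric subdivision of chains of simplices with `k` vertices. -/
noncomputable def subdiv : ℕ → ModTwoChain E →ₗ[ZMod 2] ModTwoChain E
  | 0 => LinearMap.id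
  | k + 1 => Finsupp.linearCombination (ZMod 2)
      (fun m => cone (barycentre m) (subdiv k (facetSum m)))

lemma subdiv_zero (c : ModTwoChain E) : subdiv 0 c = c := by
  simp [subdiv]

lemma subdiv_succ_single (k : ℕ) (m : Multiset E) :
    subdiv (k + 1) (Finsupp.single m 1) = cone (barycentre m) (subdiv k (facetSum m)) := by
  simp [subdiv]

attribute [irreducible] subdiv

lemma bdry_subdiv (k : ℕ) {c : ModTwoChain E}
    (hc : c ∈ Finsupp.supported (ZMod 2) (ZMod 2) {m : Multiset E | m.card = k + 1}) :
    bdry (subdiv (k + 1) c) = subdiv k (bdry c) := by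
  induction k generalizing c with
  | zero =>
    rw [← LinearMap.comp_apply, ← LinearMap.comp_apply]
    refine linearMap_eqOn _ _ (fun m hm => ?_) hc
    simp only [Set.mem_ofPred_eq, zero_add] at hm
    obtain ⟨v, rfl⟩ := Multiset.card_eq_one.1 hm
    have h1 : facetSum ({v} : Multiset E) = Finsupp.single 0 1 := by
      simp [facetSum]
    have h2 : facetSum (0 : Multiset E) = 0 := by
      simp [facetSum]
    rw [LinearMap.comp_apply, LinearMap.comp_apply, subdiv_succ_single, bdry_single, h1, bdry_cone]
    rw [subdiv_zero, bdry_single, h2, map_zero, add_zero]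
  | succ k ih =>
    rw [← LinearMap.comp_apply, ← LinearMap.comp_apply]
    refine linearMap_eqOn _ _ (fun m hm => ?_) hc
    have hf : facetSum m ∈ Finsupp.supported (ZMod 2) (ZMod 2)
        {m : Multiset E | m.card = k + 1} := by
      rw [← bdry_single]
      exact bdry_mem_supported_card (Finsupp.single_mem_supported _ _ hm)
    simp only [LinearMap.comp_apply, subdiv_succ_single k.succ, bdry_single, bdry_cone, ih hf,
      bdry_facetSum, map_zero, add_zero]

lemma barycentre_map {F : Type*} [AddCommGroup F] [Module ℝ F] (g : E →ₗ[ℝ] F) (m : Multiset E) :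
    barycentre (m.map g) = g (barycentre m) := by
  simp [barycentre, map_multiset_sum]

lemma push_subdiv {F : Type*} [AddCommGroup F] [Module ℝ F] (g : E →ₗ[ℝ] F) (k : ℕ)
    (c : ModTwoChain E) : push g (subdiv k c) = subdiv k (push g c) := by
  induction k generalizing c with
  | zero => rw [subdiv_zero, subdiv_zero]
  | succ k ih =>
    refine linearMap_eqOn (s := Set.univ) (push g ∘ₗ subdiv (k + 1)) (subdiv (k + 1) ∘ₗ push g)
      (fun m _ => ?_) (by simp)
    simp only [LinearMap.comp_apply, subdiv_succ_single, push_single, push_cone, ih,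
      barycentre_map]
    rw [← bdry_single, ← bdry_push, push_single, bdry_single]

end Subdivision

section Mesh

variable [NormedAddCommGroup E] [NormedSpace ℝ E]

lemma barycentre_mem {s : Set E} (hs : Convex ℝ s) {m : Multiset E} (hm : ∀ x ∈ m, x ∈ s)
    (h0 : m ≠ 0) : barycentre m ∈ s := by
  have hc : (0 : ℝ) < m.card := by
    exact_mod_cast Multiset.card_pos.2 h0
  induction m using Quotient.inductionOn with
  | h l =>
    have : barycentre (l : Multiset E) = ∑ i : Fin l.length, (l.length : ℝ)⁻¹ • l.get i := by
      simp only [barycentre, Multiset.coe_card, Multiset.sum_coe, ← Finset.smul_sum]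
      congr 1
      simp [Fin.sum_univ_getElem]
    change barycentre (l : Multiset E) ∈ s
    rw [this]
    have hl : (0 : ℝ) < l.length := by simpa using hc
    refine hs.sum_mem (fun i _ => by positivity) ?_ (fun i _ => hm _ ?_)
    · simp [hl.ne']
    · simp

lemma dist_barycentre_le {m : Multiset E} {n : ℕ} {δ : ℝ} (hδ : 0 ≤ δ) (hn : m.card ≤ n + 1)
    (hm : ∀ x ∈ m, ∀ y ∈ m, dist x y ≤ δ) {y : E} (hy : y ∈ m) :
    dist y (barycentre m) ≤ n / (n + 1) * δ := by
  obtain ⟨m', rfl⟩ := Multiset.exists_cons_of_mem hy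
  set k := m'.card with hk
  have hkn : (k : ℝ) ≤ n := by
    have : k ≤ n := by simpa using hn
    exact_mod_cast this
  have hk0 : (0 : ℝ) ≤ k := Nat.cast_nonneg k
  have h1 : barycentre (y ::ₘ m') - y = ((k : ℝ) + 1)⁻¹ • (m'.map (fun x => x - y)).sum := by
    have h2 : (m'.map (fun x => x - y)).sum = m'.sum - (k : ℝ) • y := by
      rw [Multiset.sum_map_sub]
      simp [hk, Nat.cast_smul_eq_nsmul]
    have hk1 : (k : ℝ) + 1 ≠ 0 := by positivity
    rw [h2]
    simp only [barycentre, Multiset.card_cons, Multiset.sum_cons, ← hk, Nat.cast_add, Nat.cast_one]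
    match_scalars
    · field_simp
      ring
    · field_simp
  have h4 : ‖(m'.map (fun x => x - y)).sum‖ ≤ k * δ := by
    have : ‖(m'.map (fun x => x - y)).sum‖ ≤ ((m'.map (fun x => x - y)).map norm).sum :=
      norm_multiset_sum_le _
    refine this.trans ?_
    have h5 := Multiset.sum_le_card_nsmul ((m'.map (fun x => x - y)).map norm) δ ?_
    · simpa [hk] using h5
    · intro z hz
      simp only [Multiset.map_map, Multiset.mem_map, Function.comp] at hz
      obtain ⟨x, hx, rfl⟩ := hz
      rw [← dist_eq_norm]
      exact hm x (Multiset.mem_cons_of_mem hx) y hy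
  rw [dist_comm, dist_eq_norm, h1, norm_smul, Real.norm_of_nonneg (by positivity)]
  calc ((k : ℝ) + 1)⁻¹ * ‖(m'.map (fun x => x - y)).sum‖ ≤ ((k : ℝ) + 1)⁻¹ * (k * δ) := by gcongr
    _ = k / (k + 1) * δ := by ring
    _ ≤ n / (n + 1) * δ := by
      gcongr ?_ * _
      rw [div_le_div_iff₀ (by positivity) (by positivity)]
      nlinarith

/-- Subdividing shrinks simplices by the factor `n / (n + 1)` and does not leave convex sets. -/
lemma subdiv_single_mem_supported {n : ℕ} {δ : ℝ} (hδ : 0 ≤ δ) (k : ℕ) (hk : k ≤ n + 1)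
    {s : Set E} (hs : Convex ℝ s) {m : Multiset E} (hcard : m.card = k) (hms : ∀ x ∈ m, x ∈ s)
    (hm : ∀ x ∈ m, ∀ y ∈ m, dist x y ≤ δ) :
    subdiv k (Finsupp.single m 1) ∈ Finsupp.supported (ZMod 2) (ZMod 2)
      {m' : Multiset E | m'.card = k ∧ (∀ x ∈ m', x ∈ s) ∧
        ∀ x ∈ m', ∀ y ∈ m', dist x y ≤ n / (n + 1) * δ} := by
  induction k generalizing s m with
  | zero =>
    rw [subdiv_zero]
    refine Finsupp.single_mem_supported _ _ ?_
    rw [Multiset.card_eq_zero] at hcard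
    simp [hcard]
  | succ k ih =>
    have hm0 : m ≠ 0 := by
      rintro rfl
      simp at hcard
    rw [subdiv_succ_single]
    set ρ := (n : ℝ) / (n + 1) * δ with hρ
    have hρ0 : 0 ≤ ρ := by positivity
    have hs' : Convex ℝ (s ∩ Metric.closedBall (barycentre m) ρ) :=
      hs.inter (convex_closedBall _ _)
    have hms' : ∀ x ∈ m, x ∈ s ∩ Metric.closedBall (barycentre m) ρ := fun x hx =>
      ⟨hms x hx, Metric.mem_closedBall.2 (dist_barycentre_le hδ (by omega) hm hx)⟩
    have hfacets : subdiv k (facetSum m) ∈ Finsupp.supported (ZMod 2) (ZMod 2)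
        {m' : Multiset E | m'.card = k ∧ (∀ x ∈ m', x ∈ s ∩ Metric.closedBall (barycentre m) ρ) ∧
          ∀ x ∈ m', ∀ y ∈ m', dist x y ≤ ρ} := by
      refine map_mem_of_supported (s := {m' | ∃ v ∈ m, m' = m.erase v}) _ _ ?_
        (facetSum_mem_supported fun v hv => ⟨v, hv, rfl⟩)
      rintro _ ⟨v, hv, rfl⟩
      refine ih (by omega) hs' ?_ (fun x hx => hms' x (Multiset.mem_of_mem_erase hx))
        (fun x hx y hy => hm x (Multiset.mem_of_mem_erase hx) y (Multiset.mem_of_mem_erase hy))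
      rw [Multiset.card_erase_of_mem hv, hcard]
      rfl
    refine map_mem_of_supported _ _ ?_ hfacets
    rintro m' ⟨h1, h2, h3⟩
    rw [cone_single]
    refine Finsupp.single_mem_supported _ _ ⟨by simp [h1], ?_, ?_⟩
    · intro x hx
      rcases Multiset.mem_cons.1 hx with rfl | hx
      · exact barycentre_mem hs hms hm0
      · exact (h2 x hx).1
    · intro x hx y hy
      rcases Multiset.mem_cons.1 hx with rfl | hx <;> rcases Multiset.mem_cons.1 hy with rfl | hy
      · simpa using hρ0
      · rw [dist_comm]
        exact Metric.mem_closedBall.1 (h2 y hy).2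
      · exact Metric.mem_closedBall.1 (h2 x hx).2
      · exact h3 x hx y hy

end Mesh

end ModTwoChain

end ModTwoChains

section AlternatingLabels

variable {Λ : Type*}

/-- The sum of `φ` over all lists obtained from a list by deleting one entry. -/
def deletionSum (φ : List Λ → ZMod 2) : List Λ → ZMod 2
  | [] => 0
  | a :: l => φ l + deletionSum (fun r => φ (a :: r)) l

/-- `1` if `h` alternates along the list and `0` otherwise. -/
def alternation (h : Λ → ZMod 2) : List Λ → ZMod 2
  | [] => 1
  | [_] => 1
  | a :: b :: l => (h a + h b) * alternation h (b :: l)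

/-- `1` if `h` alternates along the list, starting with `1`, and `0` otherwise. -/
def positiveAlternation (h : Λ → ZMod 2) : List Λ → ZMod 2
  | [] => 0
  | a :: l => h a * alternation h (a :: l)

lemma deletionSum_mul (r : ZMod 2) (φ : List Λ → ZMod 2) (l : List Λ) :
    deletionSum (fun l' => r * φ l') l = r * deletionSum φ l := by
  induction l generalizing φ with
  | nil => simp [deletionSum]
  | cons a l ih => simp [deletionSum, ih (fun l' => φ (a :: l')), mul_add]

lemma deletionSum_congr {φ ψ : List Λ → ZMod 2} {l : List Λ}
    (h : ∀ l', l'.Sublist l → φ l' = ψ l') : deletionSum φ l = deletionSum ψ l := by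
  induction l generalizing φ ψ with
  | nil => rfl
  | cons a l ih =>
    simp only [deletionSum]
    rw [h l (List.sublist_cons_self a l)]
    congr 1
    exact ih fun l' hl' => h _ (hl'.cons_cons a)

lemma zmod_two_add_self (x : ZMod 2) : x + x = 0 := CharTwo.add_self_eq_zero x

lemma deletionSum_alternation (h : Λ → ZMod 2) (a b : Λ) (l : List Λ) :
    deletionSum (alternation h) (a :: b :: l) = 0 := by
  induction l generalizing a b with
  | nil => simp [deletionSum, alternation, zmod_two_add_self]
  | cons c l ih =>
    have h1 := ih b c
    simp only [deletionSum] at h1 ⊢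
    have h2 : (fun l' => alternation h (a :: b :: l')) =
        fun l' => (h a + h b) * alternation h (b :: l') := rfl
    have h3 : deletionSum (fun l' => alternation h (a :: b :: c :: l')) l =
        (h a + h b) * deletionSum (fun l' => alternation h (b :: c :: l')) l :=
      deletionSum_mul _ (fun l' => alternation h (b :: c :: l')) l
    rw [h3]
    simp only [alternation] at h1 ⊢
    linear_combination (h a + h b) * h1 + zmod_two_add_self (h c * alternation h (c :: l))

lemma deletionSum_positiveAlternation (h : Λ → ZMod 2) (a b : Λ) (l : List Λ) :
    deletionSum (positiveAlternation h) (a :: b :: l) = alternation h (a :: b :: l) := by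
  have h1 := deletionSum_alternation h a b l
  have h2 : deletionSum (fun l' => positiveAlternation h (a :: l')) (b :: l) =
      h a * deletionSum (fun l' => alternation h (a :: l')) (b :: l) :=
    deletionSum_mul _ (fun l' => alternation h (a :: l')) (b :: l)
  have h3 : deletionSum (alternation h) (a :: b :: l) =
      alternation h (b :: l) + deletionSum (fun l' => alternation h (a :: l')) (b :: l) := rfl
  have h4 : deletionSum (positiveAlternation h) (a :: b :: l) =
      h b * alternation h (b :: l) +
        deletionSum (fun l' => positiveAlternation h (a :: l')) (b :: l) := rfl
  rw [h4, h2]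
  simp only [alternation]
  rw [h3] at h1
  linear_combination h a * h1 - zmod_two_add_self (h a * alternation h (b :: l))

lemma alternation_map {f : Λ → Λ} {h : Λ → ZMod 2} (hf : ∀ a, h (f a) = h a + 1) (l : List Λ) :
    alternation h (l.map f) = alternation h l := by
  induction l with
  | nil => rfl
  | cons a l ih =>
    cases l with
    | nil => rfl
    | cons b l =>
      simp only [List.map_cons, alternation, hf] at ih ⊢
      rw [ih]
      linear_combination alternation h (b :: l) * zmod_two_add_self 1

lemma positiveAlternation_add_map {f : Λ → Λ} {h : Λ → ZMod 2} (hf : ∀ a, h (f a) = h a + 1)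
    {l : List Λ} (hl : l ≠ []) :
    positiveAlternation h l + positiveAlternation h (l.map f) = alternation h l := by
  cases l with
  | nil => exact absurd rfl hl
  | cons a l =>
    have := alternation_map hf (a :: l)
    simp only [List.map_cons] at this
    simp only [positiveAlternation, List.map_cons, this, hf]
    linear_combination zmod_two_add_self (h a * alternation h (a :: l))

/-- Deleting entries of a list and taking the facets of the corresponding multiset agree. -/
lemma linearCombination_facetSum_coe (ψ : Multiset Λ → ZMod 2) (l : List Λ) :
    Finsupp.linearCombination (ZMod 2) ψ (ModTwoChain.facetSum (l : Multiset Λ)) =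
      deletionSum (fun l' => ψ l') l := by
  induction l generalizing ψ with
  | nil => simp [ModTwoChain.facetSum, deletionSum]
  | cons a l ih =>
    rw [← Multiset.cons_coe, ModTwoChain.facetSum_cons, map_add]
    have h1 : Finsupp.linearCombination (ZMod 2) ψ
        (ModTwoChain.cone a (ModTwoChain.facetSum (l : Multiset Λ))) =
        Finsupp.linearCombination (ZMod 2) (fun m => ψ (a ::ₘ m))
          (ModTwoChain.facetSum (l : Multiset Λ)) := by
      simp [ModTwoChain.cone, Finsupp.linearCombination_mapDomain, Function.comp_def]
    rw [h1, ih]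
    simp [deletionSum]

end AlternatingLabels

/-- Signed labels: an index together with a sign, ordered by the index first. -/
abbrev SignedLabel := ℕ ×ₗ Bool

namespace SignedLabel

/-- The sign of a label as an element of `ℤ/2`. -/
def sgn (a : SignedLabel) : ZMod 2 := if (ofLex a).2 then 1 else 0

/-- The label with the opposite sign. -/
def flip (a : SignedLabel) : SignedLabel := toLex ((ofLex a).1, !(ofLex a).2)

lemma sgn_flip (a : SignedLabel) : sgn (flip a) = sgn a + 1 := by
  unfold sgn flip
  cases h : (ofLex a).2
  · simp
  · simp; decide

lemma index_lt_or_eq {a b : SignedLabel} (hab : a ≤ b) (hne : b ≠ flip a) :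
    (ofLex a).1 < (ofLex b).1 ∨ a = b := by
  rcases Prod.Lex.le_iff.1 hab with h | ⟨h1, h2⟩
  · exact Or.inl h
  · right
    by_contra hne'
    apply hne
    have h3 : (ofLex a).2 ≠ (ofLex b).2 := fun h => hne' (ofLex.injective (Prod.ext h1 h))
    apply ofLex.injective
    refine Prod.ext h1.symm ?_
    simp only [flip, ofLex_toLex]
    revert h3
    cases (ofLex a).2 <;> cases (ofLex b).2 <;> simp

lemma flip_le_flip {a b : SignedLabel} (hab : a ≤ b) (hne : b ≠ flip a) : flip a ≤ flip b := by
  rcases index_lt_or_eq hab hne with h | rfl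
  · exact Prod.Lex.le_iff.2 (Or.inl h)
  · exact le_rfl

lemma sort_map_flip {m : Multiset SignedLabel} (hm : ∀ a ∈ m, ∀ b ∈ m, b ≠ flip a) :
    (m.map flip).sort = m.sort.map flip := by
  refine List.Perm.eq_of_pairwise' (r := (· ≤ ·)) (Multiset.pairwise_sort _ _) ?_ ?_
  · rw [List.pairwise_map]
    refine List.Pairwise.imp_of_mem ?_ (Multiset.pairwise_sort m (· ≤ ·))
    intro a b ha hb hab
    exact flip_le_flip hab (hm a ((Multiset.mem_sort _).1 ha) b ((Multiset.mem_sort _).1 hb))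
  · rw [← Multiset.coe_eq_coe, Multiset.sort_eq, ← Multiset.map_coe, Multiset.sort_eq]

lemma alternation_eq_zero {n : ℕ} {m : Multiset SignedLabel} (hcard : n < m.card)
    (hn : ∀ a ∈ m, (ofLex a).1 < n) (hm : ∀ a ∈ m, ∀ b ∈ m, b ≠ flip a) :
    alternation sgn m.sort = 0 := by
  by_contra hne
  have key : ∀ l : List SignedLabel, l.Pairwise (· ≤ ·) → (∀ a ∈ l, ∀ b ∈ l, b ≠ flip a) →
      alternation sgn l ≠ 0 → (l.map fun a => (ofLex a).1).IsChain (· < ·) := by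
    intro l
    induction l with
    | nil => simp
    | cons a l ih =>
      intro h1 h2 h3
      cases l with
      | nil => simp
      | cons b l =>
        simp only [alternation] at h3
        have h4 := ih h1.of_cons (fun x hx y hy => h2 x (List.mem_cons_of_mem _ hx) y
          (List.mem_cons_of_mem _ hy)) (right_ne_zero_of_mul h3)
        have hab : a ≤ b := List.rel_of_pairwise_cons h1 (by simp)
        rcases index_lt_or_eq hab (h2 a (by simp) b (by simp)) with h | rfl
        · exact List.isChain_cons_cons.2 ⟨h, h4⟩
        · exact absurd (zmod_two_add_self _) (left_ne_zero_of_mul h3)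
  have h1 := key m.sort (Multiset.pairwise_sort _ _) (fun a ha b hb =>
    hm a ((Multiset.mem_sort _).1 ha) b ((Multiset.mem_sort _).1 hb)) hne
  have h2 : (m.sort.map fun a => (ofLex a).1).Nodup :=
    (List.isChain_iff_pairwise.1 h1).imp (fun h => ne_of_lt h)
  have h3 : (m.sort.map fun a => (ofLex a).1).length ≤ n := by
    have := List.toFinset_card_of_nodup h2
    rw [← this]
    refine (Finset.card_le_card (t := Finset.range n) ?_).trans (by simp)
    intro i hi
    simp only [List.mem_toFinset, List.mem_map] at hi
    obtain ⟨a, ha, rfl⟩ := hi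
    exact Finset.mem_range.2 (hn a ((Multiset.mem_sort _).1 ha))
  simp at h3
  omega

lemma linearCombination_facetSum_positiveAlternation {m : Multiset SignedLabel}
    (hm : 2 ≤ m.card) :
    Finsupp.linearCombination (ZMod 2) (fun m => positiveAlternation sgn m.sort)
      (ModTwoChain.facetSum m) = alternation sgn m.sort := by
  have h := linearCombination_facetSum_coe (fun m => positiveAlternation sgn m.sort) m.sort
  rw [Multiset.sort_eq] at h
  rw [h, deletionSum_congr (ψ := positiveAlternation sgn)]
  · have hl : 2 ≤ m.sort.length := by simpa using hm
    generalize m.sort = l at hl ⊢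
    match l, hl with
    | a :: b :: l, _ => exact deletionSum_positiveAlternation _ _ _ _
  · intro l' hl'
    congr 1
    refine List.Perm.eq_of_pairwise' (r := (· ≤ ·)) (Multiset.pairwise_sort _ _)
      ((Multiset.pairwise_sort m (· ≤ ·)).sublist hl') ?_
    rw [← Multiset.coe_eq_coe, Multiset.sort_eq]

end SignedLabel

section BorsukUlam

open ModTwoChain

variable {n : ℕ}

/-- The face of the cross-polytope in the orthant given by the signs `ε`. -/
def crossFace (ε : Fin (n + 1) → ℝ) : Set (Fin (n + 1) → ℝ) :=
  {x | (∀ i, 0 ≤ ε i * x i) ∧ ∑ i, ε i * x i = 1}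

lemma convex_crossFace (ε : Fin (n + 1) → ℝ) : Convex ℝ (crossFace ε) := by
  intro x hx y hy a b ha hb hab
  refine ⟨fun i => ?_, ?_⟩
  · have := mul_nonneg ha (hx.1 i)
    have := mul_nonneg hb (hy.1 i)
    simp only [Pi.add_apply, Pi.smul_apply, smul_eq_mul]
    linarith
  · simp only [Pi.add_apply, Pi.smul_apply, smul_eq_mul]
    have : ∀ i, ε i * (a * x i + b * y i) = a * (ε i * x i) + b * (ε i * y i) := fun i => by ring
    simp only [this, Finset.sum_add_distrib, ← Finset.mul_sum, hx.2, hy.2]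
    linarith

lemma neg_mem_crossFace {ε x : Fin (n + 1) → ℝ} (hx : x ∈ crossFace ε) : -x ∈ crossFace (-ε) := by
  simpa [crossFace] using hx

lemma sum_abs_of_mem_crossFace {ε x : Fin (n + 1) → ℝ} (hε : ∀ i, |ε i| = 1)
    (hx : x ∈ crossFace ε) : ∑ i, |x i| = 1 := by
  rw [← hx.2]
  refine Finset.sum_congr rfl fun i _ => ?_
  rw [← abs_of_nonneg (hx.1 i), abs_mul, hε, one_mul]

lemma dist_le_two_of_mem_crossFace {ε x y : Fin (n + 1) → ℝ} (hε : ∀ i, |ε i| = 1)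
    (hx : x ∈ crossFace ε) (hy : y ∈ crossFace ε) : dist x y ≤ 2 := by
  rw [dist_pi_le_iff (by norm_num)]
  intro i
  have h1 : ∀ z ∈ crossFace ε, |z i| ≤ 1 := fun z hz => by
    rw [← sum_abs_of_mem_crossFace hε hz]
    exact Finset.single_le_sum (f := fun i => |z i|) (fun i _ => abs_nonneg _) (Finset.mem_univ i)
  rw [Real.dist_eq]
  have := abs_sub (x i) (y i)
  linarith [h1 x hx, h1 y hy]

/-- Simplices with `k + 1` vertices, of mesh at most `δ`, in a face of the cross-polytope. -/
def smallSimplices (n : ℕ) (δ : ℝ) (k : ℕ) : Set (Multiset (Fin (n + 1) → ℝ)) :=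
  {m | m.card = k + 1 ∧ ∃ ε : Fin (n + 1) → ℝ, (∀ i, |ε i| = 1) ∧
    (∀ x ∈ m, x ∈ crossFace ε) ∧ ∀ x ∈ m, ∀ y ∈ m, dist x y ≤ δ}

/-- A sequence of chains on the cross-polytope whose terms are half-spheres: the boundary of each
term is the sum of the preceding term and its antipode. -/
structure IsHemisphereSeq (n : ℕ) (δ : ℝ) (c : ℕ → ModTwoChain (Fin (n + 1) → ℝ)) : Prop where
  supported : ∀ k ≤ n, c k ∈ Finsupp.supported (ZMod 2) (ZMod 2) (smallSimplices n δ k)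
  bdry_zero : bdry (c 0) = Finsupp.single 0 1
  bdry_succ : ∀ k < n, bdry (c (k + 1)) = c k + push (fun x => -x) (c k)

/-- Half-spheres built by iterated coning. -/
noncomputable def initialHemisphere (n : ℕ) : ℕ → ModTwoChain (Fin (n + 1) → ℝ)
  | 0 => Finsupp.single {fun j : Fin (n + 1) => if (j : ℕ) = 0 then 1 else 0} 1
  | k + 1 => cone (fun j : Fin (n + 1) => if (j : ℕ) = k + 1 then 1 else 0)
      (initialHemisphere n k + push (fun x => -x) (initialHemisphere n k))

lemma modTwoChain_add_self {E : Type*} (c : ModTwoChain E) : c + c = 0 := by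
  ext m
  simp [zmod_two_add_self]

lemma push_neg_push_neg (c : ModTwoChain (Fin (n + 1) → ℝ)) :
    push (fun x => -x) (push (fun x => -x) c) = c := by
  refine linearMap_eqOn (s := Set.univ) (push (fun x => -x) ∘ₗ push (fun x => -x)) LinearMap.id
    (fun m _ => ?_) (by simp)
  simp [push_single]

lemma bdry_initialHemisphere_zero : bdry (initialHemisphere n 0) = Finsupp.single 0 1 := by
  simp [initialHemisphere, bdry_single, facetSum]

lemma bdry_initialHemisphere_add (k : ℕ) :
    bdry (initialHemisphere n k + push (fun x => -x) (initialHemisphere n k)) = 0 := by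
  induction k with
  | zero =>
    rw [map_add, bdry_push, bdry_initialHemisphere_zero, push_single, Multiset.map_zero]
    exact modTwoChain_add_self _
  | succ k ih =>
    rw [map_add, bdry_push, initialHemisphere, bdry_cone, ih, map_zero, add_zero, map_add,
      push_neg_push_neg, add_comm (push _ _)]
    exact modTwoChain_add_self _

lemma initialHemisphere_supported {k : ℕ} (hk : k ≤ n) :
    initialHemisphere n k ∈ Finsupp.supported (ZMod 2) (ZMod 2)
      {m | m.card = k + 1 ∧ ∃ ε : Fin (n + 1) → ℝ, (∀ i, |ε i| = 1) ∧
        ∀ x ∈ m, x ∈ crossFace ε ∧ ∀ j : Fin (n + 1), k < j → x j = 0} := by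
  have hvertex : ∀ k : ℕ, k ≤ n → ∀ ε : Fin (n + 1) → ℝ,
      (∀ j : Fin (n + 1), (j : ℕ) = k → ε j = 1) →
      (fun j : Fin (n + 1) => if (j : ℕ) = k then (1 : ℝ) else 0) ∈ crossFace ε := by
    intro k hk ε hε
    refine ⟨fun i => ?_, ?_⟩
    · by_cases h : (i : ℕ) = k
      · simp [h, hε i h]
      · simp [h]
    · rw [Finset.sum_eq_single ⟨k, by omega⟩]
      · simp [hε ⟨k, by omega⟩ rfl]
      · intro b _ hb
        have : (b : ℕ) ≠ k := fun h => hb (Fin.ext h)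
        simp [this]
      · simp
  induction k with
  | zero =>
    refine Finsupp.single_mem_supported _ _ ⟨by simp, fun _ => 1, by simp, ?_⟩
    intro x hx
    rw [Multiset.mem_singleton] at hx
    subst hx
    refine ⟨hvertex 0 hk _ fun _ _ => rfl, fun j hj => ?_⟩
    simp [hj.ne']
  | succ k ih =>
    have h1 := ih (by omega)
    have h2 : push (fun x => -x) (initialHemisphere n k) ∈ Finsupp.supported (ZMod 2) (ZMod 2)
        {m | m.card = k + 1 ∧ ∃ ε : Fin (n + 1) → ℝ, (∀ i, |ε i| = 1) ∧
          ∀ x ∈ m, x ∈ crossFace ε ∧ ∀ j : Fin (n + 1), k < j → x j = 0} := by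
      refine map_mem_of_supported _ _ ?_ h1
      rintro m ⟨hm, ε, hε, hx⟩
      rw [push_single]
      refine Finsupp.single_mem_supported _ _ ⟨by simpa using hm, -ε, by simpa using hε, ?_⟩
      intro x hxm
      obtain ⟨y, hy, rfl⟩ := Multiset.mem_map.1 hxm
      exact ⟨neg_mem_crossFace (hx y hy).1, fun j hj => by simp [(hx y hy).2 j hj]⟩
    refine map_mem_of_supported _ _ ?_ (Submodule.add_mem _ h1 h2)
    rintro m ⟨hm, ε, hε, hx⟩
    rw [cone_single]
    refine Finsupp.single_mem_supported _ _
      ⟨by simp [hm], fun j => if (j : ℕ) = k + 1 then 1 else ε j, ?_, ?_⟩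
    · intro i
      by_cases h : (i : ℕ) = k + 1 <;> simp [h, hε]
    · intro x hxm
      rcases Multiset.mem_cons.1 hxm with rfl | hxm
      · exact ⟨hvertex (k + 1) hk _ fun j hj => by simp [hj], fun j hj => by simp [hj.ne']⟩
      · obtain ⟨⟨h3, h4⟩, h5⟩ := hx x hxm
        have h6 : ∀ j : Fin (n + 1), (if (j : ℕ) = k + 1 then 1 else ε j) * x j = ε j * x j := by
          intro j
          by_cases h : (j : ℕ) = k + 1
          · simp [h5 j (by omega)]
          · simp [h]
        refine ⟨⟨fun i => ?_, ?_⟩, fun j hj => h5 j (by omega)⟩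
        · simpa only [h6] using h3 i
        · simpa only [h6] using h4

lemma isHemisphereSeq_initialHemisphere : IsHemisphereSeq n 2 (initialHemisphere n) where
  supported k hk := by
    refine Finsupp.supported_mono ?_ (initialHemisphere_supported hk)
    rintro m ⟨hm, ε, hε, hx⟩
    exact ⟨hm, ε, hε, fun x hxm => (hx x hxm).1, fun x hxm y hym =>
      dist_le_two_of_mem_crossFace hε (hx x hxm).1 (hx y hym).1⟩
  bdry_zero := bdry_initialHemisphere_zero
  bdry_succ k _ := by
    rw [initialHemisphere, bdry_cone, bdry_initialHemisphere_add, map_zero, add_zero]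

lemma IsHemisphereSeq.subdiv {δ : ℝ} (hδ : 0 ≤ δ) {c : ℕ → ModTwoChain (Fin (n + 1) → ℝ)}
    (hc : IsHemisphereSeq n δ c) :
    IsHemisphereSeq n (n / (n + 1) * δ) fun k => ModTwoChain.subdiv (k + 1) (c k) := by
  have hcard : ∀ k ≤ n, c k ∈ Finsupp.supported (ZMod 2) (ZMod 2) {m | m.card = k + 1} :=
    fun k hk => Finsupp.supported_mono (fun m hm => hm.1) (hc.supported k hk)
  refine ⟨fun k hk => ?_, ?_, fun k hk => ?_⟩
  · refine map_mem_of_supported _ _ ?_ (hc.supported k hk)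
    rintro m ⟨hm, ε, hε, hx, hd⟩
    refine Finsupp.supported_mono ?_
      (subdiv_single_mem_supported (n := n) hδ (k + 1) (by omega) (convex_crossFace ε) hm hx hd)
    rintro m' ⟨h1, h2, h3⟩
    exact ⟨h1, ε, hε, h2, h3⟩
  · rw [bdry_subdiv 0 (hcard 0 (Nat.zero_le _)), hc.bdry_zero, subdiv_zero]
  · rw [bdry_subdiv (k + 1) (hcard (k + 1) hk), hc.bdry_succ k hk, map_add]
    congr 1
    exact (push_subdiv (-LinearMap.id : (Fin (n + 1) → ℝ) →ₗ[ℝ] (Fin (n + 1) → ℝ)) (k + 1)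
      (c k)).symm

lemma exists_isHemisphereSeq {δ : ℝ} (hδ : 0 < δ) : ∃ c, ∃ δ' < δ, IsHemisphereSeq n δ' c := by
  have h1 : ∀ t : ℕ, ∃ c, IsHemisphereSeq n (((n : ℝ) / (n + 1)) ^ t * 2) c := by
    intro t
    induction t with
    | zero => exact ⟨_, by simpa using isHemisphereSeq_initialHemisphere⟩
    | succ t ih =>
      obtain ⟨c, hc⟩ := ih
      refine ⟨fun k => ModTwoChain.subdiv (k + 1) (c k), ?_⟩
      rw [pow_succ', mul_assoc]
      exact hc.subdiv (by positivity)
  obtain ⟨t, ht⟩ := exists_pow_lt_of_lt_one (show 0 < δ / 2 by positivity)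
    (show (n : ℝ) / (n + 1) < 1 by rw [div_lt_one (by positivity)]; linarith)
  obtain ⟨c, hc⟩ := h1 t
  exact ⟨c, _, by linarith, hc⟩

/-- Tucker's lemma: an antipodal labelling of fine half-spheres has a complementary edge. -/
lemma IsHemisphereSeq.exists_complementary {δ : ℝ} {c : ℕ → ModTwoChain (Fin (n + 1) → ℝ)}
    (hc : IsHemisphereSeq n δ c) (lab : (Fin (n + 1) → ℝ) → SignedLabel)
    (hodd : ∀ x, ∑ i, |x i| = 1 → lab (-x) = SignedLabel.flip (lab x))
    (hlt : ∀ x, (ofLex (lab x)).1 < n) :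
    ∃ x y : Fin (n + 1) → ℝ, ∑ i, |x i| = 1 ∧ ∑ i, |y i| = 1 ∧ dist x y ≤ δ ∧
      lab y = SignedLabel.flip (lab x) := by
  by_contra! hcon
  have hsphere : ∀ k, ∀ m ∈ smallSimplices n δ k, ∀ x ∈ m, ∑ i, |x i| = 1 := by
    rintro k m ⟨-, ε, hε, hx, -⟩ x hxm
    exact sum_abs_of_mem_crossFace hε (hx x hxm)
  have hno : ∀ k, ∀ m ∈ smallSimplices n δ k, ∀ a ∈ m.map lab, ∀ b ∈ m.map lab,
      b ≠ SignedLabel.flip a := by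
    intro k m hm a ha b hb
    obtain ⟨x, hx, rfl⟩ := Multiset.mem_map.1 ha
    obtain ⟨y, hy, rfl⟩ := Multiset.mem_map.1 hb
    have hd : dist x y ≤ δ := hm.2.choose_spec.2.2 x hx y hy
    exact hcon x y (hsphere k m hm x hx) (hsphere k m hm y hy) hd
  let A : ModTwoChain SignedLabel →ₗ[ZMod 2] ZMod 2 := Finsupp.linearCombination (ZMod 2)
    fun m : Multiset SignedLabel => alternation SignedLabel.sgn m.sort
  let B : ModTwoChain SignedLabel →ₗ[ZMod 2] ZMod 2 := Finsupp.linearCombination (ZMod 2)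
    fun m : Multiset SignedLabel => positiveAlternation SignedLabel.sgn m.sort
  have hA : ∀ m, A (Finsupp.single m 1) = alternation SignedLabel.sgn m.sort := fun m => by
    simp [A]
  have hB : ∀ m, B (Finsupp.single m 1) = positiveAlternation SignedLabel.sgn m.sort := fun m => by
    simp [B]
  have h1 : ∀ k < n, A (push lab (c (k + 1))) = B (bdry (push lab (c (k + 1)))) := by
    intro k hk
    rw [← LinearMap.comp_apply A, ← LinearMap.comp_apply bdry, ← LinearMap.comp_apply B]
    refine linearMap_eqOn _ _ (fun m hm => ?_) (hc.supported (k + 1) hk)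
    rw [LinearMap.comp_apply, LinearMap.comp_apply, LinearMap.comp_apply, push_single, hA,
      bdry_single]
    refine (SignedLabel.linearCombination_facetSum_positiveAlternation ?_).symm
    rw [Multiset.card_map, hm.1]
    omega
  have h2 : ∀ k ≤ n, B (push lab (c k + push (fun x => -x) (c k))) = A (push lab (c k)) := by
    intro k hk
    have h3 : ∀ c', B (push lab (c' + push (fun x => -x) c')) =
        (B ∘ₗ push lab + B ∘ₗ push lab ∘ₗ push (fun x => -x)) c' := fun c' => by simp
    rw [h3, ← LinearMap.comp_apply A]
    refine linearMap_eqOn _ _ (fun m hm => ?_) (hc.supported k hk)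
    rw [LinearMap.add_apply, LinearMap.comp_apply, LinearMap.comp_apply, LinearMap.comp_apply,
      LinearMap.comp_apply, push_single, push_single, push_single, hA, hB, hB]
    have h4 : (m.map fun x => -x).map lab = (m.map lab).map SignedLabel.flip := by
      rw [Multiset.map_map, Multiset.map_map]
      exact Multiset.map_congr rfl fun x hx => hodd x (hsphere k m hm x hx)
    rw [h4, SignedLabel.sort_map_flip (hno k m hm)]
    refine positiveAlternation_add_map SignedLabel.sgn_flip ?_
    intro h5
    have h6 := congrArg List.length h5
    simp [hm.1] at h6
  have h3 : ∀ k ≤ n, A (push lab (c k)) = 1 := by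
    intro k
    induction k with
    | zero =>
      intro _
      have h4 : ∀ c' : ModTwoChain (Fin (n + 1) → ℝ),
          c' ∈ Finsupp.supported (ZMod 2) (ZMod 2) (smallSimplices n δ 0) →
          A (push lab c') = bdry c' 0 := by
        intro c' hc'
        rw [← LinearMap.comp_apply A, show bdry c' 0 = (Finsupp.lapply 0 ∘ₗ bdry) c' from rfl]
        refine linearMap_eqOn _ _ (fun m hm => ?_) hc'
        obtain ⟨x, rfl⟩ := Multiset.card_eq_one.1 (show m.card = 1 from hm.1)
        rw [LinearMap.comp_apply, LinearMap.comp_apply, push_single, hA, bdry_single]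
        simp [facetSum, alternation]
      rw [h4 _ (hc.supported 0 (Nat.zero_le _)), hc.bdry_zero]
      simp
    | succ k ih =>
      intro hk
      rw [h1 k hk, bdry_push, hc.bdry_succ k hk, h2 k (by omega), ih (by omega)]
  have h4 : A (push lab (c n)) = (0 : ModTwoChain (Fin (n + 1) → ℝ) →ₗ[ZMod 2] ZMod 2) (c n) := by
    rw [← LinearMap.comp_apply A]
    refine linearMap_eqOn _ _ (fun m hm => ?_) (hc.supported n le_rfl)
    rw [LinearMap.comp_apply, push_single, hA, LinearMap.zero_apply]
    refine SignedLabel.alternation_eq_zero (n := n) ?_ ?_ (hno n m hm)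
    · rw [Multiset.card_map, hm.1]
      omega
    · intro a ha
      obtain ⟨x, -, rfl⟩ := Multiset.mem_map.1 ha
      exact hlt x
  rw [h3 n le_rfl] at h4
  exact one_ne_zero h4

lemma isCompact_crossPolytope (ι : Type*) [Fintype ι] :
    IsCompact {x : ι → ℝ | ∑ i, |x i| = 1} := by
  refine Metric.isCompact_of_isClosed_isBounded ?_ ?_
  · exact isClosed_eq (by fun_prop) continuous_const
  · refine (Metric.isBounded_closedBall (x := (0 : ι → ℝ)) (r := 1)).subset fun x hx => ?_
    rw [mem_closedBall_zero_iff, pi_norm_le_iff_of_nonneg zero_le_one]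
    intro i
    rw [Real.norm_eq_abs, ← (show ∑ i, |x i| = 1 from hx)]
    exact Finset.single_le_sum (f := fun i => |x i|) (fun i _ => abs_nonneg _) (Finset.mem_univ i)

/-- The **Borsuk–Ulam theorem**, on the boundary of the cross-polytope. -/
theorem borsuk_ulam (g : (Fin (n + 1) → ℝ) → Fin n → ℝ) (hg : Continuous g)
    (hodd : ∀ x, g (-x) = -g x) : ∃ x, ∑ i, |x i| = 1 ∧ g x = 0 := by
  rcases Nat.eq_zero_or_pos n with rfl | hn
  · exact ⟨fun _ => 1, by simp, Subsingleton.elim _ _⟩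
  by_contra! hcon
  have hK := isCompact_crossPolytope (Fin (n + 1))
  set K := {x : Fin (n + 1) → ℝ | ∑ i, |x i| = 1} with hKdef
  have hne : K.Nonempty := ⟨Pi.single 0 1, by simp [hKdef, Pi.single_apply, apply_ite abs]⟩
  obtain ⟨x₀, hx₀, hmin⟩ := hK.exists_isMinOn hne (f := fun x => ‖g x‖) (by fun_prop)
  have hη : 0 < ‖g x₀‖ := norm_pos_iff.2 (hcon x₀ hx₀)
  set η := ‖g x₀‖
  obtain ⟨δ, hδ, hunif⟩ := Metric.uniformContinuousOn_iff.1
    (hK.uniformContinuousOn_of_continuous hg.continuousOn) η hη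
  have : Nonempty (Fin n) := ⟨⟨0, hn⟩⟩
  have hmax : ∀ v : Fin n → ℝ, ∃ i, ∀ j, v j ≤ v i := fun v => Finite.exists_max v
  choose im him using hmax
  let lab : (Fin (n + 1) → ℝ) → SignedLabel := fun x =>
    toLex ((im fun i => |g x i| : ℕ), decide (0 < g x (im fun i => |g x i|)))
  have habs : ∀ x ∈ K, η ≤ |g x (im fun i => |g x i|)| := by
    intro x hx
    refine (hmin hx).trans ?_
    rw [pi_norm_le_iff_of_nonneg (abs_nonneg _)]
    exact him fun i => |g x i|
  obtain ⟨c, δ', hδ', hc⟩ := exists_isHemisphereSeq (n := n) hδ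
  have hlab : ∀ x, ∑ i, |x i| = 1 → lab (-x) = SignedLabel.flip (lab x) := by
    intro x hx
    have h1 : (fun i => |g (-x) i|) = fun i => |g x i| := by
      ext i
      simp [hodd]
    simp only [lab, SignedLabel.flip, h1, ofLex_toLex]
    congr 2
    have h2 := habs x hx
    rw [hodd, Pi.neg_apply]
    generalize g x (im fun i => |g x i|) = a at *
    rcases lt_trichotomy a 0 with ha | ha | ha
    · simp [ha, ha.le]
    · rw [ha, abs_zero] at h2
      linarith
    · simp [ha, ha.le]
  obtain ⟨x, y, hx, hy, hd, hl⟩ := hc.exists_complementary lab hlab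
    fun x => (im fun i => |g x i|).2
  have h1 := hunif x hx y hy (lt_of_le_of_lt hd hδ')
  simp only [lab, SignedLabel.flip, EmbeddingLike.apply_eq_iff_eq, ofLex_toLex,
    Prod.mk.injEq] at hl
  obtain ⟨h2, h3⟩ := hl
  have h2' := Fin.ext h2
  have hx' := habs x hx
  have hy' := habs y hy
  rw [h2'] at h3 hy'
  have h4 := (dist_le_pi_dist (g x) (g y) (im fun i => |g x i|)).trans_lt h1
  rw [Real.dist_eq] at h4
  generalize g x (im fun i => |g x i|) = a at *
  generalize g y (im fun i => |g x i|) = b at *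
  by_cases ha : 0 < a
  · have hb : ¬ 0 < b := by simpa [ha] using h3
    rw [abs_of_pos ha] at hx'
    have := le_abs_self (a - b)
    linarith
  · have hb : 0 < b := by simpa [ha] using h3
    rw [abs_of_pos hb] at hy'
    have := neg_abs_le (a - b)
    linarith

end BorsukUlam

section HamSandwich

/-- Truncation of a real number to `[-1, 1]`. -/
noncomputable def clip (t : ℝ) : ℝ := max (-1) (min 1 t)

lemma clip_neg (t : ℝ) : clip (-t) = -clip t := by
  unfold clip
  rcases le_total t (-1) with h | h <;> rcases le_total t 1 with h' | h'
  · rw [min_eq_left (by linarith), max_eq_right (by linarith), min_eq_right h', max_eq_left h]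
    norm_num
  · linarith
  · rw [min_eq_right (by linarith), max_eq_right (by linarith), min_eq_right h', max_eq_right h]
  · rw [min_eq_right (by linarith), max_eq_left (by linarith), min_eq_left h',
      max_eq_right (by linarith)]

lemma neg_one_le_clip (t : ℝ) : -1 ≤ clip t := le_max_left _ _

lemma clip_of_one_le {t : ℝ} (ht : 1 ≤ t) : clip t = 1 := by
  unfold clip
  rw [min_eq_left ht, max_eq_right (by norm_num)]

lemma continuous_clip : Continuous clip := by
  unfold clip
  fun_prop

open Filter Topology in
lemma ham_sandwich_fin {X : Type*} {J : ℕ} (b : Fin (J + 1) → X → ℝ) (S : Fin J → Finset X) :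
    ∃ c : Fin (J + 1) → ℝ, c ≠ 0 ∧
      ∀ j, 2 * ((S j).filter fun x => 0 < ∑ i, c i * b i x).card ≤ (S j).card ∧
        2 * ((S j).filter fun x => ∑ i, c i * b i x < 0).card ≤ (S j).card := by
  have h1 : ∀ M : ℕ, ∃ c : Fin (J + 1) → ℝ, c ∈ {x : Fin (J + 1) → ℝ | ∑ i, |x i| = 1} ∧
      ∀ j, ∑ x ∈ S j, clip (M * ∑ i, c i * b i x) = 0 := by
    intro M
    have hcont : Continuous fun (c : Fin (J + 1) → ℝ) (j : Fin J) =>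
        ∑ x ∈ S j, clip (M * ∑ i, c i * b i x) := by
      have := continuous_clip
      fun_prop
    obtain ⟨c, hc, hz⟩ := borsuk_ulam _ hcont fun c => by
      ext j
      simp only [Pi.neg_apply, neg_mul, Finset.sum_neg_distrib, mul_neg, clip_neg]
    exact ⟨c, hc, fun j => congrFun hz j⟩
  choose c hc hz using h1
  obtain ⟨c₀, hc₀, φ, hφ, hlim⟩ := (isCompact_crossPolytope (Fin (J + 1))).tendsto_subseq hc
  refine ⟨c₀, ?_, ?_⟩
  · rintro rfl
    simp at hc₀
  have hval : ∀ x, Tendsto (fun k => ∑ i, c (φ k) i * b i x) atTop (𝓝 (∑ i, c₀ i * b i x)) := by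
    intro x
    refine tendsto_finsetSum _ fun i _ => ?_
    exact ((continuous_apply i).tendsto c₀ |>.comp hlim).mul_const _
  have hφ' : Tendsto (fun k => (φ k : ℝ)) atTop atTop :=
    tendsto_natCast_atTop_atTop.comp hφ.tendsto_atTop
  -- a sign-independent form of the conclusion
  have key : ∀ (ψ : ℕ → X → ℝ) (s : Finset X) (p : X → Prop),
      (∀ k, ∑ x ∈ s, clip (ψ k x) = 0) → (∀ x, p x → Tendsto (fun k => ψ k x) atTop atTop) →
      2 * (s.filter p).card ≤ s.card := by
    intro ψ s p hψ hp
    have h2 : ∀ᶠ k in atTop, ∀ x ∈ s.filter p, 1 ≤ ψ k x := by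
      rw [Filter.eventually_all_finset]
      intro x hx
      exact (hp x (Finset.mem_filter.1 hx).2).eventually_ge_atTop 1
    obtain ⟨k, hk⟩ := h2.exists
    have h3 := hψ k
    rw [← Finset.sum_filter_add_sum_filter_not s p] at h3
    have h4 : ∑ x ∈ s.filter p, clip (ψ k x) = (s.filter p).card := by
      rw [Finset.sum_congr rfl fun x hx => clip_of_one_le (hk x hx)]
      simp
    have h5 : -((s.filter fun x => ¬ p x).card : ℝ) ≤
        ∑ x ∈ s.filter fun x => ¬ p x, clip (ψ k x) := by
      have := Finset.card_nsmul_le_sum (s.filter fun x => ¬ p x) (fun x => clip (ψ k x)) (-1)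
        fun x _ => neg_one_le_clip _
      simpa using this
    have h6 := Finset.card_filter_add_card_filter_not (s := s) p
    have h7 : ((s.filter p).card : ℝ) ≤ ((s.filter fun x => ¬ p x).card : ℝ) := by linarith
    have h8 := Nat.cast_le.1 h7
    omega
  intro j
  constructor
  · refine key (fun k x => φ k * ∑ i, c (φ k) i * b i x) (S j) _ (fun k => hz (φ k) j) ?_
    intro x hx
    exact hφ'.atTop_mul_pos hx (hval x)
  · refine key (fun k x => -(φ k * ∑ i, c (φ k) i * b i x)) (S j) _ (fun k => ?_) ?_
    · simp only [clip_neg, Finset.sum_neg_distrib, hz (φ k) j, neg_zero]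
    intro x hx
    exact tendsto_neg_atBot_atTop.comp (hφ'.atTop_mul_neg hx (hval x))

/-- The discrete ham sandwich theorem for a linear system of functions. -/
theorem ham_sandwich {X κ ι : Type*} [Fintype κ] [Fintype ι] (b : κ → X → ℝ) (S : ι → Finset X)
    (h : Fintype.card ι < Fintype.card κ) :
    ∃ c : κ → ℝ, c ≠ 0 ∧
      ∀ j, 2 * ((S j).filter fun x => 0 < ∑ i, c i * b i x).card ≤ (S j).card ∧
        2 * ((S j).filter fun x => ∑ i, c i * b i x < 0).card ≤ (S j).card := by
  obtain ⟨J, hJ⟩ : ∃ J, Fintype.card κ = J + 1 := ⟨Fintype.card κ - 1, by omega⟩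
  obtain ⟨e⟩ : Nonempty (Fin (J + 1) ≃ κ) := ⟨(Fintype.equivFinOfCardEq hJ).symm⟩
  obtain ⟨f⟩ : Nonempty (ι ↪ Fin J) :=
    Function.Embedding.nonempty_of_card_le (by rw [Fintype.card_fin]; omega)
  obtain ⟨c, hc, hS⟩ := ham_sandwich_fin (fun i => b (e i)) (Function.extend f S fun _ => ∅)
  refine ⟨fun i => c (e.symm i), ?_, fun j => ?_⟩
  · intro h0
    exact hc (funext fun i => by simpa using congrFun h0 (e i))
  · have h1 := hS (f j)
    rw [f.injective.extend_apply] at h1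
    have h2 : ∀ x, ∑ i, c (e.symm i) * b i x = ∑ i, c i * b (e i) x := fun x => by
      rw [← e.sum_comp]
      simp
    simpa only [h2] using h1

end HamSandwich

section Lines

open MvPolynomial

variable {f g : MvPolynomial (Fin 3) ℝ} {l l' : Set (Fin 3 → ℝ)}

/-- The restriction of a polynomial to the parametrised line `t ↦ p + t v`. -/
noncomputable def lineRestrict (p v : Fin 3 → ℝ) :
    MvPolynomial (Fin 3) ℝ →ₐ[ℝ] Polynomial ℝ :=
  aeval fun i => Polynomial.C (p i) + Polynomial.C (v i) * Polynomial.X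

lemma eval_lineRestrict (p v : Fin 3 → ℝ) (f : MvPolynomial (Fin 3) ℝ) (t : ℝ) :
    (lineRestrict p v f).eval t = eval (p + t • v) f := by
  unfold lineRestrict
  induction f using MvPolynomial.induction_on with
  | C a => simp
  | add f g hf hg => simp [hf, hg]
  | mul_X f i hf =>
    simp only [map_mul, aeval_X, Polynomial.eval_mul, hf, Polynomial.eval_add, Polynomial.eval_C,
      Polynomial.eval_X, eval_X, Pi.add_apply, Pi.smul_apply, smul_eq_mul]
    rw [mul_comm t]

lemma natDegree_lineRestrict_le (p v : Fin 3 → ℝ) (f : MvPolynomial (Fin 3) ℝ) :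
    (lineRestrict p v f).natDegree ≤ f.totalDegree := by
  have := aeval_natDegree_le f le_rfl
    (fun i => Polynomial.C (p i) + Polynomial.C (v i) * Polynomial.X) (n := 1) fun i => by
      rw [add_comm]
      exact Polynomial.natDegree_linear_le
  simpa [lineRestrict] using this

/-- The polynomial `f` vanishes identically on the set `l`. -/
def VanishesOn (f : MvPolynomial (Fin 3) ℝ) (l : Set (Fin 3 → ℝ)) : Prop :=
  ∀ x ∈ l, eval x f = 0

lemma lineRestrict_eq_zero_iff (p v : Fin 3 → ℝ) (f : MvPolynomial (Fin 3) ℝ) :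
    lineRestrict p v f = 0 ↔ VanishesOn f {x | ∃ t : ℝ, x = p + t • v} := by
  constructor
  · rintro h _ ⟨t, rfl⟩
    rw [← eval_lineRestrict, h, Polynomial.eval_zero]
  · intro h
    refine Polynomial.funext fun t => ?_
    rw [eval_lineRestrict, Polynomial.eval_zero]
    exact h _ ⟨t, rfl⟩

lemma injective_line_param {p v : Fin 3 → ℝ} (hv : v ≠ 0) :
    Function.Injective fun t : ℝ => p + t • v := by
  intro s t hst
  exact smul_left_injective ℝ hv (add_left_cancel hst)

/-- A polynomial with many zeros on a line vanishes on it. -/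
lemma card_zeros_le (hl : IsLine l) (hf : ¬ VanishesOn f l) (A : Finset (Fin 3 → ℝ)) :
    (A.filter fun x => x ∈ l ∧ eval x f = 0).card ≤ f.totalDegree := by
  obtain ⟨p, v, hv, rfl⟩ := hl
  rw [← lineRestrict_eq_zero_iff] at hf
  have h1 : (A.filter fun x => x ∈ {x | ∃ t : ℝ, x = p + t • v} ∧ eval x f = 0) ⊆
      (lineRestrict p v f).roots.toFinset.image fun t => p + t • v := by
    intro x hx
    obtain ⟨-, ⟨t, rfl⟩, h0⟩ := Finset.mem_filter.1 hx
    refine Finset.mem_image.2 ⟨t, ?_, rfl⟩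
    rw [Multiset.mem_toFinset, Polynomial.mem_roots hf, Polynomial.IsRoot.def, eval_lineRestrict,
      h0]
  calc _ ≤ _ := Finset.card_le_card h1
    _ ≤ _ := Finset.card_image_le
    _ ≤ _ := Multiset.toFinset_card_le _
    _ ≤ _ := Polynomial.card_roots' _
    _ ≤ _ := natDegree_lineRestrict_le p v f

lemma IsLine.vanishesOn_of_card (hl : IsLine l) (A : Finset (Fin 3 → ℝ))
    (hA : ∀ x ∈ A, x ∈ l ∧ eval x f = 0) (hcard : f.totalDegree < A.card) : VanishesOn f l := by
  by_contra h
  have := card_zeros_le hl h A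
  rw [Finset.filter_true_of_mem hA] at this
  omega

lemma IsLine.eq_of_mem {x y : Fin 3 → ℝ} (hl : IsLine l) (hl' : IsLine l') (hxy : x ≠ y)
    (hx : x ∈ l) (hy : y ∈ l) (hx' : x ∈ l') (hy' : y ∈ l') : l = l' := by
  have key : ∀ l, IsLine l → x ∈ l → y ∈ l → l = {z | ∃ t : ℝ, z = x + t • (y - x)} := by
    rintro l ⟨p, v, hv, rfl⟩ ⟨a, rfl⟩ ⟨b, rfl⟩
    have hab : b - a ≠ 0 := by
      intro h
      apply hxy
      rw [sub_eq_zero.1 h]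
    ext z
    constructor
    · rintro ⟨t, rfl⟩
      refine ⟨(t - a) / (b - a), ?_⟩
      ext i
      simp only [Pi.add_apply, Pi.smul_apply, Pi.sub_apply, smul_eq_mul]
      field_simp
      ring
    · rintro ⟨t, rfl⟩
      refine ⟨a + t * (b - a), ?_⟩
      ext i
      simp only [Pi.add_apply, Pi.smul_apply, Pi.sub_apply, smul_eq_mul]
      ring
  rw [key l hl hx hy, key l' hl' hx' hy']

lemma IsLine.infinite (hl : IsLine l) : l.Infinite := by
  obtain ⟨p, v, hv, rfl⟩ := hl
  have : {x | ∃ t : ℝ, x = p + t • v} = Set.range fun t : ℝ => p + t • v := by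
    ext x
    simp [eq_comm]
  rw [this]
  exact Set.infinite_range_of_injective (injective_line_param hv)

end Lines

section Partition

open MvPolynomial

variable {e : ℕ}

/-- The polynomial with given coefficients and all exponents at most `q`. -/
noncomputable def boxPoly {q : ℕ} (c : (Fin e → Fin (q + 1)) → ℝ) : MvPolynomial (Fin e) ℝ :=
  ∑ κ, monomial (Finsupp.equivFunOnFinite.symm fun i => (κ i : ℕ)) (c κ)

lemma boxPoly_ne_zero {q : ℕ} {c : (Fin e → Fin (q + 1)) → ℝ} (hc : c ≠ 0) : boxPoly c ≠ 0 := by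
  obtain ⟨κ, hκ⟩ := Function.ne_iff.1 hc
  intro h
  apply hκ
  have h1 := congrArg (coeff (Finsupp.equivFunOnFinite.symm fun i => (κ i : ℕ))) h
  rw [boxPoly, coeff_sum, Finset.sum_eq_single κ] at h1
  · simpa using h1
  · intro κ' _ hne
    rw [coeff_monomial, if_neg]
    intro h2
    apply hne
    ext i
    exact congrFun (Finsupp.equivFunOnFinite.symm.injective h2) i
  · simp

lemma totalDegree_boxPoly_le {q : ℕ} (c : (Fin e → Fin (q + 1)) → ℝ) :
    (boxPoly c).totalDegree ≤ e * q := by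
  refine totalDegree_finsetSum_le fun κ _ => (totalDegree_monomial_le _ _).trans ?_
  rw [Finsupp.sum_fintype _ _ fun _ => rfl]
  refine (Finset.sum_le_card_nsmul _ _ q fun i _ => ?_).trans (by simp)
  have := (κ i).2
  simp only [Finsupp.equivFunOnFinite_symm_apply_apply, id]
  omega

lemma eval_boxPoly {q : ℕ} (c : (Fin e → Fin (q + 1)) → ℝ) (x : Fin e → ℝ) :
    eval x (boxPoly c) = ∑ κ, c κ * ∏ i, x i ^ (κ i : ℕ) := by
  rw [boxPoly, map_sum]
  refine Finset.sum_congr rfl fun κ _ => ?_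
  rw [eval_monomial, Finsupp.prod_fintype]
  · simp
  · simp

/-- Simultaneous bisection of finite families of finite sets. -/
lemma exists_bisecting (σ : Fin e → Fin 3) {ι : Type*} [Fintype ι] {q : ℕ}
    (S : ι → Finset (Fin 3 → ℝ)) (h : Fintype.card ι < (q + 1) ^ e) :
    ∃ f : MvPolynomial (Fin e) ℝ, f ≠ 0 ∧ f.totalDegree ≤ e * q ∧
      ∀ j, 2 * ((S j).filter fun x => 0 < eval x (rename σ f)).card ≤ (S j).card ∧
        2 * ((S j).filter fun x => eval x (rename σ f) < 0).card ≤ (S j).card := by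
  obtain ⟨c, hc, hS⟩ := ham_sandwich
    (fun (κ : Fin e → Fin (q + 1)) (x : Fin 3 → ℝ) => ∏ i, x (σ i) ^ (κ i : ℕ)) S (by simpa using h)
  refine ⟨boxPoly c, boxPoly_ne_zero hc, totalDegree_boxPoly_le c, ?_⟩
  intro j
  simp only [eval_rename, eval_boxPoly, Function.comp_apply]
  exact hS j

/-- The points of `P` with prescribed strict signs of the first `k` polynomials. -/
noncomputable def signCell (σ : Fin e → Fin 3) (f : ℕ → MvPolynomial (Fin e) ℝ)
    (P : Finset (Fin 3 → ℝ)) (τ : ℕ → Bool) (k : ℕ) : Finset (Fin 3 → ℝ) :=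
  P.filter fun x => ∀ i < k, if τ i then 0 < eval x (rename σ (f i)) else
    eval x (rename σ (f i)) < 0

lemma exists_partitioning_seq (σ : Fin e → Fin 3) (P : Finset (Fin 3 → ℝ)) (q : ℕ → ℕ)
    (hq : ∀ i, 2 ^ i < (q i + 1) ^ e) (k : ℕ) :
    ∃ f : ℕ → MvPolynomial (Fin e) ℝ, (∀ i < k, f i ≠ 0 ∧ (f i).totalDegree ≤ e * q i) ∧
      ∀ τ, 2 ^ k * (signCell σ f P τ k).card ≤ P.card := by
  induction k with
  | zero => exact ⟨fun _ => 0, by simp, fun τ => by simp [signCell]⟩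
  | succ k ih =>
    obtain ⟨f, hf, hcell⟩ := ih
    obtain ⟨F, hF0, hFd, hF⟩ := exists_bisecting σ (ι := Fin k → Bool) (q := q k)
      (fun τ => signCell σ f P (fun i => if h : i < k then τ ⟨i, h⟩ else false) k)
      (by simpa using hq k)
    refine ⟨Function.update f k F, ?_, ?_⟩
    · intro i hi
      rcases Nat.lt_succ_iff_lt_or_eq.1 hi with h | rfl
      · rw [Function.update_of_ne h.ne]
        exact hf i h
      · rw [Function.update_self]
        exact ⟨hF0, hFd⟩
    · intro τ
      have h1 := hF fun i => τ i
      have h2 : signCell σ f P (fun i => if h : i < k then τ (⟨i, h⟩ : Fin k) else false) k =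
          signCell σ f P τ k := by
        refine Finset.filter_congr fun x _ => forall₂_congr fun i hi => ?_
        simp only [dif_pos hi]
      rw [h2] at h1
      have h3 := hcell τ
      have h4 : signCell σ (Function.update f k F) P τ (k + 1) ⊆
          (signCell σ f P τ k).filter fun x => if τ k then 0 < eval x (rename σ F) else
            eval x (rename σ F) < 0 := by
        intro x hx
        obtain ⟨hxP, hx⟩ := Finset.mem_filter.1 hx
        refine Finset.mem_filter.2 ⟨Finset.mem_filter.2 ⟨hxP, fun i hi => ?_⟩, ?_⟩
        · have := hx i (by omega)
          rwa [Function.update_of_ne hi.ne] at this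
        · have := hx k (by omega)
          rwa [Function.update_self] at this
      have h5 := Finset.card_le_card h4
      have h6 : 2 * (signCell σ (Function.update f k F) P τ (k + 1)).card ≤
          (signCell σ f P τ k).card := by
        cases h : τ k <;> simp only [h, if_true, if_false, Bool.false_eq_true] at h5 <;> omega
      calc 2 ^ (k + 1) * (signCell σ (Function.update f k F) P τ (k + 1)).card
          = 2 ^ k * (2 * (signCell σ (Function.update f k F) P τ (k + 1)).card) := by ring
        _ ≤ 2 ^ k * (signCell σ f P τ k).card := Nat.mul_le_mul_left _ h6
        _ ≤ _ := h3

/-- A line crosses at most `d + 1` sign patterns of the factors of a polynomial of degree `d`. -/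
lemma card_image_signs_le {k : ℕ} (F : ℕ → MvPolynomial (Fin 3) ℝ) {l : Set (Fin 3 → ℝ)}
    (hl : IsLine l) (A : Finset (Fin 3 → ℝ))
    (hA : ∀ x ∈ A, x ∈ l ∧ eval x (∏ i ∈ Finset.range k, F i) ≠ 0) :
    (A.image fun x => fun i : Fin k => decide (0 < eval x (F i))).card ≤
      (∏ i ∈ Finset.range k, F i).totalDegree + 1 := by
  rcases A.eq_empty_or_nonempty with rfl | ⟨x₀, hx₀⟩
  · simp
  obtain ⟨p, v, hv, rfl⟩ := hl
  set G := ∏ i ∈ Finset.range k, F i with hG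
  have hr0 : lineRestrict p v G ≠ 0 := by
    intro h
    exact (hA x₀ hx₀).2 ((lineRestrict_eq_zero_iff p v G).1 h x₀ (hA x₀ hx₀).1)
  set R := (lineRestrict p v G).roots.toFinset with hR
  have hRcard : R.card ≤ G.totalDegree :=
    (Multiset.toFinset_card_le _).trans
      ((Polynomial.card_roots' _).trans (natDegree_lineRestrict_le p v G))
  have hparam : ∀ x ∈ A, ∃ t : ℝ, x = p + t • v := fun x hx => (hA x hx).1
  choose! t ht using hparam
  let N : (Fin 3 → ℝ) → ℕ := fun x => (R.filter fun r => r < t x).card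
  have hlt : ∀ x ∈ A, ∀ y ∈ A, t x ≤ t y → N x = N y → ∀ i < k,
      (0 < eval x (F i) ↔ 0 < eval y (F i)) := by
    intro x hx y hy hxy hN i hi
    have hsub : (R.filter fun r => r < t x) ⊆ R.filter fun r => r < t y := by
      intro r hr
      rw [Finset.mem_filter] at hr ⊢
      exact ⟨hr.1, lt_of_lt_of_le hr.2 hxy⟩
    have heq := Finset.eq_of_subset_of_card_le hsub (le_of_eq hN.symm)
    have hnoroot : ∀ s ∈ Set.Icc (t x) (t y), eval (p + s • v) (F i) ≠ 0 := by
      intro s hs h0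
      have hroot : s ∈ R := by
        rw [hR, Multiset.mem_toFinset, Polynomial.mem_roots hr0, Polynomial.IsRoot.def,
          eval_lineRestrict, hG, map_prod]
        exact Finset.prod_eq_zero (Finset.mem_range.2 hi) h0
      rcases eq_or_lt_of_le hs.2 with h | h
      · apply (hA y hy).2
        rw [hR, Multiset.mem_toFinset, Polynomial.mem_roots hr0, Polynomial.IsRoot.def,
          eval_lineRestrict, h, ← ht y hy] at hroot
        exact hroot
      · have h2 : s ∈ R.filter fun r => r < t x := by
          rw [heq]
          exact Finset.mem_filter.2 ⟨hroot, h⟩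
        exact absurd (Finset.mem_filter.1 h2).2 (not_lt.2 hs.1)
    have hcont : ContinuousOn (fun s : ℝ => eval (p + s • v) (F i)) (Set.Icc (t x) (t y)) := by
      have : (fun s : ℝ => eval (p + s • v) (F i)) = fun s => (lineRestrict p v (F i)).eval s := by
        ext s
        rw [eval_lineRestrict]
      rw [this]
      exact (Polynomial.continuous _).continuousOn
    rw [ht x hx, ht y hy]
    constructor
    · intro h
      by_contra h'
      obtain ⟨s, hs, hs0⟩ := intermediate_value_Icc' hxy hcont ⟨not_lt.1 h', h.le⟩
      exact hnoroot s hs hs0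
    · intro h
      by_contra h'
      obtain ⟨s, hs, hs0⟩ := intermediate_value_Icc hxy hcont ⟨not_lt.1 h', h.le⟩
      exact hnoroot s hs hs0
  have hfactor : ∀ x ∈ A, ∀ y ∈ A, N x = N y →
      (fun i : Fin k => decide (0 < eval x (F i))) =
        fun i : Fin k => decide (0 < eval y (F i)) := by
    intro x hx y hy hN
    ext i
    rcases le_total (t x) (t y) with h | h
    · simp only [hlt x hx y hy h hN i i.2]
    · simp only [hlt y hy x hx h hN.symm i i.2]
  have h1 : (A.image fun x => fun i : Fin k => decide (0 < eval x (F i))).card ≤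
      (A.image N).card := by
    have hsel : ∀ u ∈ A.image fun x => fun i : Fin k => decide (0 < eval x (F i)),
        ∃ x ∈ A, (fun i : Fin k => decide (0 < eval x (F i))) = u := fun u hu =>
      Finset.mem_image.1 hu
    choose! w hwA hw using hsel
    refine Finset.card_le_card_of_injOn (fun u => N (w u)) ?_ ?_
    · intro u hu
      exact Finset.mem_coe.2 (Finset.mem_image_of_mem N (hwA u hu))
    · intro u hu u' hu' huu
      rw [← hw u hu, ← hw u' hu']
      exact hfactor _ (hwA u hu) _ (hwA u' hu') huu
  refine h1.trans ((Finset.card_le_card (t := Finset.range (G.totalDegree + 1)) ?_).trans (by simp))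
  intro j hj
  obtain ⟨x, -, rfl⟩ := Finset.mem_image.1 hj
  rw [Finset.mem_range]
  have := Finset.card_filter_le R fun r => r < t x
  simp only [N]
  omega

lemma sum_two_pow_div (he : 0 < e) (T : ℕ) :
    ∑ i ∈ Finset.range (e * T), e * 2 ^ (i / e + 1) ≤ e ^ 2 * 2 ^ (T + 1) := by
  induction T with
  | zero => simp
  | succ T ih =>
    rw [Nat.mul_succ, Finset.sum_range_add]
    have h1 : ∀ j ∈ Finset.range e, e * 2 ^ ((e * T + j) / e + 1) = e * 2 ^ (T + 1) := by
      intro j hj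
      rw [Nat.mul_add_div he, Nat.div_eq_of_lt (Finset.mem_range.1 hj), add_zero]
    rw [Finset.sum_congr rfl h1, Finset.sum_const, Finset.card_range, smul_eq_mul]
    calc _ ≤ e ^ 2 * 2 ^ (T + 1) + e * (e * 2 ^ (T + 1)) := by omega
      _ = _ := by ring

/-- Polynomial partitioning: incidences outside the zero set of a suitable polynomial. -/
theorem exists_partition (he : 0 < e) (σ : Fin e → Fin 3)
    (P : Finset (Fin 3 → ℝ)) (L : Finset (Set (Fin 3 → ℝ))) (hL : ∀ l ∈ L, IsLine l) (T : ℕ) :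
    ∃ f : MvPolynomial (Fin e) ℝ, f ≠ 0 ∧ f.totalDegree ≤ e ^ 2 * 2 ^ (T + 1) ∧
      2 ^ (e * T) * ∑ l ∈ L, (P.filter fun x => x ∈ l ∧ eval x (rename σ f) ≠ 0).card ≤
        2 ^ (e * T) * (L.card * (e ^ 2 * 2 ^ (T + 1) + 1)) + P.card ^ 2 := by
  obtain ⟨f, hf, hcell⟩ := exists_partitioning_seq σ P (fun i => 2 ^ (i / e + 1) - 1) (fun i => by
    rw [Nat.sub_add_cancel Nat.one_le_two_pow, ← pow_mul]
    refine Nat.pow_lt_pow_right (by norm_num) ?_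
    have := Nat.lt_div_mul_add he (a := i)
    rw [add_mul]
    omega) (e * T)
  set k := e * T with hk
  set G := ∏ i ∈ Finset.range k, f i with hG
  have hGd : G.totalDegree ≤ e ^ 2 * 2 ^ (T + 1) := by
    refine (totalDegree_finsetProd _ _).trans (le_trans ?_ (sum_two_pow_div he T))
    refine Finset.sum_le_sum fun i hi => (hf i (Finset.mem_range.1 hi)).2.trans ?_
    exact Nat.mul_le_mul_left _ (Nat.sub_le _ _)
  refine ⟨G, Finset.prod_ne_zero_iff.2 fun i hi => (hf i (Finset.mem_range.1 hi)).1, hGd, ?_⟩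
  set s : (Fin 3 → ℝ) → Fin k → Bool := fun x i => decide (0 < eval x (rename σ (f i))) with hs
  set P' := P.filter fun x => eval x (rename σ G) ≠ 0 with hP'
  set C : (Fin k → Bool) → Finset (Fin 3 → ℝ) := fun τ => P'.filter fun x => s x = τ with hC
  have hGr : rename σ G = ∏ i ∈ Finset.range k, rename σ (f i) := by rw [hG, map_prod]
  have hCcard : ∀ τ, 2 ^ k * (C τ).card ≤ P.card := by
    intro τ
    refine le_trans (Nat.mul_le_mul_left _ (Finset.card_le_card ?_))
      (hcell fun i => if h : i < k then τ ⟨i, h⟩ else false)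
    intro x hx
    obtain ⟨hx1, hx2⟩ := Finset.mem_filter.1 hx
    obtain ⟨hx3, hx4⟩ := Finset.mem_filter.1 hx1
    refine Finset.mem_filter.2 ⟨hx3, fun i hi => ?_⟩
    have hne : eval x (rename σ (f i)) ≠ 0 := by
      rw [hGr, map_prod] at hx4
      exact Finset.prod_ne_zero_iff.1 hx4 i (Finset.mem_range.2 hi)
    simp only [dif_pos hi, ← hx2, hs]
    by_cases h : 0 < eval x (rename σ (f i))
    · simp only [h, decide_true, if_true]
    · simp only [h, decide_false, Bool.false_eq_true, if_false]
      exact lt_of_le_of_ne (not_lt.1 h) hne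
  have hline : ∀ l ∈ L, (P.filter fun x => x ∈ l ∧ eval x (rename σ G) ≠ 0).card ≤
      (e ^ 2 * 2 ^ (T + 1) + 1) + ∑ τ, ((C τ).filter fun x => x ∈ l).offDiag.card := by
    intro l hl
    set A := P.filter fun x => x ∈ l ∧ eval x (rename σ G) ≠ 0 with hA
    have h1 : (A.image s).card ≤ e ^ 2 * 2 ^ (T + 1) + 1 := by
      have := card_image_signs_le (k := k) (fun i => rename σ (f i)) (hL l hl) A (fun x hx => by
        rw [← hGr]
        exact (Finset.mem_filter.1 hx).2)
      rw [← hGr] at this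
      have h2 := (totalDegree_rename_le σ G).trans hGd
      exact this.trans (by omega)
    have h2 : A.card = ∑ τ ∈ A.image s, (A.filter fun x => s x = τ).card :=
      Finset.card_eq_sum_card_image s A
    have h3 : ∀ τ, A.filter (fun x => s x = τ) = (C τ).filter fun x => x ∈ l := by
      intro τ
      ext x
      simp only [hA, hC, hP', Finset.mem_filter]
      tauto
    have h4 : ∀ B : Finset (Fin 3 → ℝ), B.card ≤ 1 + B.offDiag.card := by
      intro B
      rw [Finset.offDiag_card]
      rcases Nat.eq_zero_or_pos B.card with h | h
      · omega
      · obtain ⟨b, hb⟩ : ∃ b, B.card = b + 1 := ⟨B.card - 1, by omega⟩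
        rw [hb]
        have : (b + 1) * (b + 1) - (b + 1) = (b + 1) * b := by
          rw [Nat.mul_succ, Nat.add_sub_cancel]
        rw [this]
        nlinarith
    rw [h2]
    calc _ ≤ ∑ τ ∈ A.image s, (1 + ((C τ).filter fun x => x ∈ l).offDiag.card) :=
          Finset.sum_le_sum fun τ _ => by rw [h3]; exact h4 _
      _ = (A.image s).card + ∑ τ ∈ A.image s, ((C τ).filter fun x => x ∈ l).offDiag.card := by
          rw [Finset.sum_add_distrib, Finset.sum_const, smul_eq_mul, mul_one]
      _ ≤ _ := Nat.add_le_add h1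
          (Finset.sum_le_sum_of_subset (Finset.subset_univ _))
  have hpairs : ∀ τ, ∑ l ∈ L, ((C τ).filter fun x => x ∈ l).offDiag.card ≤ (C τ).card ^ 2 := by
    intro τ
    rw [← Finset.card_biUnion]
    · refine (Finset.card_le_card (t := C τ ×ˢ C τ) ?_).trans (by rw [Finset.card_product, sq])
      intro z hz
      obtain ⟨l, -, hz⟩ := Finset.mem_biUnion.1 hz
      obtain ⟨h1, h2, -⟩ := Finset.mem_offDiag.1 hz
      exact Finset.mem_product.2 ⟨(Finset.mem_filter.1 h1).1, (Finset.mem_filter.1 h2).1⟩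
    · intro l hl l' hl' hne
      rw [Function.onFun, Finset.disjoint_left]
      intro z hz hz'
      obtain ⟨h1, h2, h3⟩ := Finset.mem_offDiag.1 hz
      obtain ⟨h1', h2', -⟩ := Finset.mem_offDiag.1 hz'
      exact hne ((hL l hl).eq_of_mem (hL l' hl') h3 (Finset.mem_filter.1 h1).2
        (Finset.mem_filter.1 h2).2 (Finset.mem_filter.1 h1').2 (Finset.mem_filter.1 h2').2)
  have hsumC : ∑ τ, (C τ).card ≤ P.card := by
    have : ∑ τ, (C τ).card = P'.card := by
      rw [Finset.card_eq_sum_card_fiberwise (f := s) (t := Finset.univ) (by simp)]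
    rw [this]
    exact Finset.card_filter_le _ _
  calc _ ≤ 2 ^ k * ∑ l ∈ L, ((e ^ 2 * 2 ^ (T + 1) + 1) +
        ∑ τ, ((C τ).filter fun x => x ∈ l).offDiag.card) :=
        Nat.mul_le_mul_left _ (Finset.sum_le_sum hline)
    _ = 2 ^ k * (L.card * (e ^ 2 * 2 ^ (T + 1) + 1)) +
        ∑ τ, 2 ^ k * ∑ l ∈ L, ((C τ).filter fun x => x ∈ l).offDiag.card := by
        rw [Finset.sum_add_distrib, Finset.sum_const, smul_eq_mul, mul_add, Finset.sum_comm,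
          Finset.mul_sum]
    _ ≤ 2 ^ k * (L.card * (e ^ 2 * 2 ^ (T + 1) + 1)) + ∑ τ, P.card * (C τ).card := by
        refine Nat.add_le_add_left (Finset.sum_le_sum fun τ _ => ?_) _
        calc _ ≤ 2 ^ k * (C τ).card ^ 2 := Nat.mul_le_mul_left _ (hpairs τ)
          _ = (2 ^ k * (C τ).card) * (C τ).card := by ring
          _ ≤ _ := Nat.mul_le_mul_right _ (hCcard τ)
    _ ≤ _ := by
        rw [← Finset.mul_sum, sq P.card]
        exact Nat.add_le_add_left (Nat.mul_le_mul_left _ hsumC) _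

end Partition

section BezoutLines

open MvPolynomial

lemma sum_choose_two (d : ℕ) :
    6 * ∑ k ∈ Finset.range (d + 1), (k + 2).choose k = (d + 1) * (d + 2) * (d + 3) := by
  induction d with
  | zero => simp
  | succ d ih =>
    rw [Finset.sum_range_succ, mul_add, ih]
    have h1 : (d + 1 + 2).choose (d + 1) = (d + 3).choose 2 := Nat.choose_symm_of_eq_add (by omega)
    have h2 := Nat.triangle_succ (d + 2)
    have h3 : (d + 3).choose 2 * 2 = (d + 3) * (d + 2) := by
      rw [Nat.choose_two_right]
      exact Nat.div_mul_cancel (Nat.even_mul_pred_self (d + 3)).two_dvd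
    rw [h1]
    nlinarith

lemma six_mul_finrank_restrictTotalDegree (d : ℕ) :
    6 * Module.finrank ℝ (restrictTotalDegree (Fin 3) ℝ d) = (d + 1) * (d + 2) * (d + 3) := by
  rw [← sum_choose_two]
  congr 1
  unfold restrictTotalDegree
  rw [Module.finrank_eq_nat_card_basis (basisRestrictSupport ℝ _)]
  have h1 : {n : Fin 3 →₀ ℕ | (n.sum fun _ e => e) ≤ d} =
      ((Finset.range (d + 1)).biUnion fun k => Finset.univ.finsuppAntidiag k :
        Finset (Fin 3 →₀ ℕ)) := by
    ext n
    simp [Finset.mem_finsuppAntidiag, Finsupp.sum_fintype]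
  rw [h1, Nat.card_eq_card_toFinset, Finset.toFinset_coe, Finset.card_biUnion]
  · refine Finset.sum_congr rfl fun k _ => ?_
    rw [Finset.card_finsuppAntidiag_nat_eq_choose]
    congr 1
    simp
    omega
  · intro i _ j _ hij
    rw [Function.onFun, Finset.disjoint_left]
    intro n hi hj
    simp only [Finset.mem_finsuppAntidiag] at hi hj
    exact hij (hi.1.symm.trans hj.1)

/-- The affine form `∑ aᵢ xᵢ - b`. -/
noncomputable def affineForm (a : Fin 3 → ℝ) (b : ℝ) : MvPolynomial (Fin 3) ℝ :=
  ∑ i, C (a i) * X i - C b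

lemma eval_affineForm (a x : Fin 3 → ℝ) (b : ℝ) :
    eval x (affineForm a b) = ∑ i, a i * x i - b := by
  simp [affineForm]

lemma totalDegree_affineForm_le (a : Fin 3 → ℝ) (b : ℝ) : (affineForm a b).totalDegree ≤ 1 := by
  refine (totalDegree_sub_C_le _ _).trans (totalDegree_finsetSum_le fun i _ => ?_)
  refine (totalDegree_mul _ _).trans ?_
  simp

lemma IsLine.not_subset {l l' : Set (Fin 3 → ℝ)} (hl : IsLine l) (hl' : IsLine l') (hne : l ≠ l') :
    ¬ l ⊆ l' := by
  intro h
  obtain ⟨x, hx, y, hy, hxy⟩ := hl.infinite.nontrivial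
  exact hne (hl.eq_of_mem hl' hxy hx hy (h hx) (h hy))

lemma exists_affineForm_separating {l l' : Set (Fin 3 → ℝ)} (hl : IsLine l) (hl' : IsLine l')
    (hne : l ≠ l') : ∃ a b, VanishesOn (affineForm a b) l' ∧ ¬ VanishesOn (affineForm a b) l := by
  obtain ⟨x, hx, hx'⟩ := Set.not_subset.1 (hl.not_subset hl' hne)
  obtain ⟨p, v, hv, rfl⟩ := hl'
  have hvv : 0 < ∑ i, v i * v i := by
    obtain ⟨i, hi⟩ := Function.ne_iff.1 hv
    exact Finset.sum_pos' (fun i _ => mul_self_nonneg _) ⟨i, Finset.mem_univ _, mul_self_pos.2 hi⟩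
  set c := (∑ i, (x i - p i) * v i) / ∑ i, v i * v i with hc
  set a : Fin 3 → ℝ := fun i => x i - p i - c * v i with ha
  have hav : ∑ i, a i * v i = 0 := by
    have : ∑ i, a i * v i = ∑ i, (x i - p i) * v i - c * ∑ i, v i * v i := by
      rw [Finset.mul_sum, ← Finset.sum_sub_distrib]
      exact Finset.sum_congr rfl fun i _ => by rw [ha]; ring
    rw [this, hc, div_mul_cancel₀ _ hvv.ne', sub_self]
  refine ⟨a, ∑ i, a i * p i, ?_, ?_⟩
  · rintro _ ⟨t, rfl⟩
    rw [eval_affineForm]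
    have : ∑ i, a i * (p + t • v) i = ∑ i, a i * p i + t * ∑ i, a i * v i := by
      rw [Finset.mul_sum, ← Finset.sum_add_distrib]
      exact Finset.sum_congr rfl fun i _ => by simp; ring
    rw [this, hav]
    ring
  · intro h
    have h0 := h x hx
    rw [eval_affineForm] at h0
    have h1 : ∑ i, a i * a i = ∑ i, a i * x i - ∑ i, a i * p i - c * ∑ i, a i * v i := by
      rw [Finset.mul_sum, ← Finset.sum_sub_distrib, ← Finset.sum_sub_distrib]
      exact Finset.sum_congr rfl fun i _ => by simp only [ha]; ring
    rw [h0, hav, mul_zero, sub_zero] at h1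
    rw [Finset.sum_eq_zero_iff_of_nonneg fun i _ => mul_self_nonneg _] at h1
    apply hx'
    refine ⟨c, ?_⟩
    ext i
    have := mul_self_eq_zero.1 (h1 i (Finset.mem_univ _))
    simp only [ha] at this
    simp only [Pi.add_apply, Pi.smul_apply, smul_eq_mul]
    linarith

lemma exists_coordinate_on_line {p v : Fin 3 → ℝ} (hv : v ≠ 0) :
    ∃ a b, lineRestrict p v (affineForm a b) = Polynomial.X := by
  have hvv : 0 < ∑ i, v i * v i := by
    obtain ⟨i, hi⟩ := Function.ne_iff.1 hv
    exact Finset.sum_pos' (fun i _ => mul_self_nonneg _) ⟨i, Finset.mem_univ _, mul_self_pos.2 hi⟩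
  refine ⟨fun i => v i / ∑ j, v j * v j, ∑ i, v i / (∑ j, v j * v j) * p i, ?_⟩
  refine Polynomial.funext fun t => ?_
  rw [eval_lineRestrict, eval_affineForm, Polynomial.eval_X, ← Finset.sum_sub_distrib]
  have : ∀ i, v i / (∑ j, v j * v j) * (p + t • v) i - v i / (∑ j, v j * v j) * p i =
      t / (∑ j, v j * v j) * (v i * v i) := fun i => by
    simp only [Pi.add_apply, Pi.smul_apply, smul_eq_mul]
    ring
  rw [Finset.sum_congr rfl fun i _ => this i, ← Finset.mul_sum]
  exact div_mul_cancel₀ t hvv.ne.symm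

/-- Two coprime polynomials have at most `deg f * deg g` common lines. -/
theorem card_common_lines_le {f g : MvPolynomial (Fin 3) ℝ} (hg : g ≠ 0)
    (hfg : IsRelPrime f g) (L : Finset (Set (Fin 3 → ℝ)))
    (hL : ∀ l ∈ L, IsLine l ∧ VanishesOn f l ∧ VanishesOn g l) :
    L.card ≤ f.totalDegree * g.totalDegree := by
  by_contra! hlt
  set a := f.totalDegree with ha
  set b := g.totalDegree with hb
  obtain ⟨L', hL', hcard⟩ := Finset.exists_subset_card_eq (Nat.succ_le_of_lt hlt)
  have hL'' : ∀ l ∈ L', IsLine l ∧ VanishesOn f l ∧ VanishesOn g l := fun l hl => hL l (hL' hl)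
  clear hL hlt hL' L
  rename Finset (Set (Fin 3 → ℝ)) => L
  rename ∀ l ∈ L, _ => hL
  have hsep : ∀ l l' : L, l ≠ l' → ∃ h : MvPolynomial (Fin 3) ℝ, h.totalDegree ≤ 1 ∧
      VanishesOn h l' ∧ ¬ VanishesOn h l := by
    intro l l' hne
    obtain ⟨a, b, h1, h2⟩ := exists_affineForm_separating (hL l l.2).1 (hL l' l'.2).1
      fun h => hne (Subtype.ext h)
    exact ⟨_, totalDegree_affineForm_le a b, h1, h2⟩
  choose! h hdeg hvan hnot using hsep
  have hpar : ∀ l : L, ∃ p v : Fin 3 → ℝ, v ≠ 0 ∧ (l : Set (Fin 3 → ℝ)) = {x | ∃ t : ℝ, x = p + t • v} :=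
    fun l => (hL l l.2).1
  choose p v hv hl using hpar
  have hcoord : ∀ l : L, ∃ c : MvPolynomial (Fin 3) ℝ, c.totalDegree ≤ 1 ∧
      lineRestrict (p l) (v l) c = Polynomial.X := by
    intro l
    obtain ⟨a, b, h⟩ := exists_coordinate_on_line (p := p l) (hv l)
    exact ⟨_, totalDegree_affineForm_le a b, h⟩
  choose c hc hcX using hcoord
  let q : L → MvPolynomial (Fin 3) ℝ := fun l => ∏ l' ∈ Finset.univ.erase l, h l l'
  have hqdeg : ∀ l, (q l).totalDegree ≤ a * b := by
    intro l
    refine (totalDegree_finsetProd _ _).trans ((Finset.sum_le_card_nsmul _ _ 1 ?_).trans ?_)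
    · intro l' hl'
      exact hdeg l l' (Finset.ne_of_mem_erase hl').symm
    · rw [Finset.card_erase_of_mem (Finset.mem_univ _), Finset.card_univ, Fintype.card_coe, hcard]
      simp
  have hq0 : ∀ l, lineRestrict (p l) (v l) (q l) ≠ 0 := by
    intro l
    rw [map_prod, Finset.prod_ne_zero_iff]
    intro l' hl' h0
    rw [lineRestrict_eq_zero_iff, ← hl l] at h0
    exact hnot l l' (Finset.ne_of_mem_erase hl').symm h0
  have hq1 : ∀ l l', l ≠ l' → lineRestrict (p l) (v l) (q l') = 0 := by
    intro l l' hne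
    rw [map_prod]
    refine Finset.prod_eq_zero (Finset.mem_erase.2 ⟨hne, Finset.mem_univ l⟩) ?_
    rw [lineRestrict_eq_zero_iff, ← hl l]
    exact hvan l' l hne.symm
  set E' := (a * b) ^ 2 + 2 * (a * b) with hE'
  set E := a * b + E' with hE
  set M := a + b + E' + 1 with hM
  let V := fun d => restrictTotalDegree (Fin 3) ℝ d
  let Φ : (V (E + b) × V (E + a) × (L → Fin M → ℝ)) →ₗ[ℝ] MvPolynomial (Fin 3) ℝ :=
    (LinearMap.mulLeft ℝ f ∘ₗ (V (E + b)).subtype).coprod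
      ((LinearMap.mulLeft ℝ g ∘ₗ (V (E + a)).subtype).coprod
        (∑ l : L, ∑ k : Fin M, (LinearMap.toSpanSingleton ℝ _ (q l * c l ^ (k : ℕ))) ∘ₗ
          LinearMap.proj k ∘ₗ LinearMap.proj l))
  have hΦ : ∀ u w d, Φ (u, w, d) = f * u + (g * w + ∑ l : L, ∑ k : Fin M,
      d l k • (q l * c l ^ (k : ℕ))) := by
    intro u w d
    simp [Φ]
  let Ψ : V E →ₗ[ℝ] (V (E + b) × V (E + a) × (L → Fin M → ℝ)) :=
    ((LinearMap.mulLeft ℝ g).restrict (p := V E) (q := V (E + b)) (fun z hz => by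
      rw [mem_restrictTotalDegree] at hz ⊢
      exact (totalDegree_mul _ _).trans (by omega))).prod
      ((((LinearMap.mulLeft ℝ (-f)).restrict (p := V E) (q := V (E + a)) (fun z hz => by
      rw [mem_restrictTotalDegree] at hz ⊢
      refine (totalDegree_mul _ _).trans ?_
      rw [totalDegree_neg]
      omega))).prod 0)
  have hrange : LinearMap.range Φ ≤ V (E + a + b) := by
    rintro _ ⟨⟨u, w, d⟩, rfl⟩
    rw [hΦ]
    have hu := (mem_restrictTotalDegree (Fin 3) (E + b) u.1).1 u.2
    have hw := (mem_restrictTotalDegree (Fin 3) (E + a) w.1).1 w.2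
    refine Submodule.add_mem _ ?_ (Submodule.add_mem _ ?_ (Submodule.sum_mem _ fun l _ =>
      Submodule.sum_mem _ fun k _ => Submodule.smul_mem _ _ ?_))
    · rw [mem_restrictTotalDegree]
      exact (totalDegree_mul _ _).trans (by omega)
    · rw [mem_restrictTotalDegree]
      exact (totalDegree_mul _ _).trans (by omega)
    · rw [mem_restrictTotalDegree]
      have h1 := (totalDegree_mul (q l) (c l ^ (k : ℕ)))
      have h2 := totalDegree_pow (c l) (k : ℕ)
      have h3 : (k : ℕ) * (c l).totalDegree ≤ k := by
        calc _ ≤ (k : ℕ) * 1 := Nat.mul_le_mul_left _ (hc l)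
          _ = k := mul_one _
      have h4 := hqdeg l
      have h5 := k.2
      omega
  have hker : LinearMap.ker Φ ≤ LinearMap.range Ψ := by
    rintro ⟨u, w, d⟩ hx
    rw [LinearMap.mem_ker, hΦ] at hx
    have hd : d = 0 := by
      ext l k
      have h1 := congrArg (lineRestrict (p l) (v l)) hx
      have hf0 : lineRestrict (p l) (v l) f = 0 := by
        rw [lineRestrict_eq_zero_iff, ← hl l]
        exact (hL l l.2).2.1
      have hg0 : lineRestrict (p l) (v l) g = 0 := by
        rw [lineRestrict_eq_zero_iff, ← hl l]
        exact (hL l l.2).2.2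
      simp only [map_add, map_mul, hf0, hg0, zero_mul, zero_add, map_sum, map_smul, map_zero,
        map_pow] at h1
      rw [Finset.sum_eq_single l] at h1
      · simp only [hcX] at h1
        have h2 : lineRestrict (p l) (v l) (q l) *
            ∑ k : Fin M, Polynomial.C (d l k) * Polynomial.X ^ (k : ℕ) = 0 := by
          rw [← h1, Finset.mul_sum]
          refine Finset.sum_congr rfl fun k _ => ?_
          rw [Polynomial.smul_eq_C_mul]
          ring
        have h3 := (mul_eq_zero.1 h2).resolve_left (hq0 l)
        have h4 := congrArg (fun r => Polynomial.coeff r (k : ℕ)) h3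
        simp only [Polynomial.finsetSum_coeff, Polynomial.coeff_C_mul, Polynomial.coeff_X_pow,
          Polynomial.coeff_zero] at h4
        rw [Finset.sum_eq_single k] at h4
        · simpa using h4
        · intro k' _ hk'
          have : (k : ℕ) ≠ k' := fun h => hk' (Fin.ext h.symm)
          simp [this]
        · simp
      · intro l' _ hne
        simp [hq1 l l' hne.symm]
      · simp
    subst hd
    simp only [Pi.zero_apply, zero_smul, Finset.sum_const_zero, add_zero] at hx
    have hdvd : g ∣ f * u := ⟨-w, by linear_combination hx⟩
    obtain ⟨z, hz⟩ := hfg.symm.dvd_of_dvd_mul_left hdvd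
    have hu := (mem_restrictTotalDegree (Fin 3) (E + b) u.1).1 u.2
    have hzV : z ∈ V E := by
      rw [mem_restrictTotalDegree]
      by_cases h0 : z = 0
      · simp [h0]
      · rw [hz, totalDegree_mul_of_isDomain hg h0] at hu
        omega
    refine ⟨⟨z, hzV⟩, ?_⟩
    have hw : (w : MvPolynomial (Fin 3) ℝ) = -f * z := by
      apply mul_left_cancel₀ hg
      rw [hz] at hx
      linear_combination hx
    refine Prod.ext (Subtype.ext ?_) (Prod.ext (Subtype.ext ?_) ?_)
    · simp [Ψ, hz]
    · simp [Ψ, hw]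
    · simp [Ψ]
  have h1 := LinearMap.finrank_range_add_finrank_ker Φ
  have h2 := Submodule.finrank_mono hrange
  have h3 := (Submodule.finrank_mono hker).trans (LinearMap.finrank_range_le Ψ)
  have h4 : Module.finrank ℝ (V (E + b) × V (E + a) × (L → Fin M → ℝ)) =
      Module.finrank ℝ (V (E + b)) + (Module.finrank ℝ (V (E + a)) + (a * b + 1) * M) := by
    rw [Module.finrank_prod, Module.finrank_prod, Module.finrank_pi_fintype]
    simp [hcard]
  have d1 := six_mul_finrank_restrictTotalDegree (E + b)
  have d2 := six_mul_finrank_restrictTotalDegree (E + a)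
  have d3 := six_mul_finrank_restrictTotalDegree (E + a + b)
  have d4 := six_mul_finrank_restrictTotalDegree E
  have h5 : (E + b + 1) * (E + b + 2) * (E + b + 3) + (E + a + 1) * (E + a + 2) * (E + a + 3) +
      6 * ((a * b + 1) * M) ≤
      (E + a + b + 1) * (E + a + b + 2) * (E + a + b + 3) + (E + 1) * (E + 2) * (E + 3) := by
    rw [← d1, ← d2, ← d3, ← d4]
    simp only [V] at h1 h2 h3 h4
    omega
  have h6 : (E + a + b + 1) * (E + a + b + 2) * (E + a + b + 3) + (E + 1) * (E + 2) * (E + 3) =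
      (E + b + 1) * (E + b + 2) * (E + b + 3) + (E + a + 1) * (E + a + 2) * (E + a + 3) +
      (6 * (a * b) * E + 3 * (a * b) * (a + b) + 12 * (a * b)) := by ring
  rw [h6] at h5
  have h7 : 6 * ((a * b + 1) * M) ≤ 6 * (a * b) * E + 3 * (a * b) * (a + b) + 12 * (a * b) := by
    omega
  rw [hM, hE, hE'] at h7
  have h8 : 6 * ((a * b + 1) * (a + b + ((a * b) ^ 2 + 2 * (a * b)) + 1)) =
      (6 * (a * b) * (a * b + ((a * b) ^ 2 + 2 * (a * b))) + 3 * (a * b) * (a + b) + 12 * (a * b)) +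
      (3 * (a * b) * (a + b) + 6 * (a * b) + 6 * (a + b) + 6) := by ring
  omega

end BezoutLines

section RuledPoints

open MvPolynomial Matrix

/-- The bilinear form with matrix `H`. -/
def bilin {R : Type*} [CommRing R] (H : Fin 3 → Fin 3 → R) (x y : Fin 3 → R) : R :=
  ∑ i, ∑ j, x i * H i j * y j

lemma dvd_bilin_sub {R : Type*} [CommRing R] {z : R} (H : Fin 3 → Fin 3 → R)
    {x x' y y' : Fin 3 → R} (hx : ∀ i, z ∣ x i - x' i) (hy : ∀ i, z ∣ y i - y' i) :
    z ∣ bilin H x y - bilin H x' y' := by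
  unfold bilin
  rw [← Finset.sum_sub_distrib]
  refine Finset.dvd_sum fun i _ => ?_
  rw [← Finset.sum_sub_distrib]
  refine Finset.dvd_sum fun j _ => ?_
  have : x i * H i j * y j - x' i * H i j * y' j =
      (x i - x' i) * (H i j * y j) + (y j - y' j) * (x' i * H i j) := by ring
  rw [this]
  exact dvd_add ((hx i).mul_right _) ((hy j).mul_right _)

lemma dvd_cross {R : Type*} [CommRing R] {z : R} {c : Fin 3 → R}
    (h : ∀ i, z ∣ c i) (a : Fin 3 → R) (i : Fin 3) : z ∣ crossProduct a c i := by
  rw [cross_apply]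
  fin_cases i <;> exact dvd_sub ((h _).mul_left _) ((h _).mul_left _)

lemma dotProduct_self_mul_eq {R : Type*} [CommRing R] (V n : Fin 3 → R) (i : Fin 3) :
    (n ⬝ᵥ n) * V i = (V ⬝ᵥ n) * n i + crossProduct n (crossProduct V n) i := by
  fin_cases i <;> simp [cross_apply, dotProduct, Fin.sum_univ_three] <;> ring

lemma dvd_cross_sub {R : Type*} [CommRing R] {z : R} {V n : Fin 3 → R}
    (h : ∀ i, z ∣ crossProduct V n i) (a : Fin 3 → R) (i : Fin 3) :
    z ∣ (n ⬝ᵥ n) * crossProduct a V i - (V ⬝ᵥ n) * crossProduct a n i := by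
  have e : (n ⬝ᵥ n) * crossProduct a V i - (V ⬝ᵥ n) * crossProduct a n i =
      crossProduct a (crossProduct n (crossProduct V n)) i := by
    fin_cases i <;> simp [cross_apply, dotProduct, Fin.sum_univ_three] <;> ring
  rw [e]
  exact dvd_cross (dvd_cross h n) a i

lemma bilin_mul_mul {R : Type*} [CommRing R] (H : Fin 3 → Fin 3 → R) (c d : R) (x y : Fin 3 → R) :
    bilin H (fun i => c * x i) (fun i => d * y i) = c * d * bilin H x y := by
  unfold bilin
  rw [Finset.mul_sum]
  refine Finset.sum_congr rfl fun i _ => ?_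
  rw [Finset.mul_sum]
  exact Finset.sum_congr rfl fun j _ => by ring

lemma dvd_bilin_normal {R : Type*} [CommRing R] {z : R} {V n : Fin 3 → R} (H : Fin 3 → Fin 3 → R)
    (h : ∀ i, z ∣ crossProduct V n i) (a b : Fin 3 → R)
    (hq : z ∣ bilin H (crossProduct a V) (crossProduct b V)) :
    z ∣ (V ⬝ᵥ n) ^ 2 * bilin H (crossProduct a n) (crossProduct b n) := by
  have h1 := dvd_bilin_sub H (dvd_cross_sub h a) (dvd_cross_sub h b)
  rw [bilin_mul_mul, bilin_mul_mul] at h1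
  rw [pow_two]
  exact (dvd_sub_right (hq.mul_left _)).1 h1

/-- The gradient of a polynomial. -/
noncomputable def grad (f : MvPolynomial (Fin 3) ℝ) (i : Fin 3) : MvPolynomial (Fin 3) ℝ :=
  pderiv i f

/-- The Hessian form of `f` on the tangent directions `a × ∇f` and `b × ∇f`. -/
noncomputable def tangentHessian (f : MvPolynomial (Fin 3) ℝ) (a b : Fin 3 → ℝ) :
    MvPolynomial (Fin 3) ℝ :=
  bilin (fun i j => grad (grad f j) i) (crossProduct (fun i => C (a i)) (grad f))
    (crossProduct (fun i => C (b i)) (grad f))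

lemma map_crossProduct {R S : Type*} [CommRing R] [CommRing S] (φ : R →+* S) (a b : Fin 3 → R) :
    (fun i => φ (crossProduct a b i)) = crossProduct (fun i => φ (a i)) (fun i => φ (b i)) := by
  ext i
  fin_cases i <;> simp [cross_apply]

lemma map_bilin {R S : Type*} [CommRing R] [CommRing S] (φ : R →+* S) (H : Fin 3 → Fin 3 → R)
    (x y : Fin 3 → R) :
    φ (bilin H x y) = bilin (fun i j => φ (H i j)) (fun i => φ (x i)) (fun i => φ (y i)) := by
  simp [bilin]

lemma totalDegree_grad (f : MvPolynomial (Fin 3) ℝ) (i : Fin 3) (h : grad f i ≠ 0) :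
    (grad f i).totalDegree + 1 ≤ f.totalDegree := by
  obtain ⟨m, hm, hd⟩ := Finset.exists_mem_eq_sup _ (support_nonempty.2 h) fun s => s.sum fun _ e => e
  have h1 : m + Finsupp.single i 1 ∈ f.support := by
    rw [mem_support_iff] at hm ⊢
    intro h0
    exact hm (by rw [grad, coeff_pderiv, h0, zero_mul])
  have h2 := le_totalDegree h1
  rw [Finsupp.sum_add_index' (fun _ => rfl) (fun _ _ _ => rfl), Finsupp.sum_single_index rfl] at h2
  rw [totalDegree, hd]
  exact h2

lemma totalDegree_grad_le (f : MvPolynomial (Fin 3) ℝ) (i : Fin 3) :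
    (grad f i).totalDegree ≤ f.totalDegree := by
  by_cases h : grad f i = 0
  · simp [h]
  · have := totalDegree_grad f i h
    omega

lemma totalDegree_cross_le {d : ℕ} {g : Fin 3 → MvPolynomial (Fin 3) ℝ} (a : Fin 3 → ℝ)
    (hg : ∀ i, (g i).totalDegree ≤ d) (i : Fin 3) :
    (crossProduct (fun i => C (a i)) g i).totalDegree ≤ d := by
  have h : ∀ i j, (C (a i) * g j).totalDegree ≤ d := fun i j =>
    (totalDegree_mul _ _).trans (by simpa using hg j)
  rw [cross_apply]
  fin_cases i <;> exact (totalDegree_sub _ _).trans (max_le (h _ _) (h _ _))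

lemma totalDegree_tangentHessian_le (f : MvPolynomial (Fin 3) ℝ) (a b : Fin 3 → ℝ) :
    (tangentHessian f a b).totalDegree ≤ 3 * f.totalDegree := by
  refine totalDegree_finsetSum_le fun i _ => totalDegree_finsetSum_le fun j _ => ?_
  have h1 := totalDegree_cross_le a (totalDegree_grad_le f) i
  have h2 := totalDegree_cross_le b (totalDegree_grad_le f) j
  have h3 := (totalDegree_grad_le (grad f j) i).trans (totalDegree_grad_le f j)
  refine (totalDegree_mul _ _).trans ?_
  beta_reduce
  have := totalDegree_mul (crossProduct (fun i => C (a i)) (grad f) i) (grad (grad f j) i)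
  omega

lemma derivative_lineRestrict (p u : Fin 3 → ℝ) (f : MvPolynomial (Fin 3) ℝ) :
    Polynomial.derivative (lineRestrict p u f) =
      ∑ i, Polynomial.C (u i) * lineRestrict p u (grad f i) := by
  unfold lineRestrict grad
  induction f using MvPolynomial.induction_on with
  | C a => simp
  | add f g hf hg => simp [hf, hg, mul_add, Finset.sum_add_distrib]
  | mul_X f i hf =>
    simp only [map_mul, Polynomial.derivative_mul, hf, Derivation.leibniz, map_add, aeval_X,
      smul_eq_mul, pderiv_X]
    simp only [mul_add]
    rw [Finset.sum_add_distrib, Finset.sum_mul, add_comm]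
    congr 1
    · rw [Finset.sum_eq_single i]
      · simp
        ring
      · intro j _ hj
        simp [hj.symm]
      · simp
    · rw [← Finset.sum_mul, ← mul_add, Finset.sum_mul]
      exact Finset.sum_congr rfl fun j _ => by ring

lemma dotProduct_self_pos {v : Fin 3 → ℝ} (hv : v ≠ 0) : 0 < v ⬝ᵥ v := by
  obtain ⟨i, hi⟩ := Function.ne_iff.1 hv
  exact Finset.sum_pos' (fun i _ => mul_self_nonneg _) ⟨i, Finset.mem_univ _, mul_self_pos.2 hi⟩

/-- The bilinear form vanishes on the plane spanned by three pairwise independent isotropic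
vectors. -/
lemma bilin_eq_zero_of_isotropic {H : Fin 3 → Fin 3 → ℝ} (hH : ∀ i j, H i j = H j i)
    {v u₁ u₂ u₃ : Fin 3 → ℝ} (hv : v ≠ 0) (h₁ : u₁ ⬝ᵥ v = 0) (h₂ : u₂ ⬝ᵥ v = 0)
    (h₃ : u₃ ⬝ᵥ v = 0) (q₁ : bilin H u₁ u₁ = 0) (q₂ : bilin H u₂ u₂ = 0)
    (q₃ : bilin H u₃ u₃ = 0) (i₁₂ : crossProduct u₁ u₂ ≠ 0) (i₁₃ : crossProduct u₁ u₃ ≠ 0)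
    (i₂₃ : crossProduct u₂ u₃ ≠ 0) {w w' : Fin 3 → ℝ} (hw : w ⬝ᵥ v = 0) (hw' : w' ⬝ᵥ v = 0) :
    bilin H w w' = 0 := by
  set N := crossProduct u₁ u₂ with hN
  have hNpos := dotProduct_self_pos i₁₂
  have hvpos := dotProduct_self_pos hv
  have hdet : ∀ w : Fin 3 → ℝ, w ⬝ᵥ v = 0 → w ⬝ᵥ N = 0 := by
    intro w hw
    have : (v ⬝ᵥ v) * (w ⬝ᵥ N) = 0 := by
      have e : (v ⬝ᵥ v) * (w ⬝ᵥ N) = (N ⬝ᵥ v) * (w ⬝ᵥ v) +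
          (w ⬝ᵥ crossProduct v u₂) * (u₁ ⬝ᵥ v) - (w ⬝ᵥ crossProduct v u₁) * (u₂ ⬝ᵥ v) := by
        simp [hN, cross_apply, dotProduct, Fin.sum_univ_three]
        ring
      rw [e, hw, h₁, h₂]
      ring
    exact (mul_eq_zero.1 this).resolve_left hvpos.ne'
  have hrep : ∀ w : Fin 3 → ℝ, w ⬝ᵥ v = 0 → ∀ i, (N ⬝ᵥ N) * w i =
      (w ⬝ᵥ crossProduct u₂ N) * u₁ i + (w ⬝ᵥ crossProduct N u₁) * u₂ i := by
    intro w hw i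
    have h0 := hdet w hw
    have : (N ⬝ᵥ N) * w i =
      (w ⬝ᵥ crossProduct u₂ N) * u₁ i + (w ⬝ᵥ crossProduct N u₁) * u₂ i + (w ⬝ᵥ N) * N i := by
      fin_cases i <;> simp [hN, cross_apply, dotProduct, Fin.sum_univ_three] <;> ring
    rw [this, h0]
    ring
  have hexp : ∀ w w' : Fin 3 → ℝ, w ⬝ᵥ v = 0 → w' ⬝ᵥ v = 0 → (N ⬝ᵥ N) * (N ⬝ᵥ N) * bilin H w w' =
      ((w ⬝ᵥ crossProduct u₂ N) * (w' ⬝ᵥ crossProduct N u₁) +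
        (w ⬝ᵥ crossProduct N u₁) * (w' ⬝ᵥ crossProduct u₂ N)) * bilin H u₁ u₂ := by
    intro w w' hw hw'
    rw [← bilin_mul_mul]
    simp only [hrep w hw, hrep w' hw']
    generalize w ⬝ᵥ crossProduct u₂ N = α
    generalize w ⬝ᵥ crossProduct N u₁ = β
    generalize w' ⬝ᵥ crossProduct u₂ N = γ
    generalize w' ⬝ᵥ crossProduct N u₁ = δ
    simp only [bilin, Fin.sum_univ_three, hH 1 0, hH 2 0, hH 2 1] at q₁ q₂ ⊢
    linear_combination α * γ * q₁ + β * δ * q₂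
  have h12 : bilin H u₁ u₂ = 0 := by
    have h := hexp u₃ u₃ h₃ h₃
    rw [q₃, mul_zero] at h
    have hr := hrep u₃ h₃
    have hα : u₃ ⬝ᵥ crossProduct u₂ N ≠ 0 := by
      intro h0
      apply i₂₃
      simp only [h0, zero_mul, zero_add] at hr
      have : ∀ i, (N ⬝ᵥ N) * crossProduct u₂ u₃ i = 0 := by
        intro i
        fin_cases i <;> simp only [cross_apply, Fin.zero_eta, Fin.mk_one, Fin.reduceFinMk,
          cons_val_zero, cons_val_one, cons_val]
        · linear_combination u₂ 1 * hr 2 - u₂ 2 * hr 1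
        · linear_combination u₂ 2 * hr 0 - u₂ 0 * hr 2
        · linear_combination u₂ 0 * hr 1 - u₂ 1 * hr 0
      ext i
      exact (mul_eq_zero.1 (this i)).resolve_left hNpos.ne'
    have hβ : u₃ ⬝ᵥ crossProduct N u₁ ≠ 0 := by
      intro h0
      apply i₁₃
      simp only [h0, zero_mul, add_zero] at hr
      have : ∀ i, (N ⬝ᵥ N) * crossProduct u₁ u₃ i = 0 := by
        intro i
        fin_cases i <;> simp only [cross_apply, Fin.zero_eta, Fin.mk_one, Fin.reduceFinMk,
          cons_val_zero, cons_val_one, cons_val]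
        · linear_combination u₁ 1 * hr 2 - u₁ 2 * hr 1
        · linear_combination u₁ 2 * hr 0 - u₁ 0 * hr 2
        · linear_combination u₁ 0 * hr 1 - u₁ 1 * hr 0
      ext i
      exact (mul_eq_zero.1 (this i)).resolve_left hNpos.ne'
    have h' : (2 * (u₃ ⬝ᵥ crossProduct u₂ N) * (u₃ ⬝ᵥ crossProduct N u₁)) * bilin H u₁ u₂ = 0 := by
      linear_combination -h
    exact (mul_eq_zero.1 h').resolve_left (by positivity)
  have h := hexp w w' hw hw'
  rw [h12, mul_zero] at h
  exact (mul_eq_zero.1 h).resolve_left (by positivity)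

lemma grad_comm (f : MvPolynomial (Fin 3) ℝ) (i j : Fin 3) :
    grad (grad f i) j = grad (grad f j) i := by
  obtain rfl | hij := eq_or_ne i j
  · rfl
  ext m
  simp only [grad, coeff_pderiv, Finsupp.add_apply, Finsupp.single_eq_of_ne hij,
    Finsupp.single_eq_of_ne hij.symm]
  rw [add_right_comm m]
  push_cast
  ring

lemma IsLine.cross_ne_zero {x u u' : Fin 3 → ℝ} (hu : u ≠ 0) (hu' : u' ≠ 0)
    (h : {y | ∃ t : ℝ, y = x + t • u} ≠ {y | ∃ t : ℝ, y = x + t • u'}) :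
    crossProduct u u' ≠ 0 := by
  intro h0
  apply h
  have hpos := dotProduct_self_pos hu
  have hmem : x + u' ∈ {y | ∃ t : ℝ, y = x + t • u} := by
    refine ⟨(u' ⬝ᵥ u) / (u ⬝ᵥ u), ?_⟩
    ext i
    have := dotProduct_self_mul_eq u' u i
    rw [← cross_anticomm u u', h0, neg_zero, map_zero] at this
    simp only [Pi.add_apply, Pi.smul_apply, smul_eq_mul, Pi.zero_apply] at this ⊢
    field_simp
    linarith
  refine IsLine.eq_of_mem ⟨x, u, hu, rfl⟩ ⟨x, u', hu', rfl⟩ (x := x) (y := x + u') ?_ ⟨0, by simp⟩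
    hmem ⟨0, by simp⟩ ⟨1, by simp⟩
  simpa using hu'

lemma IsLine.exists_direction {l : Set (Fin 3 → ℝ)} (hl : IsLine l) {x : Fin 3 → ℝ} (hx : x ∈ l) :
    ∃ u : Fin 3 → ℝ, u ≠ 0 ∧ l = {y | ∃ t : ℝ, y = x + t • u} := by
  obtain ⟨p, v, hv, rfl⟩ := hl
  refine ⟨v, hv, ?_⟩
  obtain ⟨t, rfl⟩ := hx
  ext y
  constructor
  · rintro ⟨r, rfl⟩
    exact ⟨r - t, by module⟩
  · rintro ⟨r, rfl⟩
    exact ⟨t + r, by module⟩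

lemma tangent_of_vanishesOn {f : MvPolynomial (Fin 3) ℝ} {x u : Fin 3 → ℝ}
    (h : VanishesOn f {y | ∃ t : ℝ, y = x + t • u}) :
    (u ⬝ᵥ fun i => eval x (grad f i)) = 0 ∧
      bilin (fun i j => eval x (grad (grad f j) i)) u u = 0 := by
  rw [← lineRestrict_eq_zero_iff] at h
  have hev : ∀ g, (lineRestrict x u g).eval 0 = eval x g := fun g => by
    rw [eval_lineRestrict]; simp
  have h1 := derivative_lineRestrict x u f
  rw [h, map_zero] at h1
  constructor
  · have := congrArg (Polynomial.eval 0) h1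
    simp only [Polynomial.eval_zero, Polynomial.eval_finsetSum, Polynomial.eval_mul,
      Polynomial.eval_C, hev] at this
    exact this.symm
  · have h2 := congrArg Polynomial.derivative h1
    simp only [map_zero, map_sum, Polynomial.derivative_C_mul, derivative_lineRestrict] at h2
    have := congrArg (Polynomial.eval 0) h2
    simp only [Polynomial.eval_zero, Polynomial.eval_finsetSum, Polynomial.eval_mul,
      Polynomial.eval_C, hev] at this
    rw [bilin, Finset.sum_comm, this]
    refine Finset.sum_congr rfl fun i _ => ?_
    rw [Finset.mul_sum]
    exact Finset.sum_congr rfl fun j _ => by ring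

lemma eval_tangentHessian_eq_zero {f : MvPolynomial (Fin 3) ℝ} {x : Fin 3 → ℝ} (a b : Fin 3 → ℝ)
    {l₁ l₂ l₃ : Set (Fin 3 → ℝ)} (h₁ : IsLine l₁) (h₂ : IsLine l₂) (h₃ : IsLine l₃)
    (n₁₂ : l₁ ≠ l₂) (n₁₃ : l₁ ≠ l₃) (n₂₃ : l₂ ≠ l₃) (m₁ : x ∈ l₁) (m₂ : x ∈ l₂) (m₃ : x ∈ l₃)
    (v₁ : VanishesOn f l₁) (v₂ : VanishesOn f l₂) (v₃ : VanishesOn f l₃) :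
    eval x (tangentHessian f a b) = 0 := by
  obtain ⟨u₁, hu₁, rfl⟩ := h₁.exists_direction m₁
  obtain ⟨u₂, hu₂, rfl⟩ := h₂.exists_direction m₂
  obtain ⟨u₃, hu₃, rfl⟩ := h₃.exists_direction m₃
  obtain ⟨t₁, q₁⟩ := tangent_of_vanishesOn v₁
  obtain ⟨t₂, q₂⟩ := tangent_of_vanishesOn v₂
  obtain ⟨t₃, q₃⟩ := tangent_of_vanishesOn v₃
  unfold tangentHessian
  rw [map_bilin, map_crossProduct, map_crossProduct]
  simp only [eval_C]
  by_cases hv : (fun i => eval x (grad f i)) = 0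
  · rw [hv]
    simp [bilin]
  · refine bilin_eq_zero_of_isotropic (fun i j => ?_) hv t₁ t₂ t₃ q₁ q₂ q₃
      (IsLine.cross_ne_zero hu₁ hu₂ n₁₂) (IsLine.cross_ne_zero hu₁ hu₃ n₁₃)
      (IsLine.cross_ne_zero hu₂ hu₃ n₂₃) ?_ ?_
    · rw [grad_comm]
    · rw [dotProduct_comm, dot_cross_self]
    · rw [dotProduct_comm, dot_cross_self]

lemma X_pow_succ_dvd_of_derivative {k : ℕ} {g : Polynomial ℝ} (h0 : g.eval 0 = 0)
    (h : Polynomial.X ^ k ∣ Polynomial.derivative g) : Polynomial.X ^ (k + 1) ∣ g := by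
  rw [Polynomial.X_pow_dvd_iff] at h ⊢
  intro d hd
  cases d with
  | zero => rw [Polynomial.coeff_zero_eq_eval_zero, h0]
  | succ d =>
    have := h d (by omega)
    rw [Polynomial.coeff_derivative] at this
    exact (mul_eq_zero.1 this).resolve_right (by positivity)

/-- If the second fundamental form of an irreducible surface vanishes then the surface contains
its tangent planes at regular points. -/
lemma lineRestrict_eq_zero_of_dvd {f : MvPolynomial (Fin 3) ℝ}
    (hf : ∀ a b, f ∣ tangentHessian f a b) {p u : Fin 3 → ℝ} (hp : eval p f = 0)
    (hn : (fun i => eval p (grad f i)) ≠ 0) (hu : (u ⬝ᵥ fun i => eval p (grad f i)) = 0) :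
    lineRestrict p u f = 0 := by
  set n₀ : Fin 3 → ℝ := fun i => eval p (grad f i) with hn₀
  have hpos := dotProduct_self_pos hn
  have hev : ∀ g, (lineRestrict p u g).eval 0 = eval p g := fun g => by
    rw [eval_lineRestrict]; simp
  set n : Fin 3 → Polynomial ℝ := fun i => Polynomial.C (n₀ i) with hndef
  set V : Fin 3 → Polynomial ℝ := fun i => lineRestrict p u (grad f i) with hV
  set H : Fin 3 → Fin 3 → Polynomial ℝ := fun i j => lineRestrict p u (grad (grad f j) i) with hH
  set U : Fin 3 → Polynomial ℝ := fun i => Polynomial.C (u i) with hU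
  have hV0 : ∀ i, (V i).eval 0 = n₀ i := fun i => hev _
  have hφ' : Polynomial.derivative (lineRestrict p u f) = U ⬝ᵥ V := derivative_lineRestrict p u f
  have hnn : n ⬝ᵥ n = Polynomial.C (n₀ ⬝ᵥ n₀) := by simp [dotProduct, hndef]
  have hUn : U ⬝ᵥ n = 0 := by
    have : U ⬝ᵥ n = Polynomial.C (u ⬝ᵥ n₀) := by simp [dotProduct, hndef, hU]
    rw [this, hu, map_zero]
  have hunit : IsUnit (n ⬝ᵥ n) := by
    rw [hnn]
    exact Polynomial.isUnit_C.2 hpos.ne'.isUnit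
  have hcop : ∀ k : ℕ, IsCoprime (Polynomial.X ^ k : Polynomial ℝ) ((V ⬝ᵥ n) ^ 2) := by
    intro k
    refine IsCoprime.pow ((Polynomial.irreducible_X.coprime_iff_not_dvd).2 ?_)
    rw [Polynomial.X_dvd_iff, Polynomial.coeff_zero_eq_eval_zero]
    have : (V ⬝ᵥ n).eval 0 = n₀ ⬝ᵥ n₀ := by
      simp [dotProduct, Polynomial.eval_finsetSum, hV0, hndef]
    rw [this]
    exact hpos.ne'
  set b : Fin 3 → ℝ := fun i => (n₀ ⬝ᵥ n₀)⁻¹ * crossProduct n₀ u i with hb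
  have hbn : crossProduct (fun i => Polynomial.C (b i)) n = U := by
    have e : crossProduct b n₀ = u := by
      have h1 : ∀ i, (n₀ ⬝ᵥ n₀) * crossProduct b n₀ i = (n₀ ⬝ᵥ n₀) * u i := by
        intro i
        have h2 : crossProduct b n₀ = fun i => (n₀ ⬝ᵥ n₀)⁻¹ * crossProduct (crossProduct n₀ u) n₀ i := by
          have : b = (n₀ ⬝ᵥ n₀)⁻¹ • crossProduct n₀ u := rfl
          rw [this, map_smul, LinearMap.smul_apply]
          rfl
        rw [h2, dotProduct_self_mul_eq u n₀ i, hu, zero_mul, zero_add, mul_inv_cancel_left₀ hpos.ne']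
        fin_cases i <;> simp [cross_apply] <;> ring
      ext i
      exact mul_left_cancel₀ hpos.ne' (h1 i)
    have := map_crossProduct (Polynomial.C : ℝ →+* Polynomial ℝ) b n₀
    rw [e] at this
    exact this.symm
  have key : ∀ k : ℕ, Polynomial.X ^ k ∣ lineRestrict p u f ∧
      ∀ i, Polynomial.X ^ k ∣ crossProduct V n i := by
    intro k
    induction k with
    | zero => simp
    | succ k ih =>
      obtain ⟨ih1, ih2⟩ := ih
      constructor
      · refine X_pow_succ_dvd_of_derivative (by rw [hev, hp]) ?_
        rw [hφ', ← hunit.dvd_mul_left]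
        have e : (n ⬝ᵥ n) * (U ⬝ᵥ V) = (V ⬝ᵥ n) * (U ⬝ᵥ n) +
            ∑ i, U i * crossProduct n (crossProduct V n) i := by
          change (n ⬝ᵥ n) * ∑ i, U i * V i = (V ⬝ᵥ n) * ∑ i, U i * n i + _
          rw [Finset.mul_sum, Finset.mul_sum, ← Finset.sum_add_distrib]
          refine Finset.sum_congr rfl fun i _ => ?_
          linear_combination U i * dotProduct_self_mul_eq V n i
        rw [e, hUn, mul_zero, zero_add]
        exact Finset.dvd_sum fun i _ => (dvd_cross ih2 n i).mul_left _
      · have hmain : ∀ a : Fin 3 → ℝ,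
            Polynomial.X ^ (k + 1) ∣ crossProduct (fun i => Polynomial.C (a i)) n ⬝ᵥ V := by
          intro a
          have hCC := map_crossProduct (Polynomial.C : ℝ →+* Polynomial ℝ) a n₀
          rw [← hndef] at hCC
          refine X_pow_succ_dvd_of_derivative ?_ ?_
          · have : (crossProduct (fun i => Polynomial.C (a i)) n ⬝ᵥ V).eval 0 =
                crossProduct a n₀ ⬝ᵥ n₀ := by
              rw [← hCC]
              simp [dotProduct, Polynomial.eval_finsetSum, hV0]
            rw [this, dotProduct_comm, dot_cross_self]
          · have e : Polynomial.derivative (crossProduct (fun i => Polynomial.C (a i)) n ⬝ᵥ V) =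
                bilin H (crossProduct (fun i => Polynomial.C (a i)) n) U := by
              rw [← hCC]
              simp only [dotProduct, map_sum, Polynomial.derivative_C_mul, hV,
                derivative_lineRestrict, bilin]
              refine Finset.sum_congr rfl fun i _ => ?_
              rw [Finset.mul_sum]
              refine Finset.sum_congr rfl fun j _ => ?_
              rw [hH, hU]
              simp only
              rw [grad_comm f i j]
              ring
            rw [e]
            have h1 := map_dvd (lineRestrict p u) (hf a b)
            have h2 : lineRestrict p u (tangentHessian f a b) =
                bilin H (crossProduct (fun i => Polynomial.C (a i)) V)
                  (crossProduct (fun i => Polynomial.C (b i)) V) := by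
              change (lineRestrict p u).toRingHom (tangentHessian f a b) = _
              rw [tangentHessian, map_bilin, map_crossProduct, map_crossProduct]
              simp [lineRestrict, hV, hH]
            rw [h2] at h1
            have h3 := dvd_bilin_normal H ih2 _ _ (ih1.trans h1)
            rw [hbn] at h3
            exact (hcop k).dvd_of_dvd_mul_left h3
        intro i
        have e : crossProduct V n i =
            -(crossProduct (fun j => Polynomial.C (Pi.single (M := fun _ => ℝ) i 1 j)) n ⬝ᵥ V) := by
          fin_cases i <;> simp [cross_apply, dotProduct, Fin.sum_univ_three] <;> ring
        rw [e]
        exact (hmain _).neg_right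
  ext k
  exact Polynomial.X_pow_dvd_iff.1 (key (k + 1)).1 k (Nat.lt_succ_self k)

/-- An irreducible surface of degree at least two containing three concurrent lines at every point
of a set has another polynomial of comparable degree vanishing on that set. -/
theorem exists_polynomial_vanishing_at_triple_points {f : MvPolynomial (Fin 3) ℝ}
    (hf : Irreducible f) (hd : 2 ≤ f.totalDegree) :
    ∃ q : MvPolynomial (Fin 3) ℝ, q.totalDegree ≤ 3 * f.totalDegree ∧ ¬ f ∣ q ∧
      ∀ x : Fin 3 → ℝ, ∀ l₁ l₂ l₃ : Set (Fin 3 → ℝ), IsLine l₁ → IsLine l₂ → IsLine l₃ →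
        l₁ ≠ l₂ → l₁ ≠ l₃ → l₂ ≠ l₃ → x ∈ l₁ → x ∈ l₂ → x ∈ l₃ →
        VanishesOn f l₁ → VanishesOn f l₂ → VanishesOn f l₃ → eval x q = 0 := by
  by_cases hdvd : ∀ a b, f ∣ tangentHessian f a b
  swap
  · push Not at hdvd
    obtain ⟨a, b, hab⟩ := hdvd
    exact ⟨_, totalDegree_tangentHessian_le f a b, hab,
      fun x l₁ l₂ l₃ h₁ h₂ h₃ n₁₂ n₁₃ n₂₃ m₁ m₂ m₃ v₁ v₂ v₃ =>
        eval_tangentHessian_eq_zero a b h₁ h₂ h₃ n₁₂ n₁₃ n₂₃ m₁ m₂ m₃ v₁ v₂ v₃⟩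
  have hsing : ∀ p, eval p f = 0 → (fun i => eval p (grad f i)) = 0 := by
    intro p hp
    by_contra hn
    set n := fun i => eval p (grad f i) with hndef
    have hpos := dotProduct_self_pos hn
    set h := affineForm n (n ⬝ᵥ p) with hh
    have hh0 : h ≠ 0 := by
      intro h0
      have h1 : eval (p + n) h = 0 := by rw [h0, map_zero]
      rw [hh, eval_affineForm] at h1
      have h2 : ∑ i, n i * (p + n) i = n ⬝ᵥ p + n ⬝ᵥ n := by
        rw [← dotProduct_add]; rfl
      rw [h2] at h1
      linarith
    have hrel : IsRelPrime f h := by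
      refine (hf.isRelPrime_iff_not_dvd).2 fun hfh => ?_
      have h1 := totalDegree_le_of_dvd_of_isDomain hfh hh0
      have h2 : h.totalDegree ≤ 1 := totalDegree_affineForm_le n (n ⬝ᵥ p)
      omega
    obtain ⟨c, hc⟩ : ∃ c, crossProduct c n ≠ 0 := by
      by_contra! hall
      obtain ⟨i, hi⟩ := Function.ne_iff.1 hn
      apply hn
      have e : ∀ i, crossProduct (Pi.single i 1) n = 0 := fun i => hall _
      have e0 := e 0
      have e1 := e 1
      simp [cross_apply] at e0 e1
      ext i
      fin_cases i <;> simp [e0, e1]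
    set e₁ := crossProduct c n with he₁
    set e₂ := crossProduct e₁ n with he₂
    have h₁ : e₁ ⬝ᵥ n = 0 := by rw [dotProduct_comm, dot_cross_self]
    have h₂ : e₂ ⬝ᵥ n = 0 := by rw [dotProduct_comm, dot_cross_self]
    have h₁₂ : e₂ ⬝ᵥ e₁ = 0 := by rw [dotProduct_comm, dot_self_cross]
    have hpos₁ := dotProduct_self_pos hc
    have hpos₂ : 0 < e₂ ⬝ᵥ e₂ := by
      have := cross_dot_cross e₁ n e₁ n
      rw [h₁] at this
      rw [he₂, this]
      nlinarith
    have hdir : ∀ t : ℝ, e₁ + t • e₂ ≠ 0 := by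
      intro t h0
      have := congrArg (fun w => e₁ ⬝ᵥ w) h0
      simp only [dotProduct_add, dotProduct_smul, dotProduct_zero, dotProduct_comm e₁ e₂, h₁₂,
        smul_zero, add_zero] at this
      exact hpos₁.ne' this
    let ℓ : ℝ → Set (Fin 3 → ℝ) := fun t => {y | ∃ r : ℝ, y = p + r • (e₁ + t • e₂)}
    have hinj : Function.Injective ℓ := by
      intro t t' htt
      have : p + (1 : ℝ) • (e₁ + t • e₂) ∈ ℓ t' := by
        rw [← htt]
        exact ⟨1, rfl⟩
      obtain ⟨r, hr⟩ := this
      have hr' := add_left_cancel hr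
      have a1 := congrArg (fun w => e₁ ⬝ᵥ w) hr'
      have a2 := congrArg (fun w => e₂ ⬝ᵥ w) hr'
      simp only [dotProduct_add, dotProduct_smul, dotProduct_comm e₁ e₂, h₁₂, smul_eq_mul, mul_zero,
        add_zero, zero_add, one_mul] at a1 a2
      have hr1 : r = 1 := by
        have : (r - 1) * (e₁ ⬝ᵥ e₁) = 0 := by linarith
        have := (mul_eq_zero.1 this).resolve_right hpos₁.ne'
        linarith
      rw [hr1, one_mul] at a2
      exact mul_right_cancel₀ hpos₂.ne' a2
    set L := (Finset.range (f.totalDegree + 1)).image fun k : ℕ => ℓ k with hLdef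
    have hcard : L.card = f.totalDegree + 1 := by
      have hinj' : Function.Injective fun k : ℕ => ℓ k := hinj.comp Nat.cast_injective
      rw [hLdef, Finset.card_image_of_injective _ hinj', Finset.card_range]
    have hb := card_common_lines_le hh0 hrel L (by
      intro l hl
      obtain ⟨k, -, rfl⟩ := Finset.mem_image.1 hl
      have horth : (e₁ + (k : ℝ) • e₂) ⬝ᵥ n = 0 := by
        rw [add_dotProduct, smul_dotProduct, h₁, h₂, smul_zero, add_zero]
      refine ⟨⟨_, _, hdir k, rfl⟩, ?_, ?_⟩
      · rw [← lineRestrict_eq_zero_iff]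
        exact lineRestrict_eq_zero_of_dvd hdvd hp hn horth
      · rintro _ ⟨r, rfl⟩
        rw [hh, eval_affineForm]
        change n ⬝ᵥ (p + r • (e₁ + (k : ℝ) • e₂)) - _ = 0
        rw [dotProduct_add, dotProduct_smul, dotProduct_comm n (e₁ + _), horth]
        simp)
    have : h.totalDegree ≤ 1 := totalDegree_affineForm_le n (n ⬝ᵥ p)
    have h3 : f.totalDegree * h.totalDegree ≤ f.totalDegree * 1 := Nat.mul_le_mul_left _ this
    omega
  obtain ⟨j, hj⟩ : ∃ j, grad f j ≠ 0 := by
    by_contra! hall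
    have hconst : f = C (eval 0 f) := by
      refine funext fun x => ?_
      rw [eval_C]
      have h1 := derivative_lineRestrict 0 x f
      simp only [hall, map_zero, mul_zero, Finset.sum_const_zero] at h1
      have h2 := Polynomial.eq_C_of_derivative_eq_zero h1
      have h3 := eval_lineRestrict 0 x f 1
      have h4 := eval_lineRestrict 0 x f 0
      rw [h2, Polynomial.eval_C] at h3 h4
      simp only [one_smul, zero_smul, zero_add] at h3 h4
      rw [← h3, ← h4]
    rw [hconst, totalDegree_C] at hd
    omega
  refine ⟨grad f j, (totalDegree_grad_le f j).trans (by omega), fun h => ?_, ?_⟩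
  · have h1 := totalDegree_le_of_dvd_of_isDomain h hj
    have h2 := totalDegree_grad f j hj
    omega
  · intro x l₁ _ _ _ _ _ _ _ _ m₁ _ _ v₁ _ _
    exact congrFun (hsing x (v₁ x m₁)) j

end RuledPoints

section Excess

open MvPolynomial

/-- The number of lines of `L` through `p`. -/
noncomputable def richness (L : Finset (Set (Fin 3 → ℝ))) (p : Fin 3 → ℝ) : ℕ :=
  (L.filter fun l => p ∈ l).card

/-- The number of incidences, where the first `K` lines through each point are not counted. -/
noncomputable def excess (K : ℕ) (P : Finset (Fin 3 → ℝ)) (L : Finset (Set (Fin 3 → ℝ))) : ℕ :=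
  ∑ p ∈ P, (richness L p - K)

variable {K : ℕ} {P P' : Finset (Fin 3 → ℝ)} {L L' : Finset (Set (Fin 3 → ℝ))}

lemma sum_richness (P : Finset (Fin 3 → ℝ)) (L : Finset (Set (Fin 3 → ℝ))) :
    ∑ p ∈ P, richness L p = ∑ l ∈ L, (P.filter fun p => p ∈ l).card :=
  Finset.sum_card_bipartiteAbove_eq_sum_card_bipartiteBelow _

lemma richness_mono (h : L ⊆ L') (p : Fin 3 → ℝ) : richness L p ≤ richness L' p :=
  Finset.card_le_card (Finset.filter_subset_filter _ h)

lemma richness_add_sdiff (h : L ⊆ L') (p : Fin 3 → ℝ) :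
    richness L' p = richness (L' \ L) p + richness L p := by
  unfold richness
  rw [← Finset.card_union_of_disjoint, ← Finset.filter_union, Finset.sdiff_union_of_subset h]
  exact Finset.disjoint_filter_filter Finset.sdiff_disjoint

lemma excess_mono_right (h : L ⊆ L') : excess K P L ≤ excess K P L' :=
  Finset.sum_le_sum fun p _ => Nat.sub_le_sub_right (richness_mono h p) K

lemma excess_mono_left (h : P ⊆ P') : excess K P L ≤ excess K P' L :=
  Finset.sum_le_sum_of_subset h

lemma excess_filter_add (q : (Fin 3 → ℝ) → Prop) (P : Finset (Fin 3 → ℝ))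
    (L : Finset (Set (Fin 3 → ℝ))) :
    excess K (P.filter q) L + excess K (P.filter fun p => ¬ q p) L = excess K P L :=
  Finset.sum_filter_add_sum_filter_not _ _ _

lemma excess_two_le_excess_one : excess 2 P L ≤ excess 1 P L :=
  Finset.sum_le_sum fun _ _ => by omega

lemma excess_le_sum_richness : excess K P L ≤ ∑ p ∈ P, richness L p :=
  Finset.sum_le_sum fun _ _ => Nat.sub_le _ _

lemma sum_richness_le_excess (K : ℕ) (P : Finset (Fin 3 → ℝ)) (L : Finset (Set (Fin 3 → ℝ))) :
    ∑ p ∈ P, richness L p ≤ excess K P L + K * P.card := by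
  have : K * P.card = ∑ p ∈ P, K := by simp [mul_comm]
  rw [this, excess, ← Finset.sum_add_distrib]
  exact Finset.sum_le_sum fun _ _ => by omega

lemma excess_le_add_of_subset (h : L' ⊆ L) : excess K P L ≤
    ∑ p ∈ P.filter (fun p => K < richness L p), richness (L \ L') p + excess K P L' := by
  rw [Finset.sum_filter, excess, excess, ← Finset.sum_add_distrib]
  refine Finset.sum_le_sum fun p _ => ?_
  have := richness_add_sdiff h p
  split_ifs <;> omega

lemma sum_richness_le_of_zeros {f : MvPolynomial (Fin 3) ℝ} {D : ℕ} (hD : f.totalDegree ≤ D)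
    (hP : ∀ p ∈ P, eval p f = 0) (hL : ∀ l ∈ L, IsLine l) (hfL : ∀ l ∈ L, ¬ VanishesOn f l) :
    ∑ p ∈ P, richness L p ≤ L.card * D := by
  rw [sum_richness]
  refine (Finset.sum_le_card_nsmul L _ D fun l hl => ?_).trans (by simp)
  refine le_trans ?_ ((card_zeros_le (hL l hl) (hfL l hl) P).trans hD)
  refine Finset.card_le_card fun p hp => ?_
  rw [Finset.mem_filter] at hp ⊢
  exact ⟨hp.1, hp.2, hP p hp.1⟩

lemma excess_one_le_sq (P : Finset (Fin 3 → ℝ)) (hL : ∀ l ∈ L, IsLine l) :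
    excess 1 P L ≤ L.card ^ 2 := by
  calc excess 1 P L ≤ ∑ p ∈ P, ((L.filter fun l => p ∈ l).offDiag).card := by
        refine Finset.sum_le_sum fun p _ => ?_
        rw [Finset.offDiag_card, richness]
        set r := (L.filter fun l => p ∈ l).card
        rcases r with _ | r
        · simp
        · rw [← Nat.mul_sub_one]
          exact Nat.le_mul_of_pos_left _ (Nat.succ_pos _)
    _ = (P.biUnion fun p => (L.filter fun l => p ∈ l).offDiag).card := by
        rw [Finset.card_biUnion]
        intro p _ p' _ hne
        rw [Function.onFun, Finset.disjoint_left]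
        rintro ⟨l, l'⟩ h h'
        simp only [Finset.mem_offDiag, Finset.mem_filter] at h h'
        exact h.2.2 ((hL l h.1.1).eq_of_mem (hL l' h.2.1.1) hne h.1.2 h'.1.2 h.2.1.2 h'.2.1.2)
    _ ≤ (L ×ˢ L).card := by
        refine Finset.card_le_card fun x hx => ?_
        simp only [Finset.mem_biUnion, Finset.mem_offDiag, Finset.mem_filter] at hx
        obtain ⟨p, -, h, h', -⟩ := hx
        exact Finset.mem_product.2 ⟨h.1, h'.1⟩
    _ = L.card ^ 2 := by rw [Finset.card_product, sq]

lemma sum_richness_le_sq_add (P : Finset (Fin 3 → ℝ)) (hL : ∀ l ∈ L, IsLine l) :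
    ∑ p ∈ P, richness L p ≤ P.card ^ 2 + L.card := by
  rw [sum_richness]
  calc ∑ l ∈ L, (P.filter fun p => p ∈ l).card
      ≤ ∑ l ∈ L, (((P.filter fun p => p ∈ l).offDiag).card + 1) := by
        refine Finset.sum_le_sum fun l _ => ?_
        rw [Finset.offDiag_card]
        set r := (P.filter fun p => p ∈ l).card
        rcases r with _ | r
        · simp
        · rw [← Nat.mul_sub_one]
          have : r ≤ (r + 1) * (r + 1 - 1) := Nat.le_mul_of_pos_left _ (Nat.succ_pos _)
          omega
    _ = (L.biUnion fun l => (P.filter fun p => p ∈ l).offDiag).card + L.card := by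
        rw [Finset.sum_add_distrib, Finset.card_biUnion]
        · simp
        intro l hl l' hl' hne
        rw [Function.onFun, Finset.disjoint_left]
        rintro ⟨p, p'⟩ h h'
        simp only [Finset.mem_offDiag, Finset.mem_filter] at h h'
        exact hne ((hL l hl).eq_of_mem (hL l' hl') h.2.2 h.1.2 h.2.1.2 h'.1.2 h'.2.1.2)
    _ ≤ (P ×ˢ P).card + L.card := by
        refine Nat.add_le_add_right (Finset.card_le_card fun x hx => ?_) _
        simp only [Finset.mem_biUnion, Finset.mem_offDiag, Finset.mem_filter] at hx
        obtain ⟨p, -, h, h', -⟩ := hx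
        exact Finset.mem_product.2 ⟨h.1, h'.1⟩
    _ = P.card ^ 2 + L.card := by rw [Finset.card_product, sq]

end Excess

section Planes

open MvPolynomial Matrix

lemma not_isUnit_of_eval_eq_zero {h : MvPolynomial (Fin 3) ℝ} {x : Fin 3 → ℝ}
    (hx : eval x h = 0) : ¬ IsUnit h := fun hu => by
  have := hu.map (eval x)
  rw [hx] at this
  exact not_isUnit_zero this

lemma irreducible_of_totalDegree_le_one {h : MvPolynomial (Fin 3) ℝ} (h0 : h ≠ 0)
    (hd : h.totalDegree ≤ 1) {x : Fin 3 → ℝ} (hx : eval x h = 0) : Irreducible h := by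
  refine ⟨not_isUnit_of_eval_eq_zero hx, fun u v huv => ?_⟩
  have hu0 : u ≠ 0 := fun h => h0 (by rw [huv, h, zero_mul])
  have hv0 : v ≠ 0 := fun h => h0 (by rw [huv, h, mul_zero])
  have hconst : ∀ w : MvPolynomial (Fin 3) ℝ, w ≠ 0 → w.totalDegree = 0 → IsUnit w := by
    intro w hw hw0
    rw [totalDegree_eq_zero_iff_eq_C] at hw0
    rw [hw0]
    refine IsUnit.map C (IsUnit.mk0 _ fun h => hw ?_)
    rw [hw0, h, C_0]
  rw [huv, totalDegree_mul_of_isDomain hu0 hv0] at hd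
  rcases Nat.eq_zero_or_pos u.totalDegree with h | h
  · exact Or.inl (hconst u hu0 h)
  · exact Or.inr (hconst v hv0 (by omega))

lemma eval_eq_of_totalDegree_le_one {f : MvPolynomial (Fin 3) ℝ} (hd : f.totalDegree ≤ 1)
    (x : Fin 3 → ℝ) : eval x f = ∑ i, eval 0 (grad f i) * x i + eval 0 f := by
  have h1 := Polynomial.eq_X_add_C_of_natDegree_le_one
    ((natDegree_lineRestrict_le 0 x f).trans hd)
  have h2 := derivative_lineRestrict 0 x f
  set φ := lineRestrict 0 x f with hφ
  have e1 := eval_lineRestrict 0 x f 1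
  have e0 := eval_lineRestrict 0 x f 0
  have e2 := congrArg (Polynomial.eval 0) h2
  rw [← hφ] at e1 e0
  rw [h1] at e0 e1 e2
  simp only [Polynomial.eval_finsetSum, Polynomial.eval_mul, eval_lineRestrict] at e2
  simp only [Polynomial.eval_add, Polynomial.eval_mul, Polynomial.eval_C, Polynomial.eval_X,
    one_smul, zero_smul, zero_add, mul_one, add_zero, mul_zero, map_add,
    Polynomial.derivative_mul, Polynomial.derivative_C, Polynomial.derivative_X, zero_mul] at e0 e1 e2
  rw [← e1, e2, e0]
  congr 1
  exact Finset.sum_congr rfl fun i _ => mul_comm _ _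

lemma isPlane_zeros {f : MvPolynomial (Fin 3) ℝ} (hd : f.totalDegree = 1) :
    IsPlane {x | eval x f = 0} := by
  have h1 := eval_eq_of_totalDegree_le_one hd.le
  refine ⟨fun i => eval 0 (grad f i), -eval 0 f, fun h0 => ?_, ?_⟩
  · have : f = C (eval 0 f) := by
      refine MvPolynomial.funext fun x => ?_
      rw [h1, eval_C]
      have := congrFun h0
      simp only [Pi.zero_apply] at this
      simp only [this, zero_mul, Finset.sum_const_zero, zero_add]
    rw [this, totalDegree_C] at hd
    omega
  · ext x
    simp only [Set.mem_ofPred_eq, h1 x]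
    exact ⟨fun h => by linarith, fun h => by linarith⟩

end Planes

section SzemerediTrotter

open MvPolynomial Matrix

lemma card_vanishing_lines_in_plane_le {a : Fin 3 → ℝ} {c : ℝ} {i₀ : Fin 3} (ha : a i₀ ≠ 0)
    {f : MvPolynomial (Fin 2) ℝ} (hf : f ≠ 0) (L : Finset (Set (Fin 3 → ℝ)))
    (hL : ∀ l ∈ L, IsLine l) (hplane : ∀ l ∈ L, l ⊆ {x | ∑ i, a i * x i = c})
    (hvan : ∀ l ∈ L, VanishesOn (rename i₀.succAbove f) l) :
    L.card ≤ f.totalDegree := by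
  set F := rename i₀.succAbove f with hF
  set h := affineForm a c with hh
  have hF0 : F ≠ 0 :=
    (map_ne_zero_iff _ (rename_injective _ Fin.succAbove_right_injective)).2 hf
  have hsolve : ∀ x : Fin 3 → ℝ, ∃ t, ∑ i, a i * Function.update x i₀ t i = c := by
    intro x
    refine ⟨(c - ∑ i : Fin 2, a (i₀.succAbove i) * x (i₀.succAbove i)) / a i₀, ?_⟩
    rw [Fin.sum_univ_succAbove _ i₀]
    simp only [Function.update_self, ne_eq, Fin.succAbove_ne, not_false_eq_true,
      Function.update_of_ne]
    field_simp
    ring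
  have hh0 : h ≠ 0 := by
    intro h0
    have e1 : eval 0 h = 0 := by rw [h0, map_zero]
    have e2 : eval (Pi.single i₀ 1) h = 0 := by rw [h0, map_zero]
    rw [hh, eval_affineForm] at e1 e2
    simp [Pi.single_apply] at e1 e2
    apply ha
    linarith
  have hirr : Irreducible h := by
    obtain ⟨t, ht⟩ := hsolve 0
    exact irreducible_of_totalDegree_le_one hh0 (totalDegree_affineForm_le a c)
      (x := Function.update 0 i₀ t) (by rw [hh, eval_affineForm, ht, sub_self])
  have hrel : IsRelPrime F h := by
    refine ((hirr.isRelPrime_iff_not_dvd).2 fun hdvd => hF0 ?_).symm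
    refine MvPolynomial.funext fun x => ?_
    obtain ⟨t, ht⟩ := hsolve x
    have e1 : eval (Function.update x i₀ t) F = eval x F := by
      rw [hF, eval_rename, eval_rename]
      congr 2
      ext i
      simp
    obtain ⟨g, hg⟩ := hdvd
    rw [← e1, hg, map_mul, hh, eval_affineForm, ht, sub_self, zero_mul, map_zero]
  have h1 := card_common_lines_le hh0 hrel L fun l hl => ⟨hL l hl, hvan l hl, fun x hx => by
    have : ∑ i, a i * x i = c := hplane l hl hx
    rw [hh, eval_affineForm, this, sub_self]⟩
  calc L.card ≤ F.totalDegree * h.totalDegree := h1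
    _ ≤ F.totalDegree * 1 := Nat.mul_le_mul_left _ (totalDegree_affineForm_le a c)
    _ ≤ f.totalDegree := by rw [mul_one]; exact totalDegree_rename_le _ _

lemma excess_plane_le (P : Finset (Fin 3 → ℝ)) (L : Finset (Set (Fin 3 → ℝ)))
    (hL : ∀ l ∈ L, IsLine l) {π : Set (Fin 3 → ℝ)} (hπ : IsPlane π) (hLπ : ∀ l ∈ L, l ⊆ π) (T : ℕ) :
    2 ^ (2 * T) * excess 1 P L ≤ 2 ^ (2 * T) * (L.card * (8 * 2 ^ T + 1) + L.card * (8 * 2 ^ T) +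
      (8 * 2 ^ T) ^ 2) + P.card ^ 2 := by
  obtain ⟨a, c, ha, rfl⟩ := hπ
  obtain ⟨i₀, hi₀⟩ := Function.ne_iff.1 ha
  obtain ⟨f, hf0, hfd, hcells⟩ := exists_partition (e := 2) (by norm_num) i₀.succAbove P L hL T
  have hD : 2 ^ 2 * 2 ^ (T + 1) = 8 * 2 ^ T := by rw [pow_succ]; ring
  rw [hD] at hfd hcells
  set F := rename i₀.succAbove f with hF
  have hFd : F.totalDegree ≤ 8 * 2 ^ T := (totalDegree_rename_le _ _).trans hfd
  set L₁ := L.filter fun l => VanishesOn F l with hL₁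
  have h1 : excess 1 P L ≤ ∑ l ∈ L, (P.filter fun x => x ∈ l ∧ eval x F ≠ 0).card +
      (L.card * (8 * 2 ^ T) + (8 * 2 ^ T) ^ 2) := by
    rw [← excess_filter_add (fun p => ¬ eval p F = 0) P L]
    refine Nat.add_le_add ?_ ?_
    · refine excess_le_sum_richness.trans ?_
      rw [sum_richness]
      refine Finset.sum_le_sum fun l _ => Finset.card_le_card fun x hx => ?_
      simp only [Finset.mem_filter] at hx ⊢
      exact ⟨hx.1.1, hx.2, hx.1.2⟩
    · simp only [not_not]
      refine (excess_le_add_of_subset (Finset.filter_subset (fun l => VanishesOn F l) L)).trans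
        (Nat.add_le_add ?_ ?_)
      · refine (sum_richness_le_of_zeros hFd ?_ ?_ ?_).trans
          (Nat.mul_le_mul_right _ (Finset.card_le_card Finset.sdiff_subset))
        · intro p hp
          exact (Finset.mem_filter.1 (Finset.mem_filter.1 hp).1).2
        · intro l hl
          exact hL l (Finset.mem_sdiff.1 hl).1
        · intro l hl h
          obtain ⟨h1, h2⟩ := Finset.mem_sdiff.1 hl
          exact h2 (Finset.mem_filter.2 ⟨h1, h⟩)
      · refine (excess_one_le_sq _ fun l hl => hL l (Finset.mem_filter.1 hl).1).trans
          (Nat.pow_le_pow_left ?_ 2)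
        exact (card_vanishing_lines_in_plane_le hi₀ hf0 _ (fun l hl => hL l (Finset.mem_filter.1 hl).1)
          (fun l hl => hLπ l (Finset.mem_filter.1 hl).1) fun l hl => (Finset.mem_filter.1 hl).2).trans
          hfd
  calc _ ≤ 2 ^ (2 * T) * _ := Nat.mul_le_mul_left _ h1
    _ ≤ _ := by
      rw [mul_add]
      have := Nat.add_le_add_right hcells (2 ^ (2 * T) * (L.card * (8 * 2 ^ T) + (8 * 2 ^ T) ^ 2))
      refine this.trans (le_of_eq ?_)
      ring

lemma exists_dyadic (k : ℕ) (hk : 0 < k) {n M : ℝ} (hn : 0 < n) (hnM : n ≤ M) :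
    ∃ T : ℕ, n * (2 ^ T) ^ k ≤ M ∧ M < 2 ^ k * (n * (2 ^ T) ^ k) := by
  obtain ⟨T, h1, h2⟩ := exists_nat_pow_near (x := M / n) (y := (2 : ℝ) ^ k)
    ((one_le_div hn).2 hnM) (one_lt_pow₀ one_lt_two hk.ne')
  refine ⟨T, ?_, ?_⟩
  · rw [le_div_iff₀ hn] at h1
    rw [← pow_mul, mul_comm T k, pow_mul]
    linarith
  · rw [div_lt_iff₀ hn, pow_succ] at h2
    rw [← pow_mul, mul_comm T k, pow_mul]
    linarith

/-- **Szemerédi–Trotter** for points and lines in a plane of `ℝ³`. -/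
theorem excess_plane_le_of_cube (P : Finset (Fin 3 → ℝ)) (L : Finset (Set (Fin 3 → ℝ)))
    (hL : ∀ l ∈ L, IsLine l) {π : Set (Fin 3 → ℝ)} (hπ : IsPlane π) (hLπ : ∀ l ∈ L, l ⊆ π)
    {X : ℝ} (hX : 0 ≤ X) (hX3 : (P.card : ℝ) ^ 2 * (L.card : ℝ) ^ 2 ≤ X ^ 3) :
    (excess 1 P L : ℝ) ≤ 88 * X + 2 * L.card := by
  set m : ℝ := (P.card : ℝ) with hm
  set n : ℝ := (L.card : ℝ) with hn
  have hm0 : 0 ≤ m := Nat.cast_nonneg _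
  have hn0 : 0 ≤ n := Nat.cast_nonneg _
  have hsq : (excess 1 P L : ℝ) ≤ n ^ 2 := by
    rw [hn]
    exact_mod_cast excess_one_le_sq P hL
  rcases Finset.eq_empty_or_nonempty L with rfl | hne
  · simp [excess, richness]
    positivity
  have hn1 : 1 ≤ n := by rw [hn]; exact_mod_cast hne.card_pos
  rcases lt_or_ge (m ^ 2) n with h | h
  · have : (excess 1 P L : ℝ) ≤ m ^ 2 + n := by
      rw [hm, hn]
      exact_mod_cast excess_le_sum_richness.trans (sum_richness_le_sq_add P hL)
    linarith
  rcases le_or_gt (n ^ 2) m with h' | h'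
  · have : n ^ 2 ≤ X := by
      refine le_of_pow_le_pow_left₀ (n := 3) (by norm_num) hX (le_trans ?_ hX3)
      calc (n ^ 2) ^ 3 = (n ^ 2) ^ 2 * n ^ 2 := by ring
        _ ≤ m ^ 2 * n ^ 2 := by gcongr
    linarith
  obtain ⟨T, h1, h2⟩ := exists_dyadic 3 (by norm_num) (by linarith : 0 < n) h
  have key : (2 : ℝ) ^ (2 * T) * excess 1 P L ≤ 2 ^ (2 * T) * (n * (8 * 2 ^ T + 1) +
      n * (8 * 2 ^ T) + (8 * 2 ^ T) ^ 2) + m ^ 2 := by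
    rw [hm, hn]
    exact_mod_cast excess_plane_le P L hL hπ hLπ T
  have hΔ1 : (1 : ℝ) ≤ 2 ^ T := one_le_pow₀ one_le_two
  rw [mul_comm 2 T, pow_mul] at key
  generalize (2 : ℝ) ^ T = Δ at *
  have hnΔ : n * Δ ≤ X := by
    refine le_of_pow_le_pow_left₀ (n := 3) (by norm_num) hX (le_trans ?_ hX3)
    calc (n * Δ) ^ 3 = n * Δ ^ 3 * n ^ 2 := by ring
      _ ≤ m ^ 2 * n ^ 2 := by gcongr
  have hΔn : Δ ≤ n := by
    refine le_of_pow_le_pow_left₀ (n := 3) (by norm_num) hn0 ?_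
    have : n * Δ ^ 3 ≤ n * n ^ 3 := by
      calc n * Δ ^ 3 ≤ m ^ 2 := h1
        _ ≤ (n ^ 2) ^ 2 := by gcongr
        _ = n * n ^ 3 := by ring
    exact le_of_mul_le_mul_left this (by linarith)
  have hΔ2 : Δ ^ 2 ≤ X := by nlinarith
  have hm2 : m ^ 2 ≤ Δ ^ 2 * (8 * X) := by
    calc m ^ 2 ≤ Δ ^ 2 * (8 * (n * Δ)) := by linarith
      _ ≤ _ := by gcongr
  have : Δ ^ 2 * excess 1 P L ≤ Δ ^ 2 * (88 * X + 2 * n) := by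
    calc Δ ^ 2 * (excess 1 P L : ℝ)
        ≤ Δ ^ 2 * (n * (8 * Δ + 1) + n * (8 * Δ) + (8 * Δ) ^ 2) + Δ ^ 2 * (8 * X) := by linarith
      _ = Δ ^ 2 * (16 * (n * Δ) + n + 64 * Δ ^ 2 + 8 * X) := by ring
      _ ≤ Δ ^ 2 * (88 * X + 2 * n) := mul_le_mul_of_nonneg_left (by linarith) (by positivity)
  exact le_of_mul_le_mul_left this (by positivity)

end SzemerediTrotter

section Surface

open MvPolynomial

/-- Removing from the lines on an irreducible surface those lying on a second surface. -/
lemma excess_two_irreducible_le {g : MvPolynomial (Fin 3) ℝ} (hg : Irreducible g)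
    (hd : 2 ≤ g.totalDegree) (P : Finset (Fin 3 → ℝ)) (L : Finset (Set (Fin 3 → ℝ)))
    (hL : ∀ l ∈ L, IsLine l ∧ VanishesOn g l) :
    ∃ L₁ ⊆ L, L₁.card ≤ 3 * g.totalDegree ^ 2 ∧
      excess 2 P L ≤ L.card * (3 * g.totalDegree) + excess 2 P L₁ := by
  obtain ⟨q, hqd, hqg, hq⟩ := exists_polynomial_vanishing_at_triple_points hg hd
  have hq0 : q ≠ 0 := fun h => hqg (h ▸ dvd_zero g)
  refine ⟨L.filter fun l => VanishesOn q l, Finset.filter_subset _ _, ?_, ?_⟩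
  · refine (card_common_lines_le hq0 ((hg.isRelPrime_iff_not_dvd).2 hqg) _ fun l hl => ?_).trans ?_
    · obtain ⟨h1, h2⟩ := Finset.mem_filter.1 hl
      exact ⟨(hL l h1).1, (hL l h1).2, h2⟩
    · calc g.totalDegree * q.totalDegree ≤ g.totalDegree * (3 * g.totalDegree) :=
          Nat.mul_le_mul_left _ hqd
        _ = 3 * g.totalDegree ^ 2 := by ring
  · refine (excess_le_add_of_subset (Finset.filter_subset (fun l => VanishesOn q l) L)).trans
      (Nat.add_le_add_right ?_ _)
    refine (sum_richness_le_of_zeros hqd ?_ ?_ ?_).trans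
          (Nat.mul_le_mul_right _ (Finset.card_le_card Finset.sdiff_subset))
    · intro p hp
      obtain ⟨-, hp⟩ := Finset.mem_filter.1 hp
      obtain ⟨l₁, l₂, l₃, h1, h2, h3, h12, h13, h23⟩ := Finset.two_lt_card_iff.1 hp
      rw [Finset.mem_filter] at h1 h2 h3
      exact hq p l₁ l₂ l₃ (hL _ h1.1).1 (hL _ h2.1).1 (hL _ h3.1).1 h12 h13 h23 h1.2 h2.2 h3.2
        (hL _ h1.1).2 (hL _ h2.1).2 (hL _ h3.1).2
    · intro l hl
      exact (hL l (Finset.mem_sdiff.1 hl).1).1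
    · intro l hl h
      obtain ⟨h1, h2⟩ := Finset.mem_sdiff.1 hl
      exact h2 (Finset.mem_filter.2 ⟨h1, h⟩)

lemma excess_two_factor_le {g : MvPolynomial (Fin 3) ℝ} (hg : Irreducible g) {s : ℕ} {α β : ℝ}
    (hα : 0 ≤ α) (hβ : 0 ≤ β)
    (hαβ : ∀ x y : ℝ, 0 ≤ x → 0 ≤ y → s * x * y ^ 2 ≤ (α * x + β * y) ^ 3)
    (P : Finset (Fin 3 → ℝ)) (L : Finset (Set (Fin 3 → ℝ)))
    (hL : ∀ l ∈ L, IsLine l ∧ VanishesOn g l)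
    (hs : ∀ π : Set (Fin 3 → ℝ), IsPlane π → (L.filter (fun l => l ⊆ π)).card ≤ s) :
    ∃ L₁ ⊆ L, L₁.card ≤ 3 * g.totalDegree ^ 2 ∧
      (excess 2 P L : ℝ) ≤ 3 * L.card * g.totalDegree + 88 * (α * L.card + β * P.card) +
        2 * L.card + excess 2 P L₁ := by
  rcases Nat.lt_or_ge g.totalDegree 2 with hlt | hge
  · have h1 : g.totalDegree = 1 := by
      have : g.totalDegree ≠ 0 := by
        intro h0
        rw [totalDegree_eq_zero_iff_eq_C] at h0
        apply hg.not_isUnit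
        rw [h0]
        refine IsUnit.map C (IsUnit.mk0 _ fun h => hg.ne_zero ?_)
        rw [h0, h, C_0]
      omega
    have hπ := isPlane_zeros h1
    have hLπ : ∀ l ∈ L, l ⊆ {x | eval x g = 0} := fun l hl x hx => (hL l hl).2 x hx
    have hcard := hs _ hπ
    rw [Finset.filter_true_of_mem hLπ] at hcard
    have hcard' : (L.card : ℝ) ≤ s := by exact_mod_cast hcard
    refine ⟨∅, Finset.empty_subset _, by simp, ?_⟩
    have hST := excess_plane_le_of_cube P L (fun l hl => (hL l hl).1) hπ hLπ
      (X := α * L.card + β * P.card) (by positivity) (by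
        refine le_trans ?_ (hαβ L.card P.card (by positivity) (by positivity))
        have : (P.card : ℝ) ^ 2 * (L.card : ℝ) ^ 2 = L.card * L.card * P.card ^ 2 := by ring
        rw [this]
        gcongr)
    have h12 : (excess 2 P L : ℝ) ≤ excess 1 P L := by exact_mod_cast excess_two_le_excess_one
    have h3 : (0 : ℝ) ≤ 3 * L.card * g.totalDegree := by positivity
    have h4 : (0 : ℝ) ≤ excess 2 P ∅ := by positivity
    linarith
  · obtain ⟨L₁, h1, h2, h3⟩ := excess_two_irreducible_le hg hge P L hL
    refine ⟨L₁, h1, h2, ?_⟩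
    have h3' : (excess 2 P L : ℝ) ≤ L.card * (3 * g.totalDegree) + excess 2 P L₁ := by
      exact_mod_cast h3
    have h4 : 0 ≤ 88 * (α * L.card + β * P.card) + 2 * L.card := by positivity
    linarith

lemma excess_two_surface_induction {s N : ℕ} {α β : ℝ} (hα : 0 ≤ α) (hβ : 0 ≤ β)
    (hαβ : ∀ x y : ℝ, 0 ≤ x → 0 ≤ y → s * x * y ^ 2 ≤ (α * x + β * y) ^ 3)
    (f : MvPolynomial (Fin 3) ℝ) : f ≠ 0 →
    ∀ (P : Finset (Fin 3 → ℝ)) (L : Finset (Set (Fin 3 → ℝ))),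
    (∀ p ∈ P, eval p f = 0) → (∀ l ∈ L, IsLine l) → L.card ≤ N →
    (∀ π : Set (Fin 3 → ℝ), IsPlane π → (L.filter (fun l => l ⊆ π)).card ≤ s) →
    ∃ L₁ ⊆ L, L₁.card ≤ 3 * f.totalDegree ^ 2 ∧
      (excess 2 P L : ℝ) ≤ 4 * N * f.totalDegree + 88 * (α * L.card + β * P.card) +
        2 * L.card + excess 2 P L₁ := by
  induction f using WfDvdMonoid.induction_on_irreducible with
  | zero => exact fun h => absurd rfl h
  | unit f hf =>
    intro _ P L hP _ _ _
    have : P = ∅ := Finset.eq_empty_of_forall_notMem fun p hp =>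
      not_isUnit_of_eval_eq_zero (hP p hp) hf
    subst this
    refine ⟨∅, Finset.empty_subset _, by simp, ?_⟩
    simp only [excess, Finset.sum_empty, Nat.cast_zero]
    positivity
  | mul h g hh0 hg ih =>
    intro _ P L hP hL hN hs
    set Pg := P.filter fun p => eval p g = 0 with hPg
    set P' := P.filter fun p => ¬ eval p g = 0 with hP'
    set Lg := L.filter fun l => VanishesOn g l with hLg
    set L' := L \ Lg with hL'
    have hsub : ∀ M ⊆ L, ∀ π : Set (Fin 3 → ℝ), IsPlane π → (M.filter (fun l => l ⊆ π)).card ≤ s :=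
      fun M hM π hπ => (Finset.card_le_card (Finset.filter_subset_filter _ hM)).trans (hs π hπ)
    have hLgL : Lg ⊆ L := Finset.filter_subset _ _
    have hL'L : L' ⊆ L := Finset.sdiff_subset
    obtain ⟨A, hA, hAcard, hAex⟩ := excess_two_factor_le hg hα hβ hαβ Pg Lg
      (fun l hl => ⟨hL l (hLgL hl), (Finset.mem_filter.1 hl).2⟩) (hsub Lg hLgL)
    obtain ⟨B, hB, hBcard, hBex⟩ := ih hh0 P' L' (fun p hp => by
        obtain ⟨h1, h2⟩ := Finset.mem_filter.1 hp
        have := hP p h1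
        rw [map_mul] at this
        exact (mul_eq_zero.1 this).resolve_left h2)
      (fun l hl => hL l (hL'L hl)) ((Finset.card_le_card hL'L).trans hN) (hsub L' hL'L)
    have hdeg : (g * h).totalDegree = g.totalDegree + h.totalDegree :=
      totalDegree_mul_of_isDomain hg.ne_zero hh0
    have hLcard : Lg.card + L'.card = L.card := by
      rw [hL', add_comm]
      exact Finset.card_sdiff_add_card_eq_card hLgL
    have hPcard : Pg.card + P'.card = P.card := Finset.card_filter_add_card_filter_not _
    have e1 : excess 2 P L = excess 2 Pg L + excess 2 P' L := (excess_filter_add _ P L).symm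
    have e2 : excess 2 P' L = excess 2 P' L' := by
      refine Finset.sum_congr rfl fun p hp => ?_
      have h0 : richness Lg p = 0 := by
        refine Finset.card_eq_zero.2 (Finset.filter_eq_empty_iff.2 fun l hl hpl => ?_)
        exact (Finset.mem_filter.1 hp).2 ((Finset.mem_filter.1 hl).2 p hpl)
      rw [richness_add_sdiff hLgL p, h0, add_zero]
    have e3 : excess 2 Pg L ≤ L.card * g.totalDegree + excess 2 Pg Lg := by
      refine (excess_le_add_of_subset hLgL).trans (Nat.add_le_add_right ?_ _)
      refine (sum_richness_le_of_zeros le_rfl ?_ ?_ ?_).trans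
          (Nat.mul_le_mul_right _ (Finset.card_le_card Finset.sdiff_subset))
      · intro p hp
        exact (Finset.mem_filter.1 (Finset.mem_filter.1 hp).1).2
      · intro l hl
        exact hL l (hL'L hl)
      · intro l hl hv
        obtain ⟨h1, h2⟩ := Finset.mem_sdiff.1 hl
        exact h2 (Finset.mem_filter.2 ⟨h1, hv⟩)
    have e4 : excess 2 Pg A + excess 2 P' B ≤ excess 2 P (A ∪ B) := by
      rw [← excess_filter_add (fun p => eval p g = 0) P (A ∪ B)]
      exact Nat.add_le_add (excess_mono_right Finset.subset_union_left)
        (excess_mono_right Finset.subset_union_right)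
    refine ⟨A ∪ B, Finset.union_subset (hA.trans hLgL) (hB.trans hL'L), ?_, ?_⟩
    · refine (Finset.card_union_le _ _).trans ?_
      rw [hdeg]
      nlinarith [Nat.zero_le (g.totalDegree * h.totalDegree)]
    · have e1' : (excess 2 P L : ℝ) = excess 2 Pg L + excess 2 P' L' := by
        rw [e1, e2]
        push_cast
        ring
      have e3' : (excess 2 Pg L : ℝ) ≤ L.card * g.totalDegree + excess 2 Pg Lg := by
        exact_mod_cast e3
      have e4' : (excess 2 Pg A + excess 2 P' B : ℝ) ≤ excess 2 P (A ∪ B) := by exact_mod_cast e4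
      have hLcard' : (Lg.card + L'.card : ℝ) = L.card := by exact_mod_cast hLcard
      have hPcard' : (Pg.card + P'.card : ℝ) = P.card := by exact_mod_cast hPcard
      have hNL : (L.card : ℝ) * g.totalDegree ≤ N * g.totalDegree := by gcongr
      have hNLg : (Lg.card : ℝ) * g.totalDegree ≤ N * g.totalDegree := by
        have : Lg.card ≤ N := (Finset.card_le_card hLgL).trans hN
        gcongr
      rw [hdeg, ← hLcard', ← hPcard', e1']
      push_cast
      linarith

lemma mul_sq_le_cube {u v : ℝ} (hu : 0 ≤ u) (hv : 0 ≤ v) :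
    u * v ^ 2 ≤ ((u + 2 * v) / 3) ^ 3 := by
  nlinarith [mul_nonneg (sq_nonneg (u - v)) (by linarith : 0 ≤ u + 8 * v)]

/-- Points on a surface of degree `D`: apart from `3 D ^ 2` lines, incidences with at least three
lines through a point are controlled. -/
theorem excess_two_surface_le {f : MvPolynomial (Fin 3) ℝ} (hf : f ≠ 0) {D : ℕ}
    (hD : f.totalDegree ≤ D) {s : ℕ} (P : Finset (Fin 3 → ℝ)) (L : Finset (Set (Fin 3 → ℝ)))
    (hP : ∀ p ∈ P, eval p f = 0) (hL : ∀ l ∈ L, IsLine l)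
    (hs : ∀ π : Set (Fin 3 → ℝ), IsPlane π → (L.filter (fun l => l ⊆ π)).card ≤ s)
    {Y : ℝ} (hY : 0 ≤ Y) (hY3 : (s : ℝ) * L.card * (P.card : ℝ) ^ 2 ≤ Y ^ 3) :
    ∃ L₁ ⊆ L, L₁.card ≤ 3 * D ^ 2 ∧
      (excess 2 P L : ℝ) ≤ 4 * L.card * D + 88 * Y + 2 * L.card + excess 2 P L₁ := by
  rcases Finset.eq_empty_or_nonempty P with rfl | hPne
  · refine ⟨∅, Finset.empty_subset _, by simp, ?_⟩
    simp only [excess, Finset.sum_empty, Nat.cast_zero]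
    positivity
  rcases Finset.eq_empty_or_nonempty L with rfl | hLne
  · refine ⟨∅, Finset.empty_subset _, by simp, ?_⟩
    simp
    positivity
  have hm : (0 : ℝ) < P.card := by exact_mod_cast hPne.card_pos
  have hn : (0 : ℝ) < L.card := by exact_mod_cast hLne.card_pos
  obtain ⟨L₁, h1, h2, h3⟩ := excess_two_surface_induction (s := s) (N := L.card)
    (α := Y / (3 * L.card)) (β := 2 * Y / (3 * P.card)) (by positivity) (by positivity)
    (by
      intro x y hx hy
      have e : (Y / (3 * L.card) * x + 2 * Y / (3 * P.card) * y) =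
          Y * ((x / L.card + 2 * (y / P.card)) / 3) := by
        field_simp
      rw [e, mul_pow]
      obtain ⟨u, hu⟩ : ∃ u, u = x / (L.card : ℝ) := ⟨_, rfl⟩
      obtain ⟨v, hv⟩ : ∃ v, v = y / (P.card : ℝ) := ⟨_, rfl⟩
      rw [← hu, ← hv]
      have hu0 : 0 ≤ u := hu ▸ div_nonneg hx hn.le
      have hv0 : 0 ≤ v := hv ▸ div_nonneg hy hm.le
      have hx' : x = u * L.card := by rw [hu, div_mul_cancel₀ _ hn.ne']
      have hy' : y = v * P.card := by rw [hv, div_mul_cancel₀ _ hm.ne']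
      have amgm := mul_sq_le_cube hu0 hv0
      calc (s : ℝ) * x * y ^ 2 = (s * L.card * (P.card : ℝ) ^ 2) * (u * v ^ 2) := by
            rw [hx', hy']; ring
        _ ≤ Y ^ 3 * ((u + 2 * v) / 3) ^ 3 := by gcongr)
    f hf P L hP hL le_rfl hs
  refine ⟨L₁, h1, h2.trans (by gcongr), h3.trans ?_⟩
  have e : Y / (3 * L.card) * L.card + 2 * Y / (3 * P.card) * P.card = Y := by
    field_simp
    ring
  rw [e]
  gcongr

end Surface

section DegreeReduction

open MvPolynomial

lemma exists_polynomial_vanishing_at_points {q : ℕ} (A : Finset (Fin 3 → ℝ))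
    (hA : A.card < (q + 1) ^ 3) :
    ∃ f : MvPolynomial (Fin 3) ℝ, f ≠ 0 ∧ f.totalDegree ≤ 3 * q ∧ ∀ x ∈ A, eval x f = 0 := by
  let φ : ((Fin 3 → Fin (q + 1)) → ℝ) →ₗ[ℝ] (A → ℝ) :=
    LinearMap.pi fun x => ∑ κ, (∏ i, x.1 i ^ (κ i : ℕ)) • LinearMap.proj κ
  have hφ : LinearMap.ker φ ≠ ⊥ := LinearMap.ker_ne_bot_of_finrank_lt (by simpa using hA)
  obtain ⟨c, hc, hc0⟩ := (Submodule.ne_bot_iff _).1 hφ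
  refine ⟨boxPoly c, boxPoly_ne_zero hc0, totalDegree_boxPoly_le c, fun x hx => ?_⟩
  have := congrFun (LinearMap.mem_ker.1 hc) ⟨x, hx⟩
  rw [eval_boxPoly]
  simpa [φ, mul_comm] using this

lemma exists_polynomial_vanishing_on_lines {q : ℕ} {L : Finset (Set (Fin 3 → ℝ))}
    (hL : ∀ l ∈ L, IsLine l) (hcard : L.card * (3 * q + 1) < (q + 1) ^ 3) :
    ∃ f : MvPolynomial (Fin 3) ℝ, f ≠ 0 ∧ f.totalDegree ≤ 3 * q ∧ ∀ l ∈ L, VanishesOn f l := by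
  have : ∀ l : Set (Fin 3 → ℝ), ∃ A : Finset (Fin 3 → ℝ),
      l ∈ L → (↑A ⊆ l ∧ A.card = 3 * q + 1) := by
    intro l
    by_cases hl : l ∈ L
    · obtain ⟨A, hA⟩ := (hL l hl).infinite.exists_subset_card_eq (3 * q + 1)
      exact ⟨A, fun _ => hA⟩
    · exact ⟨∅, fun h => absurd h hl⟩
  choose A hA using this
  obtain ⟨f, hf0, hfd, hf⟩ := exists_polynomial_vanishing_at_points (q := q) (L.biUnion A)
    (lt_of_le_of_lt (Finset.card_biUnion_le_card_mul _ _ _ fun l hl => (hA l hl).2.le) hcard)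
  refine ⟨f, hf0, hfd, fun l hl => (hL l hl).vanishesOn_of_card (A l) (fun x hx => ?_) ?_⟩
  · exact ⟨(hA l hl).1 hx, hf x (Finset.mem_biUnion.2 ⟨l, hl, hx⟩)⟩
  · rw [(hA l hl).2]
    omega

lemma richness_insert {T : Finset (Set (Fin 3 → ℝ))} {l : Set (Fin 3 → ℝ)} (hl : l ∉ T)
    (p : Fin 3 → ℝ) : richness (insert l T) p = richness T p + if p ∈ l then 1 else 0 := by
  unfold richness
  rw [Finset.filter_insert]
  split_ifs with h
  · rw [Finset.card_insert_of_notMem]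
    exact fun h' => hl (Finset.mem_filter.1 h').1
  · rfl

/-- If each line of `L` has many points where it meets other lines of `L`, then few lines
control the vanishing of low degree polynomials on all of `L`. -/
lemma exists_controlling_lines {D κ : ℕ} {L : Finset (Set (Fin 3 → ℝ))} (hL : ∀ l ∈ L, IsLine l)
    (Q : Finset (Fin 3 → ℝ)) (hQ : ∀ l ∈ L, D + κ ≤ (Q.filter fun x => x ∈ l).card)
    (hQ2 : ∀ x ∈ Q, 2 ≤ richness L x) :
    ∃ S ⊆ L, S.card * κ ≤ L.card * (D + 1) ∧
      ∀ f : MvPolynomial (Fin 3) ℝ, f.totalDegree ≤ D → (∀ l ∈ S, VanishesOn f l) →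
        ∀ l ∈ L, VanishesOn f l := by
  have key : ∀ k ≤ L.card, ∃ (T S : Finset (Set (Fin 3 → ℝ))) (U : Finset (Fin 3 → ℝ)),
      T.card = k ∧ T ⊆ L ∧ S ⊆ L ∧ U ⊆ Q ∧ (∀ u ∈ U, ∃ t ∈ T, u ∈ t) ∧
      (∀ f : MvPolynomial (Fin 3) ℝ, f.totalDegree ≤ D → (∀ l ∈ S, VanishesOn f l) →
        ∀ l ∈ T, VanishesOn f l) ∧
      (∀ l ∈ L, l ∉ T → (U.filter fun u => u ∈ l).card ≤ D + 1) ∧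
      S.card * κ ≤ U.card ∧
      (U.filter fun u => 2 ≤ richness T u).card ≤ T.card * (D + 1) := by
    intro k
    induction k with
    | zero => exact fun _ => ⟨∅, ∅, ∅, by simp⟩
    | succ k ih =>
      intro hk
      obtain ⟨T, S, U, hTk, hTL, hSL, hUQ, hUT, hST, hA, hB, hC⟩ := ih (by omega)
      by_cases hclose : ∃ l ∈ L, l ∉ T ∧ D < (Q.filter fun x => x ∈ l ∧ ∃ t ∈ T, x ∈ t).card
      · obtain ⟨l, hlL, hlT, hlD⟩ := hclose
        refine ⟨insert l T, S, U, by rw [Finset.card_insert_of_notMem hlT, hTk],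
          Finset.insert_subset hlL hTL, hSL, hUQ, ?_, ?_, ?_, hB, ?_⟩
        · intro u hu
          obtain ⟨t, ht, hut⟩ := hUT u hu
          exact ⟨t, Finset.mem_insert_of_mem ht, hut⟩
        · intro f hfD hfS l' hl'
          rcases Finset.mem_insert.1 hl' with rfl | hl'
          · refine (hL l' hlL).vanishesOn_of_card _ (fun x hx => ?_) (lt_of_le_of_lt hfD hlD)
            obtain ⟨-, h1, t, ht, hxt⟩ := Finset.mem_filter.1 hx
            exact ⟨h1, hST f hfD hfS t ht x hxt⟩
          · exact hST f hfD hfS l' hl'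
        · exact fun l' hl'L hl'T => hA l' hl'L fun h => hl'T (Finset.mem_insert_of_mem h)
        · have hsub : (U.filter fun u => 2 ≤ richness (insert l T) u) ⊆
              (U.filter fun u => 2 ≤ richness T u) ∪ U.filter fun u => u ∈ l := by
            intro u hu
            rw [Finset.mem_filter, richness_insert hlT] at hu
            rw [Finset.mem_union, Finset.mem_filter, Finset.mem_filter]
            by_cases h : u ∈ l
            · exact Or.inr ⟨hu.1, h⟩
            · rw [if_neg h] at hu
              exact Or.inl hu
          have := (Finset.card_le_card hsub).trans (Finset.card_union_le _ _)
          have := hA l hlL hlT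
          rw [Finset.card_insert_of_notMem hlT, add_mul]
          omega
      · push Not at hclose
        obtain ⟨l, hlL, hlT⟩ : ∃ l ∈ L, l ∉ T :=
          Finset.exists_mem_notMem_of_card_lt_card (by omega)
        set W := Q.filter fun x => x ∈ l ∧ ¬ ∃ t ∈ T, x ∈ t with hW
        have hdisj : Disjoint U W := by
          rw [Finset.disjoint_left]
          intro u hu hw
          exact (Finset.mem_filter.1 hw).2.2 (hUT u hu)
        have hWcard : κ ≤ W.card := by
          have h1 := hQ l hlL
          have h2 := hclose l hlL hlT
          have h3 : (Q.filter fun x => x ∈ l ∧ ∃ t ∈ T, x ∈ t).card + W.card =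
              (Q.filter fun x => x ∈ l).card := by
            rw [hW, ← Finset.filter_filter, ← Finset.filter_filter]
            exact Finset.card_filter_add_card_filter_not _
          omega
        refine ⟨insert l T, insert l S, U ∪ W, by rw [Finset.card_insert_of_notMem hlT, hTk],
          Finset.insert_subset hlL hTL, Finset.insert_subset hlL hSL,
          Finset.union_subset hUQ (Finset.filter_subset _ _), ?_, ?_, ?_, ?_, ?_⟩
        · intro u hu
          rcases Finset.mem_union.1 hu with hu | hu
          · obtain ⟨t, ht, hut⟩ := hUT u hu
            exact ⟨t, Finset.mem_insert_of_mem ht, hut⟩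
          · exact ⟨l, Finset.mem_insert_self _ _, (Finset.mem_filter.1 hu).2.1⟩
        · intro f hfD hfS l' hl'
          rcases Finset.mem_insert.1 hl' with rfl | hl'
          · exact hfS l' (Finset.mem_insert_self _ _)
          · exact hST f hfD (fun l hl => hfS l (Finset.mem_insert_of_mem hl)) l' hl'
        · intro l' hl'L hl'T
          rw [Finset.mem_insert, not_or] at hl'T
          have hsub : ((U ∪ W).filter fun u => u ∈ l') ⊆
              (Q.filter fun x => x ∈ l' ∧ ∃ t ∈ T, x ∈ t) ∪ W.filter fun u => u ∈ l' := by
            intro u hu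
            obtain ⟨h1, h2⟩ := Finset.mem_filter.1 hu
            rcases Finset.mem_union.1 h1 with h | h
            · exact Finset.mem_union_left _ (Finset.mem_filter.2 ⟨hUQ h, h2, hUT u h⟩)
            · exact Finset.mem_union_right _ (Finset.mem_filter.2 ⟨h, h2⟩)
          have h1 : (W.filter fun u => u ∈ l').card ≤ 1 := by
            refine Finset.card_le_one.2 fun x hx y hy => ?_
            rw [Finset.mem_filter, Finset.mem_filter] at hx hy
            by_contra hxy
            exact hl'T.1 ((hL l' hl'L).eq_of_mem (hL l hlL) hxy hx.2 hy.2 hx.1.2.1 hy.1.2.1)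
          have h2 := hclose l' hl'L hl'T.2
          have := (Finset.card_le_card hsub).trans (Finset.card_union_le _ _)
          omega
        · rw [Finset.card_union_of_disjoint hdisj]
          have := Nat.mul_le_mul_right κ (Finset.card_insert_le l S)
          rw [add_mul, one_mul] at this
          omega
        · have hsub : ((U ∪ W).filter fun u => 2 ≤ richness (insert l T) u) ⊆
              (U.filter fun u => 2 ≤ richness T u) ∪ U.filter fun u => u ∈ l := by
            intro u hu
            rw [Finset.mem_filter, richness_insert hlT, Finset.mem_union] at hu
            rw [Finset.mem_union, Finset.mem_filter, Finset.mem_filter]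
            obtain ⟨h | h, h2⟩ := hu
            · by_cases h' : u ∈ l
              · exact Or.inr ⟨h, h'⟩
              · rw [if_neg h'] at h2
                exact Or.inl ⟨h, h2⟩
            · have h0 : richness T u = 0 := by
                refine Finset.card_eq_zero.2 (Finset.filter_eq_empty_iff.2 fun t ht hut => ?_)
                exact (Finset.mem_filter.1 h).2.2 ⟨t, ht, hut⟩
              rw [h0] at h2
              split_ifs at h2 <;> omega
          have := (Finset.card_le_card hsub).trans (Finset.card_union_le _ _)
          have := hA l hlL hlT
          rw [Finset.card_insert_of_notMem hlT, add_mul]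
          omega
  obtain ⟨T, S, U, hTk, hTL, hSL, hUQ, -, hST, -, hB, hC⟩ := key _ le_rfl
  obtain rfl : T = L := Finset.eq_of_subset_of_card_le hTL hTk.ge
  refine ⟨S, hSL, hB.trans ?_, hST⟩
  rwa [Finset.filter_true_of_mem fun u hu => hQ2 u (hUQ hu)] at hC

lemma exists_polynomial_of_rich_lines {q : ℕ} (hq : 0 < q) {L : Finset (Set (Fin 3 → ℝ))}
    (hL : ∀ l ∈ L, IsLine l) (hcard : L.card ≤ 864 * q ^ 2) (Q : Finset (Fin 3 → ℝ))
    (hQ : ∀ l ∈ L, 13827 * q ≤ (Q.filter fun x => x ∈ l).card)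
    (hQ2 : ∀ x ∈ Q, 2 ≤ richness L x) :
    ∃ f : MvPolynomial (Fin 3) ℝ, f ≠ 0 ∧ f.totalDegree ≤ 3 * q ∧ ∀ l ∈ L, VanishesOn f l := by
  obtain ⟨S, hSL, hS, hcontrol⟩ := exists_controlling_lines (D := 3 * q) (κ := 13824 * q) hL Q
    (fun l hl => le_trans (by omega) (hQ l hl)) hQ2
  obtain ⟨f, hf0, hfd, hf⟩ := exists_polynomial_vanishing_on_lines (q := q)
    (fun l hl => hL l (hSL hl)) (by
      have h1 : S.card * (13824 * q) ≤ 864 * q ^ 2 * (3 * q + 1) :=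
        hS.trans (Nat.mul_le_mul_right _ hcard)
      have h2 : S.card * 16 ≤ q * (3 * q + 1) := by
        refine Nat.le_of_mul_le_mul_left (c := 864 * q) ?_ (by positivity)
        calc 864 * q * (S.card * 16) = S.card * (13824 * q) := by ring
          _ ≤ 864 * q ^ 2 * (3 * q + 1) := h1
          _ = 864 * q * (q * (3 * q + 1)) := by ring
      have h3 : 3 * q + 1 ≤ 4 * q := by omega
      have h4 : 16 * (S.card * (3 * q + 1)) ≤ 16 * q ^ 3 := by
        calc 16 * (S.card * (3 * q + 1)) = S.card * 16 * (3 * q + 1) := by ring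
          _ ≤ q * (4 * q) * (4 * q) := Nat.mul_le_mul (h2.trans (Nat.mul_le_mul_left _ h3)) h3
          _ = 16 * q ^ 3 := by ring
      have h5 : q ^ 3 < (q + 1) ^ 3 := Nat.pow_lt_pow_left (by omega) (by norm_num)
      omega)
  exact ⟨f, hf0, hfd, hcontrol f hfd hf⟩

/-- Removal of the lines with few points on at least three lines. -/
lemma exists_rich_subset (P : Finset (Fin 3 → ℝ)) (τ : ℕ) (L : Finset (Set (Fin 3 → ℝ))) :
    ∃ L' ⊆ L, excess 2 P L ≤ L.card * τ + excess 2 P L' ∧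
      ∀ l ∈ L', τ ≤ ((P.filter fun x => 2 < richness L' x).filter fun x => x ∈ l).card := by
  induction L using Finset.strongInduction with
  | H L ih =>
    by_cases h : ∀ l ∈ L, τ ≤ ((P.filter fun x => 2 < richness L x).filter fun x => x ∈ l).card
    · exact ⟨L, subset_rfl, Nat.le_add_left _ _, h⟩
    · push Not at h
      obtain ⟨l, hl, hlτ⟩ := h
      obtain ⟨L', hL', hex, hrich⟩ := ih (L.erase l) (Finset.erase_ssubset hl)
      refine ⟨L', hL'.trans (Finset.erase_subset _ _), ?_, hrich⟩
      have h1 : excess 2 P L ≤ τ + excess 2 P (L.erase l) := by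
        refine (excess_le_add_of_subset (Finset.erase_subset l L)).trans
          (Nat.add_le_add_right (le_trans ?_ hlτ.le) _)
        rw [sum_richness, Finset.sdiff_erase_self hl, Finset.sum_singleton]
      have h2 : L.card = (L.erase l).card + 1 := (Finset.card_erase_add_one hl).symm
      rw [h2, add_mul, one_mul]
      omega

end DegreeReduction

section MainInduction

open MvPolynomial

variable {s : ℕ} {P : Finset (Fin 3 → ℝ)} {L : Finset (Set (Fin 3 → ℝ))} {X Y : ℝ}

/-- The partitioning step, for few points. -/
lemma excess_two_reduce_of_few_points (hL : ∀ l ∈ L, IsLine l)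
    (hs : ∀ π : Set (Fin 3 → ℝ), IsPlane π → (L.filter (fun l => l ⊆ π)).card ≤ s)
    (hX : 0 ≤ X) (hX4 : (L.card : ℝ) ^ 3 * (P.card : ℝ) ^ 2 ≤ X ^ 4)
    (hY : 0 ≤ Y) (hY3 : (s : ℝ) * L.card * (P.card : ℝ) ^ 2 ≤ Y ^ 3)
    (hn : 0 < L.card) (hnm : (L.card : ℝ) ≤ (P.card : ℝ) ^ 2)
    (hmn : (7776 : ℝ) ^ 2 * (P.card : ℝ) ^ 2 ≤ (L.card : ℝ) ^ 3) :
    ∃ L₁ ⊆ L, 8 * L₁.card ≤ L.card ∧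
      (excess 2 P L : ℝ) ≤ 106 * X + 88 * Y + 3 * L.card + excess 2 P L₁ := by
  have hn' : (0 : ℝ) < L.card := by exact_mod_cast hn
  obtain ⟨T, hT1, hT2⟩ := exists_dyadic 4 (by norm_num) hn' hnm
  obtain ⟨f, hf0, hfd, hcells⟩ := exists_partition (e := 3) (by norm_num) id P L hL T
  rw [show 3 ^ 2 * 2 ^ (T + 1) = 18 * 2 ^ T by ring] at hfd hcells
  simp only [rename_id_apply] at hcells
  obtain ⟨δ, hδ⟩ : ∃ δ : ℕ, δ = 2 ^ T := ⟨_, rfl⟩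
  have hδR : (2 : ℝ) ^ T = δ := by rw [hδ]; push_cast; rfl
  rw [hδR] at hT1 hT2
  rw [pow_mul' 2 3 T, ← hδ] at hcells
  rw [← hδ] at hfd
  have hδ0 : 0 < δ := by rw [hδ]; positivity
  have hδ0' : (0 : ℝ) < δ := by exact_mod_cast hδ0
  have hnδ : (L.card : ℝ) * δ ≤ X := by
    refine le_of_pow_le_pow_left₀ (n := 4) (by norm_num) hX (le_trans ?_ hX4)
    calc ((L.card : ℝ) * δ) ^ 4 = (L.card : ℝ) ^ 3 * (L.card * (δ : ℝ) ^ 4) := by ring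
      _ ≤ _ := mul_le_mul_of_nonneg_left hT1 (by positivity)
  obtain ⟨L₁, h1, h2, h3⟩ := excess_two_surface_le hf0 hfd (P.filter fun p => eval p f = 0) L
    (fun p hp => (Finset.mem_filter.1 hp).2) hL hs hY (le_trans (by
      have : (P.filter fun p => eval p f = 0).card ≤ P.card := Finset.card_filter_le _ _
      gcongr) hY3)
  have hoff : (excess 2 (P.filter fun p => ¬ eval p f = 0) L : ℝ) ≤ 34 * X + L.card := by
    have e1 : excess 2 (P.filter fun p => ¬ eval p f = 0) L ≤
        ∑ l ∈ L, (P.filter fun x => x ∈ l ∧ eval x f ≠ 0).card := by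
      refine excess_le_sum_richness.trans ?_
      rw [sum_richness]
      refine Finset.sum_le_sum fun l _ => ?_
      rw [Finset.filter_filter]
      refine Finset.card_le_card fun x hx => ?_
      rw [Finset.mem_filter] at hx ⊢
      exact ⟨hx.1, hx.2.2, hx.2.1⟩
    have e2 : ((∑ l ∈ L, (P.filter fun x => x ∈ l ∧ eval x f ≠ 0).card : ℕ) : ℝ) ≤
        34 * (L.card * δ) + L.card := by
      refine le_of_mul_le_mul_left ?_ (by positivity : (0 : ℝ) < (δ : ℝ) ^ 3)
      have : ((δ ^ 3 * ∑ l ∈ L, (P.filter fun x => x ∈ l ∧ eval x f ≠ 0).card : ℕ) : ℝ) ≤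
          ((δ ^ 3 * (L.card * (18 * δ + 1)) + P.card ^ 2 : ℕ) : ℝ) := by exact_mod_cast hcells
      rw [Nat.cast_mul, Nat.cast_pow] at this
      refine this.trans ?_
      push_cast
      linarith
    have e1' : (excess 2 (P.filter fun p => ¬ eval p f = 0) L : ℝ) ≤
      ((∑ l ∈ L, (P.filter fun x => x ∈ l ∧ eval x f ≠ 0).card : ℕ) : ℝ) := by exact_mod_cast e1
    linarith
  refine ⟨L₁, h1, ?_, ?_⟩
  · have h4 : (7776 : ℝ) * (δ : ℝ) ^ 2 ≤ L.card := by
      refine le_of_pow_le_pow_left₀ (n := 2) (by norm_num) hn'.le ?_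
      refine le_of_mul_le_mul_left ?_ hn'
      calc (L.card : ℝ) * (7776 * (δ : ℝ) ^ 2) ^ 2 = 7776 ^ 2 * (L.card * (δ : ℝ) ^ 4) := by ring
        _ ≤ 7776 ^ 2 * (P.card : ℝ) ^ 2 := mul_le_mul_of_nonneg_left hT1 (by norm_num)
        _ ≤ (L.card : ℝ) ^ 3 := hmn
        _ = L.card * (L.card : ℝ) ^ 2 := by ring
    have h5 : 7776 * δ ^ 2 ≤ L.card := by exact_mod_cast h4
    have h6 : 3 * (18 * δ) ^ 2 = 972 * δ ^ 2 := by ring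
    omega
  · have e : (excess 2 P L : ℝ) = excess 2 (P.filter fun p => eval p f = 0) L +
        excess 2 (P.filter fun p => ¬ eval p f = 0) L := by
      exact_mod_cast (excess_filter_add (fun p => eval p f = 0) P L).symm
    have e' : (excess 2 (P.filter fun p => eval p f = 0) L₁ : ℝ) ≤ excess 2 P L₁ := by
      exact_mod_cast excess_mono_left (Finset.filter_subset _ _)
    push_cast at h3
    linarith

/-- The degree reduction step, for many points. -/
lemma excess_two_reduce_of_many_points (hL : ∀ l ∈ L, IsLine l)
    (hs : ∀ π : Set (Fin 3 → ℝ), IsPlane π → (L.filter (fun l => l ⊆ π)).card ≤ s)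
    (hX : 0 ≤ X) (hX4 : (L.card : ℝ) ^ 3 * (P.card : ℝ) ^ 2 ≤ X ^ 4)
    (hY : 0 ≤ Y) (hY3 : (s : ℝ) * L.card * (P.card : ℝ) ^ 2 ≤ Y ^ 3)
    (hn : 216 ≤ L.card) (hmn : (L.card : ℝ) ^ 3 ≤ (7776 : ℝ) ^ 2 * (P.card : ℝ) ^ 2) :
    ∃ L₁ ⊆ L, 8 * L₁.card ≤ L.card ∧
      (excess 2 P L : ℝ) ≤ 83034 * X + 88 * Y + 2 * L.card + excess 2 P L₁ := by
  obtain ⟨q, hq⟩ : ∃ q, q = Nat.sqrt (L.card / 216) := ⟨_, rfl⟩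
  have hq1 : 216 * q ^ 2 ≤ L.card := by
    have := Nat.sqrt_le' (L.card / 216)
    rw [← hq] at this
    omega
  have hq2 : L.card < 216 * (q + 1) ^ 2 := by
    have := Nat.lt_succ_sqrt' (L.card / 216)
    rw [← hq, Nat.succ_eq_add_one] at this
    omega
  have hq0 : 0 < q := by
    rcases Nat.eq_zero_or_pos q with rfl | h
    · norm_num at hq2
      omega
    · exact h
  have hq3 : L.card ≤ 864 * q ^ 2 := by nlinarith
  have hqX : (L.card : ℝ) * q ≤ 6 * X := by
    refine le_of_pow_le_pow_left₀ (n := 4) (by norm_num) (by positivity) ?_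
    have h1 : (216 : ℝ) * (q : ℝ) ^ 2 ≤ L.card := by exact_mod_cast hq1
    have h2 : (216 * (q : ℝ) ^ 2) ^ 2 ≤ (L.card : ℝ) ^ 2 := pow_le_pow_left₀ (by positivity) h1 2
    have h3 := mul_le_mul_of_nonneg_left hmn (by positivity : (0 : ℝ) ≤ (L.card : ℝ) ^ 3)
    have h4 := mul_le_mul_of_nonneg_left h2 (by positivity : (0 : ℝ) ≤ (L.card : ℝ) ^ 4)
    nlinarith
  obtain ⟨L', hL'L, hex, hrich⟩ := exists_rich_subset P (13827 * q) L
  have hL' : ∀ l ∈ L', IsLine l := fun l hl => hL l (hL'L hl)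
  have hcard : L'.card ≤ L.card := Finset.card_le_card hL'L
  set Q := P.filter fun x => 2 < richness L' x with hQ
  obtain ⟨f, hf0, hfd, hf⟩ := exists_polynomial_of_rich_lines hq0 hL' (hcard.trans hq3) Q hrich
    fun x hx => (Finset.mem_filter.1 hx).2.le
  obtain ⟨L₁, h1, h2, h3⟩ := excess_two_surface_le (s := s) hf0 hfd Q L'
    (fun p hp => by
      have hpos : 0 < richness L' p := lt_trans (by norm_num) (Finset.mem_filter.1 hp).2
      obtain ⟨l, hl⟩ := Finset.card_pos.1 hpos
      rw [Finset.mem_filter] at hl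
      exact hf l hl.1 p hl.2) hL'
    (fun π hπ => (Finset.card_le_card (Finset.filter_subset_filter _ hL'L)).trans (hs π hπ))
    hY (le_trans (by
      have : Q.card ≤ P.card := Finset.card_filter_le _ _
      gcongr) hY3)
  refine ⟨L₁, h1.trans hL'L, by nlinarith, ?_⟩
  have e1 : excess 2 P L' = excess 2 Q L' := by
    exact (Finset.sum_filter_of_ne fun p _ hp => by omega).symm
  have e2 : (excess 2 P L : ℝ) ≤ L.card * (13827 * q) + excess 2 Q L' := by
    rw [e1] at hex
    exact_mod_cast hex
  have e3 : (excess 2 Q L₁ : ℝ) ≤ excess 2 P L₁ := by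
    exact_mod_cast excess_mono_left (Finset.filter_subset _ _)
  have e4 : (L'.card : ℝ) ≤ L.card := by exact_mod_cast hcard
  have e5 : (L'.card : ℝ) * q ≤ L.card * q := by gcongr
  push_cast at h3
  linarith

lemma excess_two_reduce (hL : ∀ l ∈ L, IsLine l)
    (hs : ∀ π : Set (Fin 3 → ℝ), IsPlane π → (L.filter (fun l => l ⊆ π)).card ≤ s)
    (hX : 0 ≤ X) (hX4 : (L.card : ℝ) ^ 3 * (P.card : ℝ) ^ 2 ≤ X ^ 4)
    (hY : 0 ≤ Y) (hY3 : (s : ℝ) * L.card * (P.card : ℝ) ^ 2 ≤ Y ^ 3) :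
    ∃ L₁ ⊆ L, 8 * L₁.card ≤ L.card ∧
      (excess 2 P L : ℝ) ≤ 83034 * (X + Y + L.card) + excess 2 P L₁ := by
  have hnR : (0 : ℝ) ≤ L.card := Nat.cast_nonneg _
  rcases lt_or_ge L.card 216 with hn | hn
  · refine ⟨∅, Finset.empty_subset _, by simp, ?_⟩
    have h1 : excess 2 P L ≤ 216 * L.card :=
      (excess_two_le_excess_one.trans (excess_one_le_sq P hL)).trans (by nlinarith)
    have h2 : (excess 2 P L : ℝ) ≤ 216 * L.card := by exact_mod_cast h1
    have h3 : (0 : ℝ) ≤ excess 2 P ∅ := Nat.cast_nonneg _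
    linarith
  rcases lt_or_ge ((P.card : ℝ) ^ 2) L.card with hnm | hnm
  · refine ⟨∅, Finset.empty_subset _, by simp, ?_⟩
    have h2 : (excess 2 P L : ℝ) ≤ (P.card : ℝ) ^ 2 + L.card := by
      exact_mod_cast excess_le_sum_richness.trans (sum_richness_le_sq_add P hL)
    have h3 : (0 : ℝ) ≤ excess 2 P ∅ := Nat.cast_nonneg _
    linarith
  rcases le_total ((7776 : ℝ) ^ 2 * (P.card : ℝ) ^ 2) ((L.card : ℝ) ^ 3) with h | h
  · obtain ⟨L₁, h1, h2, h3⟩ :=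
      excess_two_reduce_of_few_points hL hs hX hX4 hY hY3 (by omega) hnm h
    exact ⟨L₁, h1, h2, by linarith⟩
  · obtain ⟨L₁, h1, h2, h3⟩ := excess_two_reduce_of_many_points hL hs hX hX4 hY hY3 hn h
    exact ⟨L₁, h1, h2, by linarith⟩

theorem excess_two_le (L : Finset (Set (Fin 3 → ℝ))) : ∀ {X Y : ℝ}, (∀ l ∈ L, IsLine l) →
    (∀ π : Set (Fin 3 → ℝ), IsPlane π → (L.filter (fun l => l ⊆ π)).card ≤ s) →
    0 ≤ X → (L.card : ℝ) ^ 3 * (P.card : ℝ) ^ 2 ≤ X ^ 4 →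
    0 ≤ Y → (s : ℝ) * L.card * (P.card : ℝ) ^ 2 ≤ Y ^ 3 →
    (excess 2 P L : ℝ) ≤ 166068 * (X + Y + L.card) := by
  induction L using Finset.strongInduction with
  | H L ih =>
    intro X Y hL hs hX hX4 hY hY3
    rcases Finset.eq_empty_or_nonempty L with rfl | hne
    · simp only [excess, richness, Finset.filter_empty, Finset.card_empty, zero_tsub,
        Finset.sum_const_zero, Nat.cast_zero]
      positivity
    obtain ⟨L₁, h1, h2, h3⟩ := excess_two_reduce hL hs hX hX4 hY hY3
    have hpos := hne.card_pos
    have h2' : (L₁.card : ℝ) ≤ L.card / 8 := by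
      have : (8 * L₁.card : ℝ) ≤ L.card := by exact_mod_cast h2
      linarith
    have hind := ih L₁ (h1.ssubset_of_ne fun h => by rw [h] at h2; omega) (X := X / 2) (Y := Y / 2)
      (fun l hl => hL l (h1 hl))
      (fun π hπ => (Finset.card_le_card (Finset.filter_subset_filter _ h1)).trans (hs π hπ))
      (by positivity) (by
        calc (L₁.card : ℝ) ^ 3 * (P.card : ℝ) ^ 2 ≤ (L.card / 8 : ℝ) ^ 3 * (P.card : ℝ) ^ 2 := by
              gcongr
          _ = ((L.card : ℝ) ^ 3 * (P.card : ℝ) ^ 2) / 512 := by ring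
          _ ≤ X ^ 4 / 512 := by gcongr
          _ ≤ (X / 2) ^ 4 := by nlinarith [pow_nonneg hX 4])
      (by positivity) (by
        calc (s : ℝ) * L₁.card * (P.card : ℝ) ^ 2 ≤ s * (L.card / 8) * (P.card : ℝ) ^ 2 := by
              gcongr
          _ = (s * L.card * (P.card : ℝ) ^ 2) / 8 := by ring
          _ ≤ Y ^ 3 / 8 := by gcongr
          _ = (Y / 2) ^ 3 := by ring)
    have hnR : (0 : ℝ) ≤ L.card := Nat.cast_nonneg _
    linarith

end MainInduction

/-- **Guth–Katz incidence theorem.** There is an absolute constant `C` such that for a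
finite set `P` of points and a finite set `L` of lines in `ℝ³` with at most `s ≤ |L|`
lines of `L` in any affine plane,
`I(P,L) ≤ C (|L|^{3/4}|P|^{1/2} + s^{1/3}|L|^{1/3}|P|^{2/3} + |L| + |P|)`. -/
theorem guth_katz_incidence_bound :
    ∃ C : ℝ, 0 < C ∧
      ∀ (P : Finset (Fin 3 → ℝ)) (L : Finset (Set (Fin 3 → ℝ))) (s : ℕ),
        (∀ l ∈ L, IsLine l) → s ≤ L.card →
        (∀ π : Set (Fin 3 → ℝ), IsPlane π → (L.filter (fun l => l ⊆ π)).card ≤ s) →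
        (((P ×ˢ L).filter (fun pl => pl.1 ∈ pl.2)).card : ℝ) ≤
          C * ((L.card : ℝ) ^ (3 / 4 : ℝ) * (P.card : ℝ) ^ (1 / 2 : ℝ) +
            (s : ℝ) ^ (1 / 3 : ℝ) * (L.card : ℝ) ^ (1 / 3 : ℝ) * (P.card : ℝ) ^ (2 / 3 : ℝ) +
            (L.card : ℝ) + (P.card : ℝ)) := by
  refine ⟨166068, by norm_num, fun P L s hL _ hs => ?_⟩
  have hrpow : ∀ (a k : ℕ) (r : ℝ) (j : ℕ), r * k = j →
      ((a : ℝ) ^ r) ^ k = (a : ℝ) ^ j := by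
    intro a k r j h
    rw [← Real.rpow_mul_natCast (Nat.cast_nonneg a), h, Real.rpow_natCast]
  have hbound := excess_two_le (s := s) (P := P) L
    (X := (L.card : ℝ) ^ (3 / 4 : ℝ) * (P.card : ℝ) ^ (1 / 2 : ℝ))
    (Y := (s : ℝ) ^ (1 / 3 : ℝ) * (L.card : ℝ) ^ (1 / 3 : ℝ) * (P.card : ℝ) ^ (2 / 3 : ℝ))
    hL hs (by positivity)
    (by
      rw [mul_pow, hrpow L.card 4 _ 3 (by norm_num), hrpow P.card 4 _ 2 (by norm_num)])
    (by positivity)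
    (by
      rw [mul_pow, mul_pow, hrpow s 3 _ 1 (by norm_num), hrpow L.card 3 _ 1 (by norm_num),
        hrpow P.card 3 _ 2 (by norm_num), pow_one, pow_one])
  have hinc : ((P ×ˢ L).filter (fun pl => pl.1 ∈ pl.2)).card = ∑ p ∈ P, richness L p := by
    rw [Finset.card_filter, Finset.sum_product]
    exact Finset.sum_congr rfl fun p _ => (Finset.card_filter _ _).symm
  have hsum : ((∑ p ∈ P, richness L p : ℕ) : ℝ) ≤ excess 2 P L + 2 * P.card := by
    exact_mod_cast sum_richness_le_excess 2 P L
  have hP : (0 : ℝ) ≤ P.card := Nat.cast_nonneg _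
  rw [hinc]
  linarith
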